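/- Let n−1 < q ≤ p < ∞, q̃ = q/(q−n+1), and −n/q < α < n/(q̃(n−1)). Let a homeomorphism φ : Ω → Ω̃ between domains Ω, Ω̃ ⊆ ℝⁿ (n ≥ 2) have the Luzin N-property and generate a bounded composition operator φ* : L¹_p(Ω̃) → L¹_q(Ω,|x|^α). Then the inverse mapping φ⁻¹ : Ω̃ → Ω generates a bounded composition operator (φ⁻¹)* : L¹_{q̃}(Ω,|x|^{α(1−n)}) → L¹_{p̃}(Ω̃), where p̃ = p/(p−n+1). -/

import Mathlib

open MeasureTheory Set Metric Filter ENNReal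

noncomputable section

/-- Euclidean space `ℝⁿ`. -/
abbrev En (n : ℕ) : Type := EuclideanSpace ℝ (Fin n)

/-- A domain: an open connected set. -/
def IsDomainSet {n : ℕ} (Ω : Set (En n)) : Prop := IsOpen Ω ∧ IsConnected Ω

/-- A weight: a nonnegative locally integrable function. -/
def IsWeight (n : ℕ) (w : En n → ℝ) : Prop :=
  (∀ x, 0 ≤ w x) ∧ LocallyIntegrable w volume

/-- The Muckenhoupt `A_p` condition for the function `u` (to be applied to `u = w^p`):
`sup_B (|B|⁻¹ ∫_B u)^{1/p} (|B|⁻¹ ∫_B u^{-1/(p-1)})^{1/p'} < ∞`. -/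
def IsMuckenhoupt (n : ℕ) (p : ℝ) (u : En n → ℝ) : Prop :=
  ∃ C : ℝ≥0∞, C ≠ ⊤ ∧ ∀ (x : En n) (r : ℝ), 0 < r →
    ((volume (ball x r))⁻¹ * ∫⁻ y in ball x r, ENNReal.ofReal (u y)) ^ (1 / p) *
      ((volume (ball x r))⁻¹ *
        ∫⁻ y in ball x r, ENNReal.ofReal (u y ^ (-(1 / (p - 1))))) ^ (1 - 1 / p) ≤ C

/-- `g` is a weak gradient of `f` on `Ω` (both locally integrable on `Ω`). -/
def IsWeakGradOn {n : ℕ} (Ω : Set (En n)) (f : En n → ℝ) (g : En n → En n) : Prop :=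
  LocallyIntegrableOn f Ω volume ∧ LocallyIntegrableOn g Ω volume ∧
    ∀ ψ : En n → ℝ, ContDiff ℝ (⊤ : ℕ∞) ψ → HasCompactSupport ψ → tsupport ψ ⊆ Ω →
      ∀ i : Fin n,
        ∫ x in Ω, f x * fderiv ℝ ψ x (EuclideanSpace.single i 1) = -∫ x in Ω, g x i * ψ x

/-- The weighted Sobolev seminorm `‖f | L¹_p(Ω,w)‖`, computed from a weak gradient `g` of `f`. -/
def gradNormLp {n : ℕ} (Ω : Set (En n)) (w : En n → ℝ) (p : ℝ) (g : En n → En n) : ℝ≥0∞ :=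
  (∫⁻ x in Ω, ENNReal.ofReal (‖g x‖ * w x) ^ p) ^ (1 / p)

/-- Operator (Euclidean) norm of an `n × n` matrix. -/
def opNorm {n : ℕ} (M : Matrix (Fin n) (Fin n) ℝ) : ℝ :=
  ‖Matrix.toEuclideanCLM (𝕜 := ℝ) M‖

/-- `Dφ` is the matrix of weak partial derivatives of the mapping `φ` on `Ω`
(row `i` is the weak gradient of the `i`-th coordinate function of `φ`). -/
def IsWeakJacobiOn {n : ℕ} (Ω : Set (En n)) (φ : En n → En n)
    (Dφ : En n → Matrix (Fin n) (Fin n) ℝ) : Prop :=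
  ∀ i : Fin n, IsWeakGradOn Ω (fun x => φ x i)
    (fun x => (EuclideanSpace.equiv (Fin n) ℝ).symm (Dφ x i))

/-- `φ ∈ L¹_q(Ω,w;Ω')`: weakly differentiable with Jacobi matrix `Dφ` and
`∫_Ω |Dφ|^q w^q dx < ∞`. -/
def MapInL1q {n : ℕ} (Ω : Set (En n)) (w : En n → ℝ) (q : ℝ) (φ : En n → En n)
    (Dφ : En n → Matrix (Fin n) (Fin n) ℝ) : Prop :=
  IsWeakJacobiOn Ω φ Dφ ∧ (∫⁻ x in Ω, ENNReal.ofReal (opNorm (Dφ x) * w x) ^ q) ≠ ⊤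

/-- Finite distortion: `Dφ(x) = 0` a.e. on the zero set of the Jacobian. -/
def HasFiniteDistortionOn {n : ℕ} (Ω : Set (En n))
    (Dφ : En n → Matrix (Fin n) (Fin n) ℝ) : Prop :=
  ∀ᵐ x ∂(volume.restrict Ω), (Dφ x).det = 0 → Dφ x = 0

/-- Luzin N-property: images of null subsets of `Ω` are null. -/
def LuzinN {n : ℕ} (Ω : Set (En n)) (φ : En n → En n) : Prop :=
  ∀ E, E ⊆ Ω → volume E = 0 → volume (φ '' E) = 0

/-- `φ` is a homeomorphism of `Ω` onto `Ω'` with inverse `ψ`. -/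
def IsHomeoOn {n : ℕ} (Ω Ω' : Set (En n)) (φ ψ : En n → En n) : Prop :=
  ContinuousOn φ Ω ∧ ContinuousOn ψ Ω' ∧ MapsTo φ Ω Ω' ∧ MapsTo ψ Ω' Ω ∧
    (∀ x ∈ Ω, ψ (φ x) = x) ∧ (∀ y ∈ Ω', φ (ψ y) = y)

/-- The homeomorphism `φ : Ω → Ω'` generates a composition operator
`φ* : L¹_p(Ω',w') → L¹_q(Ω,w)` bounded by the constant `K`. -/
def CompOpBound {n : ℕ} (Ω Ω' : Set (En n)) (φ : En n → En n) (p : ℝ) (w' : En n → ℝ)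
    (q : ℝ) (w : En n → ℝ) (K : ℝ≥0∞) : Prop :=
  ∀ f gf, ContinuousOn f Ω' → IsWeakGradOn Ω' f gf → gradNormLp Ω' w' p gf ≠ ⊤ →
    ∃ g, IsWeakGradOn Ω (f ∘ φ) g ∧ gradNormLp Ω w q g ≤ K * gradNormLp Ω' w' p gf

/-- The homeomorphism `φ : Ω → Ω'` generates a bounded composition operator
`φ* : L¹_p(Ω',w') → L¹_q(Ω,w)`. -/
def BddCompOp {n : ℕ} (Ω Ω' : Set (En n)) (φ : En n → En n) (p : ℝ) (w' : En n → ℝ)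
    (q : ℝ) (w : En n → ℝ) : Prop :=
  ∃ K : ℝ≥0∞, K ≠ ⊤ ∧ CompOpBound Ω Ω' φ p w' q w K

/-- Smooth compactly supported functions with support in `U`. -/
def IsTest {n : ℕ} (U : Set (En n)) (u : En n → ℝ) : Prop :=
  ContDiff ℝ (⊤ : ℕ∞) u ∧ HasCompactSupport u ∧ tsupport u ⊆ U

/-- The `i`-th partial derivative. -/
def pd {n : ℕ} (i : Fin n) (f : En n → ℝ) (x : En n) : ℝ :=
  fderiv ℝ f x (EuclideanSpace.single i 1)

/-- `g` is the `i`-th weak partial derivative of `f` on `U`. -/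
def IsWeakPd {n : ℕ} (U : Set (En n)) (i : Fin n) (f g : En n → ℝ) : Prop :=
  ∀ u, IsTest U u → ∫ x in U, f x * pd i u x = -∫ x in U, g x * u x

section Basic
variable {n : ℕ} {U V : Set (En n)} {u v : En n → ℝ}

lemma IsTest.mono (h : IsTest U u) (hUV : U ⊆ V) : IsTest V u :=
  ⟨h.1, h.2.1, h.2.2.trans hUV⟩

lemma IsTest.continuous (h : IsTest U u) : Continuous u := h.1.continuous

lemma IsTest.differentiable (h : IsTest U u) : Differentiable ℝ u :=
  h.1.differentiable (by simp)

lemma pd_contDiff (h : ContDiff ℝ (⊤ : ℕ∞) u) (i : Fin n) : ContDiff ℝ (⊤ : ℕ∞) (pd i u) :=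
  (h.fderiv_right (m := (⊤ : ℕ∞)) (by simp)).clm_apply contDiff_const

lemma pd_continuous_of_one (h : ContDiff ℝ 1 u) (i : Fin n) : Continuous (pd i u) :=
  (h.continuous_fderiv (by simp)).clm_apply continuous_const

lemma tsupport_pd (i : Fin n) : tsupport (pd i u) ⊆ tsupport u := by
  refine (closure_mono ?_).trans (tsupport_fderiv_subset ℝ (f := u))
  intro x hx hx'
  apply hx
  simp only [pd]
  rw [hx']; simp

lemma pd_eq_zero_of_notMem {i : Fin n} {x : En n} (hx : x ∉ tsupport u) : pd i u x = 0 :=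
  image_eq_zero_of_notMem_tsupport (fun h => hx (tsupport_pd i h))

lemma IsTest.pd (h : IsTest U u) (i : Fin n) : IsTest U (pd i u) :=
  ⟨pd_contDiff h.1 i, h.2.1.mono' ((subset_tsupport _).trans (tsupport_pd i)),
    (tsupport_pd i).trans h.2.2⟩

lemma IsTest.mul_left (h : IsTest U u) (hv : ContDiff ℝ (⊤ : ℕ∞) v) :
    IsTest U (fun x => v x * u x) :=
  ⟨hv.mul h.1, h.2.1.mul_left, (tsupport_mul_subset_right (f := v) (g := u)).trans h.2.2⟩

lemma IsTest.mul_right (h : IsTest U u) (hv : ContDiff ℝ (⊤ : ℕ∞) v) :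
    IsTest U (fun x => u x * v x) :=
  ⟨h.1.mul hv, h.2.1.mul_right, (tsupport_mul_subset_left (f := u) (g := v)).trans h.2.2⟩

lemma IsTest.add (h : IsTest U u) (hv : IsTest U v) : IsTest U (fun x => u x + v x) :=
  ⟨h.1.add hv.1, h.2.1.add hv.2.1, (tsupport_add u v).trans (union_subset h.2.2 hv.2.2)⟩

lemma pd_mul {i : Fin n} {x : En n} (hu : DifferentiableAt ℝ u x) (hv : DifferentiableAt ℝ v x) :
    pd i (fun x => u x * v x) x = u x * pd i v x + pd i u x * v x := by
  simp only [pd]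
  rw [fderiv_fun_mul hu hv]
  simp; ring

lemma pd_add {i : Fin n} {x : En n} (hu : DifferentiableAt ℝ u x) (hv : DifferentiableAt ℝ v x) :
    pd i (fun x => u x + v x) x = pd i u x + pd i v x := by
  simp only [pd]
  rw [fderiv_fun_add hu hv]
  simp

lemma pd_sub {i : Fin n} {x : En n} (hu : DifferentiableAt ℝ u x) (hv : DifferentiableAt ℝ v x) :
    pd i (fun x => u x - v x) x = pd i u x - pd i v x := by
  simp only [pd]
  rw [fderiv_fun_sub hu hv]
  simp

lemma pd_congr {i : Fin n} {x : En n} (h : u =ᶠ[nhds x] v) : pd i u x = pd i v x := by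
  simp only [pd]; rw [h.fderiv_eq]

lemma fderiv_eq_sum (x h : En n) : fderiv ℝ u x h = ∑ i, h i * pd i u x := by
  have : h = ∑ i, h i • EuclideanSpace.single i (1:ℝ) := by
    ext j
    simp [Finset.sum_apply, Pi.single_apply]
  conv_lhs => rw [this]
  rw [map_sum]
  simp [pd]

lemma pd_coord (i j : Fin n) (x : En n) : pd i (fun y : En n => y j) x = if j = i then 1 else 0 := by
  have : (fun y : En n => y j) = (EuclideanSpace.proj j : En n →L[ℝ] ℝ) := by ext; simp
  simp only [pd]
  rw [this, ContinuousLinearMap.fderiv]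
  simp

lemma contDiff_coord (j : Fin n) : ContDiff ℝ (⊤ : ℕ∞) (fun y : En n => y j) := by
  have : (fun y : En n => y j) = (EuclideanSpace.proj j : En n →L[ℝ] ℝ) := by ext; simp
  rw [this]; exact ContinuousLinearMap.contDiff _

lemma abs_coord_le (y : En n) (j : Fin n) : |y j| ≤ ‖y‖ := by
  simpa using PiLp.norm_apply_le y j

lemma norm_le_sum (y : En n) : ‖y‖ ≤ ∑ j, |y j| := by
  have h : y = ∑ i, y i • EuclideanSpace.single i (1:ℝ) := by
    ext j
    simp [Finset.sum_apply, Pi.single_apply]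
  conv_lhs => rw [h]
  refine (norm_sum_le _ _).trans ?_
  simp [norm_smul]

lemma exists_cutoff {K : Set (En n)} (hK : IsCompact K) (hU : IsOpen U) (hKU : K ⊆ U) :
    ∃ χ : En n → ℝ, IsTest U χ ∧ (∀ x, 0 ≤ χ x ∧ χ x ≤ 1) ∧
      ∃ W, IsOpen W ∧ K ⊆ W ∧ ∀ x ∈ W, χ x = 1 := by
  obtain ⟨L, hL, hKL, hLU⟩ := exists_compact_between hK hU hKU
  obtain ⟨L', hL', hLL', hLU'⟩ := exists_compact_between hL hU hLU
  obtain ⟨f, hf1, hf0, hf⟩ := exists_contMDiffMap_one_nhds_of_subset_interior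
    (modelWithCornersSelf ℝ (En n)) (n := (⊤ : ℕ∞)) hK.isClosed hKL
  have hs : Function.support f ⊆ L := by
    intro x hx; by_contra h; exact hx (hf0 x h)
  have hts : tsupport f ⊆ L := closure_minimal hs hL.isClosed
  refine ⟨f, ⟨f.contMDiff.contDiff, HasCompactSupport.intro hL (fun x hx => hf0 x hx),
    hts.trans hLU⟩, fun x => ⟨(hf x).1, (hf x).2⟩, ?_⟩
  obtain ⟨W, hW, hKW, hW'⟩ := mem_nhdsSet_iff_exists.1 hf1
  exact ⟨W, hW, hKW, hW'⟩

lemma integral_pd_mul (h : ContDiff ℝ 1 u) (hv : ContDiff ℝ 1 v) (hc : HasCompactSupport v)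
    (i : Fin n) : ∫ x, u x * pd i v x = -∫ x, pd i u x * v x := by
  have hpc : HasCompactSupport (pd i v) := hc.mono' ((subset_tsupport _).trans (tsupport_pd i))
  apply integral_mul_fderiv_eq_neg_fderiv_mul_of_integrable
  · exact ((pd_continuous_of_one h i).mul hv.continuous).integrable_of_hasCompactSupport
      hc.mul_left
  · exact (h.continuous.mul (pd_continuous_of_one hv i)).integrable_of_hasCompactSupport
      hpc.mul_left
  · exact (h.continuous.mul hv.continuous).integrable_of_hasCompactSupport hc.mul_left
  · exact fun x _ => h.differentiable (by simp) x
  · exact fun x _ => hv.differentiable (by simp) x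

lemma setIntegral_eq_integral_of_tsupport {f : En n → ℝ} (h : tsupport f ⊆ U) :
    ∫ x in U, f x = ∫ x, f x :=
  setIntegral_eq_integral_of_forall_compl_eq_zero
    (fun _ hx => image_eq_zero_of_notMem_tsupport (fun h' => hx (h h')))

lemma setIntegral_mul_test {f : En n → ℝ} (h : tsupport u ⊆ U) :
    ∫ x in U, f x * u x = ∫ x, f x * u x :=
  setIntegral_eq_integral_of_tsupport ((tsupport_mul_subset_right (f := f) (g := u)).trans h)

lemma isWeakPd_of_contDiff (h : ContDiff ℝ 1 u) (i : Fin n) : IsWeakPd U i u (pd i u) := by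
  intro v hv
  rw [setIntegral_mul_test ((hv.pd i).2.2), setIntegral_mul_test hv.2.2]
  exact integral_pd_mul h (hv.1.of_le (by simp)) hv.2.1 i

lemma IsWeakPd.mono {i : Fin n} (h : IsWeakPd U i u v) (hVU : V ⊆ U) : IsWeakPd V i u v := by
  intro w hw
  have := h w (hw.mono hVU)
  rwa [setIntegral_mul_test (((hw.mono hVU).pd i).2.2), setIntegral_mul_test (hw.mono hVU).2.2,
    ← setIntegral_mul_test ((hw.pd i).2.2), ← setIntegral_mul_test hw.2.2] at this

lemma integrable_mul_of_integrableOn {K : Set (En n)} {g : En n → ℝ} (hK : IsCompact K)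
    (hg : IntegrableOn g K) (hu : Continuous u) (hs : ∀ x ∉ K, u x = 0) :
    Integrable (fun x => g x * u x) := by
  have := hg.mul_continuousOn (K := K) hu.continuousOn hK
  replace this := (integrable_indicator_iff hK.measurableSet).2 this
  refine this.congr (Eventually.of_forall fun x => ?_)
  by_cases hx : x ∈ K
  · simp [hx]
  · simp [hx, hs x hx]

lemma integrable_mul_of_locallyIntegrableOn {g : En n → ℝ} (hg : LocallyIntegrableOn g U)
    (hu : Continuous u) (hc : HasCompactSupport u) (hs : tsupport u ⊆ U) :
    Integrable (fun x => g x * u x) :=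
  integrable_mul_of_integrableOn hc (hg.integrableOn_compact_subset hs hc) hu
    (fun _ hx => image_eq_zero_of_notMem_tsupport hx)

/-- Uniqueness of weak derivatives. -/
lemma IsWeakPd.unique {i : Fin n} {f g g' : En n → ℝ} (hU : IsOpen U)
    (h : IsWeakPd U i f g) (h' : IsWeakPd U i f g')
    (hg : LocallyIntegrableOn g U) (hg' : LocallyIntegrableOn g' U) :
    ∀ᵐ x, x ∈ U → g x = g' x := by
  have key := hU.ae_eq_zero_of_integral_contDiff_smul_eq_zero (μ := volume) (hg.sub hg') ?_
  · filter_upwards [key] with x hx hxU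
    exact sub_eq_zero.1 (hx hxU)
  · intro v hv hc hs
    have hT : IsTest U v := ⟨hv, hc, hs⟩
    have e := (h v hT).symm.trans (h' v hT)
    rw [neg_inj, setIntegral_mul_test hs, setIntegral_mul_test hs] at e
    simp only [smul_eq_mul, Pi.sub_apply, mul_sub]
    simp only [mul_comm (v _)]
    rw [integral_sub (integrable_mul_of_locallyIntegrableOn hg hv.continuous hc hs)
      (integrable_mul_of_locallyIntegrableOn hg' hv.continuous hc hs), e, sub_self]

end Basic

/-- The Jacobi matrix. -/
def Jm {n : ℕ} (Φ : En n → En n) (x : En n) : Matrix (Fin n) (Fin n) ℝ :=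
  Matrix.of fun i j => pd j (fun y => Φ y i) x

section Piola
variable {n : ℕ}

lemma contDiff_comp_coord {k : WithTop ℕ∞} {Φ : En n → En n} (h : ContDiff ℝ k Φ) (i : Fin n) :
    ContDiff ℝ k (fun y => Φ y i) := by
  have : (fun y => Φ y i) = (EuclideanSpace.proj i : En n →L[ℝ] ℝ) ∘ Φ := by ext; simp
  rw [this]
  exact (ContinuousLinearMap.contDiff _).comp h

lemma fderiv_coord {Φ : En n → En n} {x : En n} (h : DifferentiableAt ℝ Φ x) (i : Fin n)
    (v : En n) : fderiv ℝ (fun y => Φ y i) x v = (fderiv ℝ Φ x v) i := by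
  have : (fun y => Φ y i) = (EuclideanSpace.proj i : En n →L[ℝ] ℝ) ∘ Φ := by ext; simp
  rw [this, fderiv_comp x (ContinuousLinearMap.differentiableAt _) h, ContinuousLinearMap.fderiv]
  simp

lemma det_fderiv_eq {Φ : En n → En n} {x : En n} (h : DifferentiableAt ℝ Φ x) :
    (fderiv ℝ Φ x).det = (Jm Φ x).det := by
  rw [ContinuousLinearMap.det, ← LinearMap.det_toMatrix (EuclideanSpace.basisFun (Fin n) ℝ).toBasis]
  congr 1
  ext i j
  simp [LinearMap.toMatrix_apply, Jm, pd, fderiv_coord h]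

lemma Jm_continuous {Φ : En n → En n} (h : ContDiff ℝ 1 Φ) : Continuous (Jm Φ) :=
  continuous_matrix fun i j => pd_continuous_of_one (contDiff_comp_coord h i) j

lemma Jm_eq_zero {Φ : En n → En n} {x : En n} (hx : x ∉ tsupport Φ) : Jm Φ x = 0 := by
  ext i j
  simp only [Jm, Matrix.of_apply, Matrix.zero_apply]
  apply pd_eq_zero_of_notMem
  intro h
  apply hx
  refine closure_mono ?_ h
  intro y hy hy'
  apply hy
  simp [hy']

/-- Lagrange extraction of the top coefficient of `t ↦ det (1 + t M)`. -/
lemma exists_det_eq_sum (hn : 0 < n) {t₀ : ℝ} (ht₀ : 0 < t₀) :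
    ∃ (t l : Fin (n + 1) → ℝ), (∀ k, 0 < t k ∧ t k < t₀) ∧ ∑ k, l k = 0 ∧
      ∀ M : Matrix (Fin n) (Fin n) ℝ, M.det = ∑ k, (1 + t k • M).det * l k := by
  set t : Fin (n + 1) → ℝ := fun k => t₀ * ((k : ℝ) + 1) / (n + 2) with ht
  have hinj : Set.InjOn t (Finset.univ : Finset (Fin (n+1))) := by
    intro a _ b _ hab
    simp only [ht] at hab
    have : (0:ℝ) < n + 2 := by positivity
    field_simp at hab
    ext
    have : (a : ℝ) = b := by linarith
    exact_mod_cast this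
  have key : ∀ p : Polynomial ℝ, p.natDegree ≤ n →
      p.coeff n = ∑ k, p.eval (t k) * (Lagrange.basis Finset.univ t k).coeff n := by
    intro p hp
    have hdeg : p.degree < (Finset.univ : Finset (Fin (n+1))).card := by
      refine (Polynomial.degree_le_natDegree).trans_lt ?_
      simp only [Finset.card_univ, Fintype.card_fin]
      exact_mod_cast Nat.lt_succ_of_le hp
    conv_lhs => rw [Lagrange.eq_interpolate hinj hdeg]
    rw [Lagrange.interpolate_apply, Polynomial.finsetSum_coeff]
    simp
  refine ⟨t, fun k => (Lagrange.basis Finset.univ t k).coeff n, fun k => ⟨by positivity, ?_⟩,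
    ?_, ?_⟩
  · simp only [ht]
    rw [div_lt_iff₀ (by positivity)]
    have : (k : ℝ) + 1 < n + 2 := by
      have := k.2
      have h2 : (k : ℝ) < n + 1 := by exact_mod_cast this
      linarith
    nlinarith
  · have := key 1 (by simp)
    simp only [Polynomial.eval_one, one_mul] at this
    rw [← this, Polynomial.coeff_one]
    simp [hn.ne']
  · intro M
    have h1 := Polynomial.natDegree_det_X_add_C_le M 1
    have h2 := Polynomial.coeff_det_X_add_C_card M 1
    simp only [Fintype.card_fin] at h1 h2
    rw [← h2, key _ h1]
    refine Finset.sum_congr rfl fun k _ => ?_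
    congr 1
    rw [← Polynomial.coe_evalRingHom, RingHom.map_det]
    congr 1
    ext i j
    simp [Matrix.one_apply, Matrix.map_apply]
    split_ifs <;> simp <;> ring

lemma integral_det_perturb {A : En n → En n} (hA : ContDiff ℝ 1 A)
    (hc : HasCompactSupport A) : ∃ R t₀ : ℝ, 0 < t₀ ∧ tsupport A ⊆ closedBall 0 R ∧
      ∀ t, 0 < t → t < t₀ → ∫ x in closedBall (0 : En n) R, (1 + t • Jm A x).det =
        volume.real (closedBall (0 : En n) R) := by
  obtain ⟨R, hR⟩ := (hc.isBounded).subset_closedBall (0 : En n)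
  set B := closedBall (0 : En n) R
  obtain ⟨C, hC⟩ := hA.lipschitzWith_of_hasCompactSupport hc (by simp)
  have hcont : Continuous fun z : ℝ × En n => (1 + z.1 • Jm A z.2).det :=
    (continuous_const.add (continuous_fst.smul ((Jm_continuous hA).comp continuous_snd))).matrix_det
  have hpos : ∀ᶠ t in nhds (0:ℝ), ∀ x ∈ B, 0 < (1 + t • Jm A x).det := by
    apply IsCompact.eventually_forall_of_forall_eventually (isCompact_closedBall _ _)
    intro x _
    exact hcont.continuousAt.eventually (lt_mem_nhds (by simp))
  obtain ⟨t₁, ht₁, hpos⟩ := Metric.eventually_nhds_iff.1 hpos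
  refine ⟨R, min t₁ (1 / (C + 1)), lt_min ht₁ (by positivity), hR, ?_⟩
  intro t ht htt
  have hd : ∀ x ∈ B, 0 < (1 + t • Jm A x).det := by
    apply hpos
    rw [Real.dist_eq, sub_zero, abs_of_pos ht]
    exact htt.trans_le (min_le_left _ _)
  set T : En n → En n := fun x => x + t • A x
  have hTd : ContDiff ℝ 1 T := contDiff_id.add (hA.const_smul t)
  have hJ : ∀ x, Jm T x = 1 + t • Jm A x := by
    intro x
    ext i j
    simp only [Jm, T, Matrix.of_apply, PiLp.add_apply, PiLp.smul_apply, smul_eq_mul,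
      Matrix.add_apply, Matrix.smul_apply]
    have hAi := contDiff_comp_coord hA i
    rw [pd_add ((contDiff_coord i).differentiable (by simp) x)
      ((hAi.differentiable (by simp) x).const_mul t), pd_coord, Matrix.one_apply]
    congr 1
    simp only [pd]
    rw [fderiv_const_mul (hAi.differentiable (by simp) x)]
    simp
  have happ : ApproximatesLinearOn T ((ContinuousLinearEquiv.refl ℝ (En n)) : En n →L[ℝ] En n)
      univ (‖t‖₊ * C) := by
    intro x _ y _
    have : T x - T y - ((ContinuousLinearEquiv.refl ℝ (En n)) : En n →L[ℝ] En n) (x - y)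
      = t • (A x - A y) := by
      simp only [T, ContinuousLinearEquiv.coe_refl, ContinuousLinearMap.id_apply]
      rw [smul_sub]; abel
    rw [this, norm_smul, NNReal.coe_mul, mul_assoc]
    gcongr
    · simp
    · exact hC.norm_sub_le x y
  have hlt : ‖t‖₊ * C < 1 := by
    rw [← NNReal.coe_lt_coe]
    push_cast
    rw [Real.norm_eq_abs, abs_of_pos ht]
    have h1 : t < 1 / (C + 1) := htt.trans_le (min_le_right _ _)
    rw [lt_div_iff₀ (by positivity)] at h1
    nlinarith
  have hinj : Function.Injective T := by
    rw [← Set.injOn_univ]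
    apply happ.injOn
    by_cases hs : Subsingleton (En n)
    · exact Or.inl hs
    · right
      refine hlt.trans_le ?_
      have : Nontrivial (En n) := not_subsingleton_iff_nontrivial.1 hs
      rw [le_inv_comm₀ one_pos (ContinuousLinearEquiv.nnnorm_symm_pos _), inv_one]
      exact ContinuousLinearMap.norm_id_le
  have hsurj : Function.Surjective T := by
    apply happ.surjective
    by_cases hs : Subsingleton (En n)
    · exact Or.inl hs
    · right
      refine hlt.trans_le ?_
      have : Nontrivial (En n) := not_subsingleton_iff_nontrivial.1 hs
      rw [le_inv_comm₀ one_pos (ContinuousLinearEquiv.nnnorm_symm_pos _), inv_one]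
      exact ContinuousLinearMap.norm_id_le
  have hout : ∀ x ∉ B, T x = x := by
    intro x hx
    simp [T, image_eq_zero_of_notMem_tsupport (fun h => hx (hR h))]
  have himg : T '' B = B := by
    have h1 : T '' Bᶜ = Bᶜ := by
      have : EqOn T id Bᶜ := fun x hx => hout x hx
      rw [this.image_eq, image_id]
    have h2 := Set.image_compl_eq (s := B) ⟨hinj, hsurj⟩
    rw [h1] at h2
    exact (compl_injective h2).symm
  have hch := integral_image_eq_integral_abs_det_fderiv_smul (E := En n) volume
    (isClosed_closedBall (x := (0:En n)) (ε := R)).measurableSet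
    (f := T) (f' := fun x => fderiv ℝ T x)
    (fun x _ => ((hTd.differentiable (by simp)) x).hasFDerivAt.hasFDerivWithinAt)
    hinj.injOn (fun _ => (1:ℝ))
  rw [himg] at hch
  simp only [smul_eq_mul, mul_one, integral_const, measureReal_restrict_apply_univ] at hch
  rw [hch]
  apply setIntegral_congr_fun isClosed_closedBall.measurableSet
  intro x hx
  simp only
  rw [det_fderiv_eq (hTd.differentiable (by simp) x), hJ, abs_of_pos (hd x hx)]

lemma integral_det_eq_zero (hn : 0 < n) {A : En n → En n} (hA : ContDiff ℝ 1 A)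
    (hc : HasCompactSupport A) : ∫ x, (Jm A x).det = 0 := by
  obtain ⟨R, t₀, ht₀, hR, h⟩ := integral_det_perturb hA hc
  obtain ⟨t, l, ht, hl, hM⟩ := exists_det_eq_sum hn ht₀
  have h1 : ∫ x, (Jm A x).det = ∫ x in closedBall 0 R, (Jm A x).det := by
    rw [setIntegral_eq_integral_of_forall_compl_eq_zero]
    intro x hx
    rw [Jm_eq_zero (fun h => hx (hR h)), Matrix.det_eq_zero_of_row_eq_zero ⟨0, hn⟩ (by simp)]
  have hintg : ∀ k, IntegrableOn (fun x => (1 + t k • Jm A x).det) (closedBall 0 R) := fun k =>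
    ((continuous_const.add ((Jm_continuous hA).const_smul (t k))).matrix_det).continuousOn
      |>.integrableOn_compact (isCompact_closedBall _ _)
  rw [h1]
  simp_rw [fun x => hM (Jm A x)]
  rw [integral_finsetSum _ (fun k _ => (hintg k).mul_const _)]
  simp_rw [integral_mul_const]
  rw [Finset.sum_congr rfl (fun k _ => by rw [h (t k) (ht k).1 (ht k).2]), ← Finset.mul_sum, hl,
    mul_zero]

lemma det_updateRow_eq_adj (M : Matrix (Fin n) (Fin n) ℝ) (i : Fin n) (b : Fin n → ℝ) :
    (M.updateRow i b).det = ∑ j, b j * M.adjugate j i := by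
  rw [← Matrix.cramer_transpose_apply, Matrix.cramer_eq_adjugate_mulVec, ← Matrix.adjugate_transpose]
  simp [Matrix.mulVec, dotProduct, mul_comm]

/-- Piola identity in weak form. -/
lemma piola {Φ : En n → En n} {u : En n → ℝ} (hΦ : ContDiff ℝ (⊤ : ℕ∞) Φ)
    (hu : ContDiff ℝ 1 u) (hc : HasCompactSupport u) (i : Fin n) :
    ∫ x, ∑ j, pd j u x * (Jm Φ x).adjugate j i = 0 := by
  obtain ⟨χ, hχ, -, W, hW, hKW, hχ1⟩ := exists_cutoff (K := tsupport u) hc isOpen_univ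
    (subset_univ _)
  set A : En n → En n := fun x => WithLp.toLp 2 (Function.update (fun k => χ x * Φ x k) i (u x))
  have hAc : ∀ k, (fun x => A x k) = if k = i then u else fun x => χ x * Φ x k := by
    intro k
    by_cases hk : k = i
    · subst hk; ext x; simp [A]
    · ext x; simp [A, hk]
  have hA : ContDiff ℝ 1 A := by
    rw [contDiff_piLp]
    intro k
    rw [hAc]
    split_ifs
    · exact hu
    · exact (hχ.1.mul (contDiff_comp_coord hΦ k)).of_le (by simp)
  have hcA : HasCompactSupport A := by
    refine HasCompactSupport.intro (hc.union hχ.2.1) (fun x hx => ?_)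
    ext k
    have := congrFun (hAc k) x
    simp only at this
    rw [this]
    have h1 : u x = 0 := image_eq_zero_of_notMem_tsupport (fun h => hx (Or.inl h))
    have h2 : χ x = 0 := image_eq_zero_of_notMem_tsupport (fun h => hx (Or.inr h))
    split_ifs <;> simp [h1, h2]
  have h0 := integral_det_eq_zero (i.pos) hA hcA
  rw [← h0]
  congr 1
  ext x
  by_cases hx : x ∈ tsupport u
  · have : Jm A x = (Jm Φ x).updateRow i (fun j => pd j u x) := by
      ext k j
      simp only [Jm, Matrix.of_apply, Matrix.updateRow_apply]
      rw [hAc]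
      split_ifs
      · rfl
      · apply pd_congr
        filter_upwards [hW.mem_nhds (hKW hx)] with y hy
        simp [hχ1 y hy]
    rw [this, det_updateRow_eq_adj]
  · have h1 : ∀ j, pd j u x = 0 := fun j => pd_eq_zero_of_notMem hx
    symm
    simp only [h1, zero_mul, Finset.sum_const_zero]
    apply Matrix.det_eq_zero_of_row_eq_zero i
    intro j
    simp only [Jm, Matrix.of_apply]
    rw [hAc, if_pos rfl, h1]

end Piola

/-- The cofactor pairing `⟨∇f, adj(A) h⟩`. -/
def cofD {n : ℕ} (f : En n → ℝ) (A : En n → Matrix (Fin n) (Fin n) ℝ) (h x : En n) : ℝ :=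
  ∑ i, h i * ∑ j, pd j f x * (A x).adjugate j i

section Shift
variable {n : ℕ} {Φ : En n → En n} {f : En n → ℝ}

lemma cofD_eq_zero {A : En n → Matrix (Fin n) (Fin n) ℝ} {h x : En n} (hx : x ∉ tsupport f) :
    cofD f A h x = 0 := by
  simp [cofD, pd_eq_zero_of_notMem hx]

lemma cofD_continuous (hΦ : ContDiff ℝ (⊤ : ℕ∞) Φ) (hf : ContDiff ℝ (⊤ : ℕ∞) f) (h : En n) :
    Continuous (cofD f (Jm Φ) h) := by
  have h2 := (Jm_continuous (hΦ.of_le (by simp))).matrix_adjugate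
  exact continuous_finsetSum _ fun i _ => continuous_const.mul <|
    continuous_finsetSum _ fun j _ => (pd_contDiff hf j).continuous.mul (h2.matrix_elem j i)

lemma pd_comp {F : En n → ℝ} (hΦ : Differentiable ℝ Φ) (hF : Differentiable ℝ F) (j : Fin n)
    (x : En n) : pd j (fun y => F (Φ y)) x = ∑ k, pd k F (Φ x) * Jm Φ x k j := by
  simp only [pd]
  rw [show (fun y => F (Φ y)) = F ∘ Φ from rfl, fderiv_comp x (hF _) (hΦ x),
    ContinuousLinearMap.comp_apply, fderiv_eq_sum]
  refine Finset.sum_congr rfl fun k _ => ?_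
  simp [Jm, pd, fderiv_coord (hΦ x), mul_comm]

lemma integral_pd_comp_mul_det (hΦ : ContDiff ℝ (⊤ : ℕ∞) Φ) {U : Set (En n)} (hf : IsTest U f)
    {η : En n → ℝ} (hη : ContDiff ℝ (⊤ : ℕ∞) η) (i : Fin n) :
    ∫ x, f x * pd i η (Φ x) * (Jm Φ x).det =
      -∫ x, η (Φ x) * ∑ j, pd j f x * (Jm Φ x).adjugate j i := by
  have hcomp : ContDiff ℝ (⊤ : ℕ∞) (fun x => η (Φ x)) := hη.comp hΦ
  have h0 := piola hΦ ((hf.1.mul hcomp).of_le (by simp)) (hf.2.1.mul_right) i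
  have hJ := Jm_continuous (hΦ.of_le (by simp : (1 : WithTop ℕ∞) ≤ (⊤ : ℕ∞)))
  have hpt : ∀ x, ∑ j, pd j (fun x => f x * η (Φ x)) x * (Jm Φ x).adjugate j i =
      f x * pd i η (Φ x) * (Jm Φ x).det +
        η (Φ x) * ∑ j, pd j f x * (Jm Φ x).adjugate j i := by
    intro x
    have h1 : ∀ j, pd j (fun x => f x * η (Φ x)) x =
        f x * (∑ k, pd k η (Φ x) * Jm Φ x k j) + pd j f x * η (Φ x) := by
      intro j
      rw [pd_mul (hf.differentiable x) (hcomp.differentiable (by simp) x),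
        pd_comp (hΦ.differentiable (by simp)) (hη.differentiable (by simp))]
    simp_rw [h1, add_mul, Finset.sum_add_distrib]
    congr 1
    · simp_rw [mul_assoc (f x), ← Finset.mul_sum, Finset.sum_mul]
      congr 1
      rw [Finset.sum_comm]
      simp_rw [mul_assoc, ← Finset.mul_sum]
      have h2 : ∀ k, ∑ j, Jm Φ x k j * (Jm Φ x).adjugate j i = if k = i then (Jm Φ x).det else 0 := by
        intro k
        have := congrFun (congrFun (Matrix.mul_adjugate (Jm Φ x)) k) i
        rw [Matrix.mul_apply] at this
        rw [this]; simp [Matrix.one_apply]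
      simp_rw [h2]
      simp
    · rw [Finset.mul_sum]
      refine Finset.sum_congr rfl fun j _ => by ring
  simp_rw [hpt] at h0
  rw [integral_add] at h0
  · linarith
  · exact (((hf.continuous.mul ((pd_contDiff hη i).continuous.comp hΦ.continuous)).mul
      hJ.matrix_det)).integrable_of_hasCompactSupport (hf.2.1.mul_right.mul_right)
  · refine Continuous.integrable_of_hasCompactSupport ?_ ?_
    · exact (hη.continuous.comp hΦ.continuous).mul (continuous_finsetSum _ fun j _ =>
        (pd_contDiff hf.1 j).continuous.mul (hJ.matrix_adjugate.matrix_elem j i))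
    · refine HasCompactSupport.intro hf.2.1 fun x hx => ?_
      simp [pd_eq_zero_of_notMem hx]

/-- Translating the test function, smooth case. -/
lemma shift_formula_smooth (hΦ : ContDiff ℝ (⊤ : ℕ∞) Φ) {U : Set (En n)} (hf : IsTest U f)
    {F : En n → ℝ} (hF : ContDiff ℝ (⊤ : ℕ∞) F) (h : En n) :
    ∫ x in tsupport f, f x * (F (Φ x - h) - F (Φ x)) * (Jm Φ x).det =
      ∫ s in (0:ℝ)..1, ∫ x in tsupport f, F (Φ x - s • h) * cofD f (Jm Φ) h x := by
  have hJ := Jm_continuous (hΦ.of_le (by simp : (1 : WithTop ℕ∞) ≤ (⊤ : ℕ∞)))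
  set D : ℝ → En n → ℝ := fun s x => -∑ i, h i * pd i F (Φ x - s • h)
  have hDc : Continuous (Function.uncurry D) := by
    refine (continuous_finsetSum _ fun i _ => continuous_const.mul
      ((pd_contDiff hF i).continuous.comp ?_)).neg
    exact (hΦ.continuous.comp continuous_snd).sub (continuous_fst.smul continuous_const)
  have hder : ∀ x s, HasDerivAt (fun s : ℝ => F (Φ x - s • h)) (D s x) s := by
    intro x s
    have h1 : HasDerivAt (fun s : ℝ => Φ x - s • h) (-h) s := by
      simpa using ((hasDerivAt_id s).smul_const h).const_sub (Φ x)
    have h2 := ((hF.differentiable (by simp) (Φ x - s • h)).hasFDerivAt).comp_hasDerivAt s h1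
    have e : D s x = fderiv ℝ F (Φ x - s • h) (-h) := by
      rw [map_neg, fderiv_eq_sum]
    rw [e]; exact h2
  have hftc : ∀ x, F (Φ x - h) - F (Φ x) = ∫ s in (0:ℝ)..1, D s x := by
    intro x
    rw [intervalIntegral.integral_eq_sub_of_hasDerivAt (fun s _ => hder x s)]
    · simp
    · exact (hDc.comp (Continuous.prodMk continuous_id continuous_const)).intervalIntegrable _ _
  have hcongr : ∀ s, ∫ x in tsupport f, D s x * (f x * (Jm Φ x).det) =
      ∫ x in tsupport f, F (Φ x - s • h) * cofD f (Jm Φ) h x := by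
    intro s
    have hΦs : ContDiff ℝ (⊤ : ℕ∞) (fun x => Φ x - s • h) := hΦ.sub contDiff_const
    have hJs : Jm (fun x => Φ x - s • h) = Jm Φ := by
      ext x i j
      have : (fun y => (Φ y - s • h) i) = fun y => Φ y i - (s • h) i := by ext y; simp
      simp only [Jm, pd, Matrix.of_apply]
      rw [this, fderiv_sub_const]
    have hi := fun i => integral_pd_comp_mul_det hΦs hf hF i
    rw [hJs] at hi
    rw [setIntegral_eq_integral_of_forall_compl_eq_zero, setIntegral_eq_integral_of_forall_compl_eq_zero]
    · have e1 : ∀ x, D s x * (f x * (Jm Φ x).det) =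
        ∑ i, -(h i) * (f x * pd i F (Φ x - s • h) * (Jm Φ x).det) := by
        intro x
        simp only [D]
        rw [← Finset.sum_neg_distrib, Finset.sum_mul]
        exact Finset.sum_congr rfl fun i _ => by ring
      have e2 : ∀ x, F (Φ x - s • h) * cofD f (Jm Φ) h x =
        ∑ i, h i * (F (Φ x - s • h) * ∑ j, pd j f x * (Jm Φ x).adjugate j i) := by
        intro x
        simp only [cofD]
        rw [Finset.mul_sum]
        exact Finset.sum_congr rfl fun i _ => by ring
      simp_rw [e1, e2]
      rw [integral_finsetSum, integral_finsetSum]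
      · refine Finset.sum_congr rfl fun i _ => ?_
        rw [integral_const_mul, integral_const_mul, hi i]
        ring
      · intro i _
        refine Continuous.integrable_of_hasCompactSupport ?_ ?_
        · exact continuous_const.mul ((hF.continuous.comp hΦs.continuous).mul
            (continuous_finsetSum _ fun j _ =>
              (pd_contDiff hf.1 j).continuous.mul (hJ.matrix_adjugate.matrix_elem j i)))
        · refine HasCompactSupport.intro hf.2.1 fun x hx => ?_
          simp [pd_eq_zero_of_notMem hx]
      · intro i _
        exact (continuous_const.mul (((hf.continuous.mul ((pd_contDiff hF i).continuous.comp
          hΦs.continuous)).mul hJ.matrix_det))).integrable_of_hasCompactSupport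
            (hf.2.1.mul_right.mul_right.mul_left)
    · intro x hx
      rw [cofD_eq_zero hx, mul_zero]
    · intro x hx
      rw [image_eq_zero_of_notMem_tsupport hx]; simp
  simp_rw [← hcongr]
  rw [intervalIntegral_integral_swap]
  · refine integral_congr_ae (Eventually.of_forall fun x => ?_)
    simp only
    rw [intervalIntegral.integral_mul_const, hftc]
    ring
  · rw [Measure.prod_restrict]
    have hcK : IsCompact (Icc (0:ℝ) 1 ×ˢ tsupport f) := isCompact_Icc.prod hf.2.1
    have : IntegrableOn (Function.uncurry fun s x => D s x * (f x * (Jm Φ x).det))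
        (Icc (0:ℝ) 1 ×ˢ tsupport f) (volume.prod volume) := by
      refine ContinuousOn.integrableOn_compact hcK (Continuous.continuousOn ?_)
      exact hDc.mul ((hf.continuous.mul hJ.matrix_det).comp continuous_snd)
    refine this.mono_set (prod_mono ?_ le_rfl)
    rw [uIoc_of_le zero_le_one]
    exact Ioc_subset_Icc_self

lemma abs_setIntegral_sub_le {K : Set (En n)} (hK : IsCompact K) {a G H : En n → ℝ}
    (ha : Continuous a) (hG : Continuous G) (hH : Continuous H) {ε : ℝ}
    (h : ∀ x, |G x - H x| ≤ ε) :
    |(∫ x in K, G x * a x) - ∫ x in K, H x * a x| ≤ ε * ∫ x in K, |a x| := by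
  have i1 : IntegrableOn (fun x => G x * a x) K := (hG.mul ha).continuousOn.integrableOn_compact hK
  have i2 : IntegrableOn (fun x => H x * a x) K := (hH.mul ha).continuousOn.integrableOn_compact hK
  rw [← integral_sub i1 i2, ← integral_const_mul]
  refine (abs_integral_le_integral_abs).trans ?_
  refine integral_mono (i1.sub i2).abs
    ((ha.abs.continuousOn.integrableOn_compact hK).const_mul ε) fun x => ?_
  simp only
  rw [← sub_mul, abs_mul]
  gcongr
  exact h x

/-- Translating the test function. -/
lemma shift_formula (hΦ : ContDiff ℝ (⊤ : ℕ∞) Φ) {U : Set (En n)} (hf : IsTest U f)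
    {F : En n → ℝ} (hF : Continuous F) (h : En n) :
    (∫ x in tsupport f, F (Φ x - h) * (f x * (Jm Φ x).det)) -
        ∫ x in tsupport f, F (Φ x) * (f x * (Jm Φ x).det) =
      ∫ s in (0:ℝ)..1, ∫ x in tsupport f, F (Φ x - s • h) * cofD f (Jm Φ) h x := by
  have hJ := Jm_continuous (hΦ.of_le (by simp : (1 : WithTop ℕ∞) ≤ (⊤ : ℕ∞)))
  have hK : IsCompact (tsupport f) := hf.2.1
  have ha : Continuous fun x => f x * (Jm Φ x).det := hf.continuous.mul hJ.matrix_det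
  have hc := cofD_continuous hΦ hf.1 h
  set K := tsupport f
  set Ca := ∫ x in K, |f x * (Jm Φ x).det|
  set Cc := ∫ x in K, |cofD f (Jm Φ) h x|
  have hcont : ∀ G : En n → ℝ, Continuous G →
      Continuous fun s : ℝ => ∫ x in K, G (Φ x - s • h) * cofD f (Jm Φ) h x := by
    intro G hG
    refine continuous_parametric_integral_of_continuous (X := ℝ)
      (f := fun s x => G (Φ x - s • h) * cofD f (Jm Φ) h x) ?_ hK
    refine (hG.comp ?_).mul (hc.comp continuous_snd)
    exact (hΦ.continuous.comp continuous_snd).sub (continuous_fst.smul continuous_const)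
  have hΦh : Continuous fun x => Φ x - h := hΦ.continuous.sub continuous_const
  have smooth : ∀ G : En n → ℝ, ContDiff ℝ (⊤ : ℕ∞) G →
      (∫ x in K, G (Φ x - h) * (f x * (Jm Φ x).det)) - ∫ x in K, G (Φ x) * (f x * (Jm Φ x).det) =
      ∫ s in (0:ℝ)..1, ∫ x in K, G (Φ x - s • h) * cofD f (Jm Φ) h x := by
    intro G hG
    rw [← shift_formula_smooth hΦ hf hG h, ← integral_sub]
    · exact integral_congr_ae (Eventually.of_forall fun x => by simp only; ring)
    · exact ((hG.continuous.comp hΦh).mul ha).continuousOn.integrableOn_compact hK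
    · exact ((hG.continuous.comp hΦ.continuous).mul ha).continuousOn.integrableOn_compact hK
  rw [← sub_eq_zero, ← abs_nonpos_iff]
  refine le_of_forall_pos_le_add fun δ hδ => ?_
  have hCa : 0 ≤ Ca := integral_nonneg fun x => abs_nonneg _
  have hCc : 0 ≤ Cc := integral_nonneg fun x => abs_nonneg _
  obtain ⟨ε, hε, hεδ⟩ : ∃ ε : ℝ, 0 < ε ∧ ε * (2 * Ca + Cc) ≤ δ := by
    refine ⟨δ / (2 * Ca + Cc + 1), by positivity, ?_⟩
    rw [div_mul_eq_mul_div, div_le_iff₀ (by positivity)]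
    nlinarith
  obtain ⟨G, hG, hGF, -⟩ := hF.exists_contDiff_approx (⊤ : ℕ∞) (ε := fun _ => ε)
    continuous_const (fun _ => hε)
  have hGF' : ∀ y, |F y - G y| ≤ ε := fun y => by
    rw [abs_sub_comm]; exact (hGF y).le
  have e1 := abs_setIntegral_sub_le hK ha (hF.comp hΦh) (hG.continuous.comp hΦh)
    (fun x => hGF' (Φ x - h))
  have e2 := abs_setIntegral_sub_le hK ha (hF.comp hΦ.continuous) (hG.continuous.comp hΦ.continuous)
    (fun x => hGF' (Φ x))
  have e3 : |(∫ s in (0:ℝ)..1, ∫ x in K, F (Φ x - s • h) * cofD f (Jm Φ) h x) -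
      ∫ s in (0:ℝ)..1, ∫ x in K, G (Φ x - s • h) * cofD f (Jm Φ) h x| ≤ ε * Cc := by
    rw [← intervalIntegral.integral_sub ((hcont F hF).intervalIntegrable _ _)
      ((hcont G hG.continuous).intervalIntegrable _ _)]
    have := intervalIntegral.norm_integral_le_of_norm_le_const (a := (0:ℝ)) (b := 1) (C := ε * Cc)
      (f := fun s => (∫ x in K, F (Φ x - s • h) * cofD f (Jm Φ) h x) -
        ∫ x in K, G (Φ x - s • h) * cofD f (Jm Φ) h x) ?_
    · simpa using this
    · intro s _
      have hs : Continuous fun x => Φ x - s • h := hΦ.continuous.sub continuous_const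
      exact abs_setIntegral_sub_le hK hc (hF.comp hs) (hG.continuous.comp hs)
        (fun x => hGF' (Φ x - s • h))
  have e4 := smooth G hG
  simp only [Function.comp_def] at e1 e2
  rw [abs_le] at e1 e2 e3 ⊢
  constructor <;> linarith [e1.1, e1.2, e2.1, e2.2, e3.1, e3.2]

end Shift

/-- Smooth approximations of `φ` whose cofactors converge locally in `L¹`. -/
structure Approx {n : ℕ} (U : Set (En n)) (φ : En n → En n)
    (A : En n → Matrix (Fin n) (Fin n) ℝ) (Φ : ℕ → En n → En n) : Prop where
  smooth : ∀ k, ContDiff ℝ (⊤ : ℕ∞) (Φ k)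
  unif : ∀ K ⊆ U, IsCompact K → TendstoUniformlyOn Φ φ atTop K
  adj_int : ∀ K ⊆ U, IsCompact K → ∀ i j, IntegrableOn (fun x => (A x).adjugate i j) K
  adj_lim : ∀ K ⊆ U, IsCompact K → ∀ i j, Tendsto (fun k => ∫ x in K,
    |(Jm (Φ k) x).adjugate i j - (A x).adjugate i j|) atTop (nhds 0)

/-- The smooth degree pairing `∫ F(Φ) f det DΦ`. -/
def degB {n : ℕ} (Φ : En n → En n) (f F : En n → ℝ) : ℝ :=
  ∫ x in tsupport f, F (Φ x) * (f x * (Jm Φ x).det)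

/-- The limit of the degree pairings. -/
def degN {n : ℕ} (Φ : ℕ → En n → En n) (f F : En n → ℝ) : ℝ :=
  limUnder atTop fun k => degB (Φ k) f F

/-- Sum of absolute values of cofactors. -/
def adjS {n : ℕ} (M : Matrix (Fin n) (Fin n) ℝ) : ℝ := ∑ i, ∑ j, |M.adjugate j i|

/-- Sum of absolute values of differences of cofactors. -/
def adjD {n : ℕ} (M M' : Matrix (Fin n) (Fin n) ℝ) : ℝ :=
  ∑ i, ∑ j, |M.adjugate j i - M'.adjugate j i|

section Limit
variable {n : ℕ} {U : Set (En n)} {φ : En n → En n} {A : En n → Matrix (Fin n) (Fin n) ℝ}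
  {Φ : ℕ → En n → En n}

lemma adjS_nonneg (M : Matrix (Fin n) (Fin n) ℝ) : 0 ≤ adjS M :=
  Finset.sum_nonneg fun _ _ => Finset.sum_nonneg fun _ _ => abs_nonneg _

lemma adjD_nonneg (M M' : Matrix (Fin n) (Fin n) ℝ) : 0 ≤ adjD M M' :=
  Finset.sum_nonneg fun _ _ => Finset.sum_nonneg fun _ _ => abs_nonneg _

lemma adjS_le (M M' : Matrix (Fin n) (Fin n) ℝ) : adjS M ≤ adjS M' + adjD M M' := by
  simp only [adjS, adjD]
  rw [← Finset.sum_add_distrib]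
  refine Finset.sum_le_sum fun i _ => ?_
  rw [← Finset.sum_add_distrib]
  refine Finset.sum_le_sum fun j _ => ?_
  have := abs_add_le (M'.adjugate j i) (M.adjugate j i - M'.adjugate j i)
  simpa using this

lemma abs_cofD_le {f : En n → ℝ} {h x : En n} {L ρ : ℝ} (hf : ∀ j, |pd j f x| ≤ L)
    (hh : ∀ i, |h i| ≤ ρ) (hρ : 0 ≤ ρ) (B : En n → Matrix (Fin n) (Fin n) ℝ) :
    |cofD f B h x| ≤ ρ * L * adjS (B x) := by
  simp only [cofD, adjS, Finset.mul_sum]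
  refine (Finset.abs_sum_le_sum_abs _ _).trans (Finset.sum_le_sum fun i _ => ?_)
  refine (Finset.abs_sum_le_sum_abs _ _).trans (Finset.sum_le_sum fun j _ => ?_)
  rw [abs_mul, abs_mul, ← mul_assoc]
  have := hf j
  have := hh i
  gcongr

lemma abs_cofD_sub_le {f : En n → ℝ} {h x : En n} {L ρ : ℝ} (hf : ∀ j, |pd j f x| ≤ L)
    (hh : ∀ i, |h i| ≤ ρ) (hρ : 0 ≤ ρ) (B B' : En n → Matrix (Fin n) (Fin n) ℝ) :
    |cofD f B h x - cofD f B' h x| ≤ ρ * L * adjD (B x) (B' x) := by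
  simp only [cofD, adjD, Finset.mul_sum]
  rw [← Finset.sum_sub_distrib]
  refine (Finset.abs_sum_le_sum_abs _ _).trans (Finset.sum_le_sum fun i _ => ?_)
  rw [← Finset.sum_sub_distrib]
  refine (Finset.abs_sum_le_sum_abs _ _).trans (Finset.sum_le_sum fun j _ => ?_)
  rw [← mul_sub, ← mul_sub, abs_mul, abs_mul, ← mul_assoc]
  have := hf j
  have := hh i
  gcongr

lemma Approx.adj_sub_int (hA : Approx U φ A Φ) {K : Set (En n)} (hKU : K ⊆ U) (hK : IsCompact K)
    (k : ℕ) (i j : Fin n) :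
    IntegrableOn (fun x => (Jm (Φ k) x).adjugate i j - (A x).adjugate i j) K :=
  (((Jm_continuous ((hA.smooth k).of_le (by simp))).matrix_adjugate.matrix_elem i
    j).continuousOn.integrableOn_compact hK).sub (hA.adj_int K hKU hK i j)

lemma Approx.adjS_int (hA : Approx U φ A Φ) {K : Set (En n)} (hKU : K ⊆ U) (hK : IsCompact K) :
    IntegrableOn (fun x => adjS (A x)) K :=
  integrable_finsetSum _ fun i _ => integrable_finsetSum _ fun j _ =>
    (hA.adj_int K hKU hK j i).abs

lemma Approx.adjD_int (hA : Approx U φ A Φ) {K : Set (En n)} (hKU : K ⊆ U) (hK : IsCompact K)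
    (k : ℕ) : IntegrableOn (fun x => adjD (Jm (Φ k) x) (A x)) K :=
  integrable_finsetSum _ fun i _ => integrable_finsetSum _ fun j _ =>
    (hA.adj_sub_int hKU hK k j i).abs

lemma Approx.adjD_lim (hA : Approx U φ A Φ) {K : Set (En n)} (hKU : K ⊆ U) (hK : IsCompact K) :
    Tendsto (fun k => ∫ x in K, adjD (Jm (Φ k) x) (A x)) atTop (nhds 0) := by
  have : ∀ k, ∫ x in K, adjD (Jm (Φ k) x) (A x) =
      ∑ i, ∑ j, ∫ x in K, |(Jm (Φ k) x).adjugate j i - (A x).adjugate j i| := by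
    intro k
    simp only [adjD]
    rw [integral_finsetSum _ fun i _ => integrable_finsetSum _ fun j _ =>
      (hA.adj_sub_int hKU hK k j i).abs]
    exact Finset.sum_congr rfl fun i _ => integral_finsetSum _ fun j _ =>
      (hA.adj_sub_int hKU hK k j i).abs
  simp_rw [this]
  have h0 : (0:ℝ) = ∑ i : Fin n, ∑ j : Fin n, 0 := by simp
  rw [h0]
  exact tendsto_finsetSum _ fun i _ => tendsto_finsetSum _ fun j _ => hA.adj_lim K hKU hK j i

lemma degB_eq (Ψ : En n → En n) (f F : En n → ℝ) :
    degB Ψ f F = ∫ x, F (Ψ x) * (f x * (Jm Ψ x).det) := by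
  rw [degB, setIntegral_eq_integral_of_forall_compl_eq_zero]
  intro x hx
  rw [image_eq_zero_of_notMem_tsupport hx]; simp

lemma degB_integrable {Ψ : En n → En n} (hΨ : ContDiff ℝ (⊤ : ℕ∞) Ψ) {f F : En n → ℝ}
    (hf : IsTest U f) (hF : Continuous F) :
    Integrable fun x => F (Ψ x) * (f x * (Jm Ψ x).det) := by
  have hJ := Jm_continuous (hΨ.of_le (by simp : (1 : WithTop ℕ∞) ≤ (⊤ : ℕ∞)))
  exact ((hF.comp hΨ.continuous).mul (hf.continuous.mul
    hJ.matrix_det)).integrable_of_hasCompactSupport (hf.2.1.mul_right.mul_left)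

lemma degB_shift {Ψ : En n → En n} (hΨ : ContDiff ℝ (⊤ : ℕ∞) Ψ) {f F : En n → ℝ}
    (hf : IsTest U f) (hF : Continuous F) (h : En n) :
    degB Ψ f (fun y => F (y - h)) - degB Ψ f F =
      ∫ s in (0:ℝ)..1, ∫ x in tsupport f, F (Ψ x - s • h) * cofD f (Jm Ψ) h x :=
  shift_formula hΨ hf hF h

lemma Approx.cmp_point (hA : Approx U φ A Φ) {f F : En n → ℝ} (hf : IsTest U f) {k l : ℕ}
    {L M ε ρ : ℝ} (hL : 0 ≤ L) (hρ : 0 ≤ ρ) (hM : 0 ≤ M) (hε : 0 ≤ ε)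
    (hfL : ∀ j x, |pd j f x| ≤ L) {h : En n} (hh : ∀ i, |h i| ≤ ρ) (hF : Continuous F)
    (hFM : ∀ y, |F y| ≤ M) (s : ℝ)
    (hFε : ∀ x ∈ tsupport f, |F (Φ k x - s • h) - F (Φ l x - s • h)| ≤ ε) :
    |(∫ x in tsupport f, F (Φ k x - s • h) * cofD f (Jm (Φ k)) h x) -
      ∫ x in tsupport f, F (Φ l x - s • h) * cofD f (Jm (Φ l)) h x| ≤
    ∫ x in tsupport f, ρ * L * (ε * adjS (A x) + (ε + M) * adjD (Jm (Φ k) x) (A x) +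
      M * adjD (Jm (Φ l) x) (A x)) := by
  have hK : IsCompact (tsupport f) := hf.2.1
  have hi : ∀ k, IntegrableOn (fun x => F (Φ k x - s • h) * cofD f (Jm (Φ k)) h x) (tsupport f) :=
    fun k => ((hF.comp ((hA.smooth k).continuous.sub continuous_const)).mul
      (cofD_continuous (hA.smooth k) hf.1 h)).continuousOn.integrableOn_compact hK
  rw [← integral_sub (hi k) (hi l)]
  refine abs_integral_le_integral_abs.trans ?_
  refine setIntegral_mono_on ((hi k).sub (hi l)).abs ?_ hK.measurableSet fun x hx => ?_
  · exact ((((hA.adjS_int hf.2.2 hK).const_mul ε).add ((hA.adjD_int hf.2.2 hK k).const_mul _)).add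
      ((hA.adjD_int hf.2.2 hK l).const_mul _)).const_mul _
  · have e1 := abs_cofD_le (hfL · x) hh hρ (Jm (Φ k))
    have e2 := abs_cofD_sub_le (hfL · x) hh hρ (Jm (Φ k)) A
    have e3 := abs_cofD_sub_le (hfL · x) hh hρ (Jm (Φ l)) A
    have e4 := adjS_le (Jm (Φ k) x) (A x)
    have e5 : |cofD f (Jm (Φ k)) h x - cofD f (Jm (Φ l)) h x| ≤
        ρ * L * adjD (Jm (Φ k) x) (A x) + ρ * L * adjD (Jm (Φ l) x) (A x) := by
      rw [abs_le] at e2 e3 ⊢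
      constructor <;> linarith [e2.1, e2.2, e3.1, e3.2]
    have e6 : |cofD f (Jm (Φ k)) h x| ≤ ρ * L * (adjS (A x) + adjD (Jm (Φ k) x) (A x)) :=
      e1.trans (by gcongr)
    have : F (Φ k x - s • h) * cofD f (Jm (Φ k)) h x - F (Φ l x - s • h) * cofD f (Jm (Φ l)) h x
      = (F (Φ k x - s • h) - F (Φ l x - s • h)) * cofD f (Jm (Φ k)) h x +
        F (Φ l x - s • h) * (cofD f (Jm (Φ k)) h x - cofD f (Jm (Φ l)) h x) := by ring
    rw [this]
    refine (abs_add_le _ _).trans ?_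
    rw [abs_mul, abs_mul]
    have g1 := mul_le_mul (hFε x hx) e6 (abs_nonneg _) hε
    have g2 := mul_le_mul (hFM (Φ l x - s • h)) e5 (abs_nonneg _) hM
    nlinarith

lemma Approx.bound (hA : Approx U φ A Φ) (hφ : ContinuousOn φ U) {K : Set (En n)} (hKU : K ⊆ U)
    (hK : IsCompact K) : ∃ R, 0 ≤ R ∧ ∀ᶠ k in atTop, ∀ x ∈ K, ‖Φ k x‖ ≤ R := by
  obtain ⟨C, hC⟩ := (hK.image_of_continuousOn (hφ.mono hKU)).isBounded.exists_norm_le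
  refine ⟨|C| + 1, by positivity, ?_⟩
  filter_upwards [Metric.tendstoUniformlyOn_iff.1 (hA.unif K hKU hK) 1 one_pos] with k hk x hx
  have h1 := hk x hx
  have h2 := hC (φ x) (mem_image_of_mem _ hx)
  rw [dist_eq_norm] at h1
  have := norm_sub_norm_le (Φ k x) (φ x)
  rw [norm_sub_rev] at this
  linarith [le_abs_self C]

lemma Approx.dist_ev (hA : Approx U φ A Φ) {K : Set (En n)} (hKU : K ⊆ U)
    (hK : IsCompact K) {δ : ℝ} (hδ : 0 < δ) :
    ∃ k₀, ∀ k ≥ k₀, ∀ l ≥ k₀, ∀ x ∈ K, dist (Φ k x) (Φ l x) < δ := by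
  obtain ⟨k₀, hk₀⟩ := eventually_atTop.1
    (Metric.tendstoUniformlyOn_iff.1 (hA.unif K hKU hK) (δ / 2) (by positivity))
  refine ⟨k₀, fun k hk l hl x hx => ?_⟩
  have h1 := hk₀ k hk x hx
  have h2 := hk₀ l hl x hx
  calc dist (Φ k x) (Φ l x) ≤ dist (φ x) (Φ k x) + dist (φ x) (Φ l x) := dist_triangle_left _ _ _
    _ < δ := by linarith

/-- Uniform Cauchy estimate for the degree pairings. -/
lemma Approx.cmp (hA : Approx U φ A Φ) (hφ : ContinuousOn φ U) (hn : 0 < n) {K : Set (En n)}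
    (hKU : K ⊆ U) (hK : IsCompact K) {R M L : ℝ} (hM : 0 ≤ M) (hL : 0 ≤ L) {ω : ℝ → ℝ}
    (hω : ∀ ε > 0, 0 < ω ε) {δ : ℝ} (hδ : 0 < δ) :
    ∃ k₀, ∀ k ≥ k₀, ∀ l ≥ k₀, ∀ f F : En n → ℝ, IsTest U f → tsupport f ⊆ K →
      (∀ j x, |pd j f x| ≤ L) → Continuous F → (∀ y, |F y| ≤ M) → (∀ y, R < ‖y‖ → F y = 0) →
      (∀ ε > 0, ∀ y z, dist y z < ω ε → |F y - F z| ≤ ε) →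
      |degB (Φ k) f F - degB (Φ l) f F| ≤ δ := by
  obtain ⟨R₁, hR₁, hb⟩ := hA.bound hφ hKU hK
  obtain ⟨k₁, hk₁⟩ := eventually_atTop.1 hb
  set ρ := |R| + R₁ + 1
  have hρ : 0 ≤ ρ := by positivity
  set S := ∫ x in K, adjS (A x)
  have hS : 0 ≤ S := integral_nonneg fun _ => adjS_nonneg _
  obtain ⟨ε, hε, hεδ⟩ : ∃ ε : ℝ, 0 < ε ∧ ρ * L * (ε * S + (ε + M) * ε + M * ε) ≤ δ := by
    have : Tendsto (fun ε : ℝ => ρ * L * (ε * S + (ε + M) * ε + M * ε)) (nhds 0) (nhds 0) := by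
      have : Continuous (fun ε : ℝ => ρ * L * (ε * S + (ε + M) * ε + M * ε)) := by fun_prop
      simpa using this.tendsto 0
    have h1 := (this.eventually (gt_mem_nhds hδ)).filter_mono (nhdsWithin_le_nhds (s := Ioi 0))
    obtain ⟨ε, h2, h3⟩ := (h1.and self_mem_nhdsWithin).exists
    exact ⟨ε, h3, h2.le⟩
  obtain ⟨k₂, hk₂⟩ := hA.dist_ev hKU hK (hω ε hε)
  obtain ⟨k₃, hk₃⟩ := eventually_atTop.1 ((hA.adjD_lim hKU hK).eventually (gt_mem_nhds hε))
  refine ⟨max k₁ (max k₂ k₃), fun k hk l hl f F hf hfK hfL hF hFM hFR hFω => ?_⟩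
  set h : En n := EuclideanSpace.single ⟨0, hn⟩ ρ
  have hh : ∀ i, |h i| ≤ ρ := by
    intro i
    refine (abs_coord_le h i).trans ?_
    simp [h, abs_of_nonneg hρ]
  have hshift : ∀ k ≥ k₁, degB (Φ k) f F =
      -∫ s in (0:ℝ)..1, ∫ x in tsupport f, F (Φ k x - s • h) * cofD f (Jm (Φ k)) h x := by
    intro k hk
    rw [← degB_shift (hA.smooth k) hf hF h]
    have : degB (Φ k) f (fun y => F (y - h)) = 0 := by
      refine setIntegral_eq_zero_of_forall_eq_zero fun x hx => ?_
      simp only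
      rw [hFR, zero_mul]
      have h1 := hk₁ k hk x (hfK hx)
      have h2 := norm_sub_norm_le h (Φ k x)
      rw [norm_sub_rev] at h2
      have h3 : ‖h‖ = ρ := by simp [h, abs_of_nonneg hρ]
      have : ρ = |R| + R₁ + 1 := rfl
      linarith [le_abs_self R]
    rw [this]; ring
  have hk1 : k ≥ k₁ := (le_max_left _ _).trans hk
  have hl1 : l ≥ k₁ := (le_max_left _ _).trans hl
  have hk2 : k ≥ k₂ := (le_max_left _ _).trans ((le_max_right _ _).trans hk)
  have hl2 : l ≥ k₂ := (le_max_left _ _).trans ((le_max_right _ _).trans hl)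
  have hk3 : k ≥ k₃ := (le_max_right _ _).trans ((le_max_right _ _).trans hk)
  have hl3 : l ≥ k₃ := (le_max_right _ _).trans ((le_max_right _ _).trans hl)
  have hcont : ∀ k, Continuous
      fun s : ℝ => ∫ x in tsupport f, F (Φ k x - s • h) * cofD f (Jm (Φ k)) h x := by
    intro k
    refine continuous_parametric_integral_of_continuous (X := ℝ)
      (f := fun s x => F (Φ k x - s • h) * cofD f (Jm (Φ k)) h x) ?_ hf.2.1
    refine (hF.comp ?_).mul ((cofD_continuous (hA.smooth k) hf.1 h).comp continuous_snd)
    exact ((hA.smooth k).continuous.comp continuous_snd).sub (continuous_fst.smul continuous_const)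
  rw [hshift k hk1, hshift l hl1, neg_sub_neg,
    ← intervalIntegral.integral_sub ((hcont l).intervalIntegrable _ _)
      ((hcont k).intervalIntegrable _ _)]
  have := intervalIntegral.norm_integral_le_of_norm_le_const (a := (0:ℝ)) (b := 1) (C := δ)
    (f := fun s => (∫ x in tsupport f, F (Φ l x - s • h) * cofD f (Jm (Φ l)) h x) -
      ∫ x in tsupport f, F (Φ k x - s • h) * cofD f (Jm (Φ k)) h x) ?_
  · simpa using this
  · intro s _
    refine (hA.cmp_point hf hL hρ hM hε.le hfL hh hF hFM s ?_).trans ?_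
    · intro x hx
      apply hFω ε hε
      rw [dist_sub_right]
      exact hk₂ l hl2 k hk2 x (hfK hx)
    · have hintg : IntegrableOn (fun x => ρ * L * (ε * adjS (A x) +
          (ε + M) * adjD (Jm (Φ l) x) (A x) + M * adjD (Jm (Φ k) x) (A x))) K :=
        ((((hA.adjS_int hKU hK).const_mul ε).add ((hA.adjD_int hKU hK l).const_mul _)).add
          ((hA.adjD_int hKU hK k).const_mul _)).const_mul _
      refine (setIntegral_mono_set hintg ?_ (LE.le.eventuallyLE hfK)).trans ?_
      · refine Eventually.of_forall fun x => ?_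
        have := adjS_nonneg (A x)
        have := adjD_nonneg (Jm (Φ l) x) (A x)
        have := adjD_nonneg (Jm (Φ k) x) (A x)
        simp only [Pi.zero_apply]
        positivity
      · rw [integral_const_mul, integral_add, integral_add, integral_const_mul, integral_const_mul,
          integral_const_mul]
        · refine le_trans ?_ hεδ
          have := (hk₃ k hk3).le
          have := (hk₃ l hl3).le
          gcongr
        · exact (hA.adjS_int hKU hK).const_mul ε
        · exact (hA.adjD_int hKU hK l).const_mul _
        · exact ((hA.adjS_int hKU hK).const_mul ε).add ((hA.adjD_int hKU hK l).const_mul _)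
        · exact (hA.adjD_int hKU hK k).const_mul _

lemma pd_bound_of_isTest {f : En n → ℝ} (hf : IsTest U f) : ∃ L, 0 ≤ L ∧ ∀ j x, |pd j f x| ≤ L := by
  have : ∀ j, ∃ L, ∀ x, ‖pd j f x‖ ≤ L := fun j =>
    (hf.pd j).2.1.exists_bound_of_continuous (hf.pd j).continuous
  choose L hL using this
  refine ⟨∑ j, |L j|, Finset.sum_nonneg fun _ _ => abs_nonneg _, fun j x => ?_⟩
  refine ((hL j x).trans (le_abs_self _)).trans ?_
  exact Finset.single_le_sum (f := fun j => |L j|) (fun _ _ => abs_nonneg _) (Finset.mem_univ j)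

lemma Approx.tendsto (hA : Approx U φ A Φ) (hφ : ContinuousOn φ U) (hn : 0 < n) {f F : En n → ℝ}
    (hf : IsTest U f) (hF : Continuous F) (hFc : HasCompactSupport F) :
    Tendsto (fun k => degB (Φ k) f F) atTop (nhds (degN Φ f F)) := by
  have : CauchySeq fun k => degB (Φ k) f F := by
    rw [Metric.cauchySeq_iff]
    intro δ hδ
    obtain ⟨L, hL, hfL⟩ := pd_bound_of_isTest hf
    obtain ⟨M, hM⟩ := hFc.exists_bound_of_continuous hF
    obtain ⟨R, hR⟩ := hFc.isBounded.subset_closedBall (0 : En n)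
    have hu := Metric.uniformContinuous_iff.1 (hFc.uniformContinuous_of_continuous hF)
    choose! ω hω hω' using hu
    obtain ⟨k₀, hk₀⟩ := hA.cmp hφ hn hf.2.2 hf.2.1 (R := R) (abs_nonneg M) hL (ω := ω)
      (fun ε hε => hω ε hε) (half_pos hδ)
    refine ⟨k₀, fun k hk l hl => ?_⟩
    rw [Real.dist_eq]
    refine (hk₀ k hk l hl f F hf le_rfl hfL hF (fun y => (hM y).trans (le_abs_self _)) ?_ ?_).trans_lt
      (by linarith)
    · intro y hy
      apply image_eq_zero_of_notMem_tsupport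
      intro h
      have := hR h
      simp at this
      linarith
    · intro ε hε y z hyz
      exact (hω' ε hε hyz).le
  exact this.tendsto_limUnder

end Limit

section DegreeLimit
variable {n : ℕ} {U : Set (En n)} {φ : En n → En n} {A : En n → Matrix (Fin n) (Fin n) ℝ}
  {Φ : ℕ → En n → En n}

lemma integrableOn_of_continuous {f : En n → ℝ} (hf : Continuous f) {K : Set (En n)}
    (hK : IsCompact K) : IntegrableOn f K := hf.continuousOn.integrableOn_compact hK

lemma degN_eq {f F : En n → ℝ} {a : ℝ} (h : Tendsto (fun k => degB (Φ k) f F) atTop (nhds a)) :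
    degN Φ f F = a := h.limUnder_eq

lemma IsTest.sub {u v : En n → ℝ} (h : IsTest U u) (hv : IsTest U v) :
    IsTest U (fun x => u x - v x) := by
  have := h.add (hv.mul_left (v := fun _ => -1) contDiff_const)
  simpa [sub_eq_add_neg] using this

lemma IsTest.const_mul {u : En n → ℝ} (h : IsTest U u) (a : ℝ) : IsTest U (fun x => a * u x) :=
  h.mul_left contDiff_const

lemma degB_sub_left {Ψ : En n → En n} (hΨ : ContDiff ℝ (⊤ : ℕ∞) Ψ) {f g F : En n → ℝ}
    (hf : IsTest U f) (hg : IsTest U g) (hF : Continuous F) (a : ℝ) :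
    degB Ψ (fun x => f x - a * g x) F = degB Ψ f F - a * degB Ψ g F := by
  rw [degB_eq, degB_eq, degB_eq, ← integral_const_mul, ← integral_sub (degB_integrable hΨ hf hF)
    ((degB_integrable hΨ hg hF).const_mul a)]
  congr 1; ext x; ring

lemma degB_sum_right {Ψ : En n → En n} (hΨ : ContDiff ℝ (⊤ : ℕ∞) Ψ) {f : En n → ℝ}
    (hf : IsTest U f) {m : ℕ} {F : Fin m → En n → ℝ} (hF : ∀ i, Continuous (F i)) :
    degB Ψ f (fun y => ∑ i, F i y) = ∑ i, degB Ψ f (F i) := by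
  simp only [degB_eq]
  rw [← integral_finsetSum _ fun i _ => degB_integrable hΨ hf (hF i)]
  congr 1; ext x; rw [Finset.sum_mul]

lemma Approx.sub_left (hA : Approx U φ A Φ) (hφ : ContinuousOn φ U) (hn : 0 < n)
    {f g F : En n → ℝ} (hf : IsTest U f) (hg : IsTest U g) (hF : Continuous F)
    (hFc : HasCompactSupport F) (a : ℝ) :
    degN Φ (fun x => f x - a * g x) F = degN Φ f F - a * degN Φ g F := by
  apply degN_eq
  simp_rw [fun k => degB_sub_left (hA.smooth k) hf hg hF a]
  exact (hA.tendsto hφ hn hf hF hFc).sub ((hA.tendsto hφ hn hg hF hFc).const_mul a)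

lemma Approx.sum_right (hA : Approx U φ A Φ) (hφ : ContinuousOn φ U) (hn : 0 < n)
    {f : En n → ℝ} (hf : IsTest U f) {m : ℕ} {F : Fin m → En n → ℝ} (hF : ∀ i, Continuous (F i))
    (hFc : ∀ i, HasCompactSupport (F i)) :
    degN Φ f (fun y => ∑ i, F i y) = ∑ i, degN Φ f (F i) := by
  apply degN_eq
  simp_rw [fun k => degB_sum_right (hA.smooth k) hf hF]
  exact tendsto_finsetSum _ fun i _ => hA.tendsto hφ hn hf (hF i) (hFc i)

lemma degB_conv {Ψ : En n → En n} (hΨ : ContDiff ℝ (⊤ : ℕ∞) Ψ) {f β F : En n → ℝ}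
    (hf : IsTest U f) (hβ : Continuous β) (hβc : HasCompactSupport β) (hF : Continuous F) :
    degB Ψ f (fun z => ∫ y, β y * F (z - y)) = ∫ y, β y * degB Ψ f (fun z => F (z - y)) := by
  have hJ := Jm_continuous (hΨ.of_le (by simp : (1 : WithTop ℕ∞) ≤ (⊤ : ℕ∞)))
  have hΨc := hΨ.continuous
  have hfc := hf.continuous
  have hd : Continuous fun x => (Jm Ψ x).det := hJ.matrix_det
  simp only [degB_eq]
  have := integral_integral_swap_of_hasCompactSupport (μ := (volume : Measure (En n)))
    (ν := (volume : Measure (En n)))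
    (f := fun x y => β y * F (Ψ x - y) * (f x * (Jm Ψ x).det)) ?_ ?_
  · simp_rw [← integral_mul_const, this, ← integral_const_mul, mul_assoc]
  · simp only [Function.uncurry_def]
    fun_prop
  · refine HasCompactSupport.intro (hf.2.1.prod hβc) ?_
    rintro ⟨x, y⟩ hxy
    rw [mem_prod, not_and_or] at hxy
    rcases hxy with h | h
    · simp [Function.uncurry, image_eq_zero_of_notMem_tsupport h]
    · simp [Function.uncurry, image_eq_zero_of_notMem_tsupport h]

lemma degB_shift_le {Ψ : En n → En n} (hΨ : ContDiff ℝ (⊤ : ℕ∞) Ψ) {f F : En n → ℝ}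
    (hf : IsTest U f) (hF : Continuous F) {M L ρ : ℝ} (hM : ∀ y, |F y| ≤ M)
    (hL : ∀ j x, |pd j f x| ≤ L) (hρ : 0 ≤ ρ) {h : En n} (hh : ∀ i, |h i| ≤ ρ) {K : Set (En n)}
    (hK : IsCompact K) (hfK : tsupport f ⊆ K) (hL0 : 0 ≤ L) :
    |degB Ψ f (fun y => F (y - h)) - degB Ψ f F| ≤ M * (ρ * L * ∫ x in K, adjS (Jm Ψ x)) := by
  rw [degB_shift hΨ hf hF]
  have hJ := Jm_continuous (hΨ.of_le (by simp : (1 : WithTop ℕ∞) ≤ (⊤ : ℕ∞)))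
  have hSc : Continuous fun x => adjS (Jm Ψ x) :=
    continuous_finsetSum _ fun i _ => continuous_finsetSum _ fun j _ =>
      (hJ.matrix_adjugate.matrix_elem j i).abs
  have := intervalIntegral.norm_integral_le_of_norm_le_const (a := (0:ℝ)) (b := 1)
    (C := M * (ρ * L * ∫ x in K, adjS (Jm Ψ x)))
    (f := fun s => ∫ x in tsupport f, F (Ψ x - s • h) * cofD f (Jm Ψ) h x) ?_
  · simpa using this
  · intro s _
    have hM0 : 0 ≤ M := (abs_nonneg _).trans (hM 0)
    calc ‖∫ x in tsupport f, F (Ψ x - s • h) * cofD f (Jm Ψ) h x‖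
        ≤ ∫ x in tsupport f, M * (ρ * L * adjS (Jm Ψ x)) := by
          refine norm_integral_le_of_norm_le
            (integrableOn_of_continuous (f := fun x => M * (ρ * L * adjS (Jm Ψ x)))
              (by fun_prop) hf.2.1) (Eventually.of_forall fun x => ?_)
          rw [norm_mul]
          exact mul_le_mul (hM _) (abs_cofD_le (hL · x) hh hρ _) (norm_nonneg _) hM0
      _ ≤ ∫ x in K, M * (ρ * L * adjS (Jm Ψ x)) := by
          refine setIntegral_mono_set (integrableOn_of_continuous
            (f := fun x => M * (ρ * L * adjS (Jm Ψ x))) (by fun_prop) hK)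
            (Eventually.of_forall fun x => ?_) (LE.le.eventuallyLE hfK)
          have := adjS_nonneg (Jm Ψ x)
          simp only [Pi.zero_apply]
          positivity
      _ = _ := by rw [integral_const_mul, integral_const_mul]

/-- Pairings vanish if the supports are separated by `φ`. -/
lemma Approx.degN_zero (hA : Approx U φ A Φ) (hφ : ContinuousOn φ U) {f F : En n → ℝ}
    (hf : IsTest U f) (hd : ∀ x ∈ tsupport f, φ x ∉ tsupport F) : degN Φ f F = 0 := by
  apply degN_eq
  have hc : IsCompact (φ '' tsupport f) := hf.2.1.image_of_continuousOn (hφ.mono hf.2.2)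
  have hdj : Disjoint (φ '' tsupport f) (tsupport F) := by
    rw [Set.disjoint_left]
    rintro _ ⟨x, hx, rfl⟩
    exact hd x hx
  obtain ⟨δ, hδ, hδ'⟩ := hdj.exists_thickenings hc (isClosed_tsupport F)
  apply tendsto_const_nhds.congr'
  filter_upwards [Metric.tendstoUniformlyOn_iff.1 (hA.unif _ hf.2.2 hf.2.1) δ hδ] with k hk
  symm
  refine setIntegral_eq_zero_of_forall_eq_zero fun x hx => ?_
  rw [image_eq_zero_of_notMem_tsupport (f := F), zero_mul]
  intro h
  refine Set.disjoint_left.1 hδ' ?_ (self_subset_thickening hδ _ h)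
  exact mem_thickening_iff.2 ⟨φ x, mem_image_of_mem _ hx, by rw [dist_comm]; exact hk x hx⟩

lemma exists_bump (y : En n) {r : ℝ} (hr : 0 < r) : ∃ β : En n → ℝ, ContDiff ℝ (⊤ : ℕ∞) β ∧
    HasCompactSupport β ∧ tsupport β ⊆ closedBall y r ∧ (∀ x, 0 ≤ β x) ∧ ∫ x, β x = 1 := by
  let b : ContDiffBump y := ⟨r / 2, r, by positivity, by linarith⟩
  refine ⟨b.normed volume, b.contDiff_normed, b.hasCompactSupport_normed, ?_,
    fun x => b.nonneg_normed x, b.integral_normed⟩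
  rw [b.tsupport_normed_eq]

/-- The pairing is small for uniformly small functions with bounded gradient. -/
lemma Approx.small (hA : Approx U φ A Φ) (hφ : ContinuousOn φ U) (hn : 0 < n) {K : Set (En n)}
    (hKU : K ⊆ U) (hK : IsCompact K) {R M L : ℝ} (hM : 0 ≤ M) (hL : 0 ≤ L) {δ : ℝ} (hδ : 0 < δ) :
    ∃ σ > 0, ∀ f F : En n → ℝ, IsTest U f → tsupport f ⊆ K → (∀ j x, |pd j f x| ≤ L) →
      (∀ x, |f x| ≤ σ) → Continuous F → (∀ y, |F y| ≤ M) → (∀ y, R < ‖y‖ → F y = 0) →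
      |degN Φ f F| ≤ δ := by
  set S := ∫ x in K, adjS (A x)
  have hS : 0 ≤ S := integral_nonneg fun _ => adjS_nonneg _
  obtain ⟨ε, hε, hεδ⟩ : ∃ ε : ℝ, 0 < ε ∧ M * (ε * L * (S + 1)) ≤ δ / 3 := by
    have : Tendsto (fun ε : ℝ => M * (ε * L * (S + 1))) (nhds 0) (nhds 0) := by
      have : Continuous (fun ε : ℝ => M * (ε * L * (S + 1))) := by fun_prop
      simpa using this.tendsto 0
    have h1 := (this.eventually (gt_mem_nhds (by positivity : 0 < δ / 3))).filter_mono
      (nhdsWithin_le_nhds (s := Ioi 0))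
    obtain ⟨ε, h2, h3⟩ := (h1.and self_mem_nhdsWithin).exists
    exact ⟨ε, h3, h2.le⟩
  obtain ⟨β, hβs, hβc, hβε, hβ0, hβ1⟩ := exists_bump (0 : En n) hε
  have hβ := hβs.continuous
  obtain ⟨C, hC⟩ := (hβs.of_le (by simp : (1 : WithTop ℕ∞) ≤ (⊤ : ℕ∞))).lipschitzWith_of_hasCompactSupport
    hβc (by simp)
  set V := volume.real (closedBall (0 : En n) R)
  have hV : 0 ≤ V := measureReal_nonneg
  set ℓ : ℝ := C * M * V + 1
  have hℓ : 0 < ℓ := by positivity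
  obtain ⟨k₀, hk₀⟩ := hA.cmp hφ hn hKU hK (R := R + ε) hM hL (ω := fun t => t / ℓ)
    (fun t ht => by positivity) (by positivity : 0 < δ / 3)
  set D := ∫ x in K, |(Jm (Φ k₀) x).det|
  have hD : 0 ≤ D := integral_nonneg fun _ => abs_nonneg _
  refine ⟨δ / 3 / (M * D + 1), by positivity, fun f F hf hfK hfL hfσ hF hFM hFR => ?_⟩
  have hFc : HasCompactSupport F := HasCompactSupport.intro (isCompact_closedBall (0 : En n) R)
    fun y hy => hFR y (by simpa using hy)
  set G : En n → ℝ := fun z => ∫ y, β y * F (z - y)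
  have hG' : ∀ z, G z = ∫ y in closedBall (0 : En n) R, β (z - y) * F y := by
    intro z
    rw [setIntegral_eq_integral_of_forall_compl_eq_zero]
    · rw [← integral_sub_left_eq_self _ volume z]
      simp [G]
    · intro y hy
      rw [hFR y (by simpa using hy), mul_zero]
  have hintg : ∀ z, IntegrableOn (fun y => β (z - y) * F y) (closedBall (0 : En n) R) := fun z =>
    integrableOn_of_continuous (by fun_prop) (isCompact_closedBall _ _)
  have hGω : ∀ y z, |G y - G z| ≤ ℓ * dist y z := by
    intro y z
    rw [hG', hG', ← integral_sub (hintg y) (hintg z)]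
    have := norm_setIntegral_le_of_norm_le_const (μ := (volume : Measure (En n)))
      (s := closedBall (0 : En n) R) (C := C * dist y z * M)
      (f := fun t => β (y - t) * F t - β (z - t) * F t) measure_closedBall_lt_top ?_
    · rw [Real.norm_eq_abs] at this
      refine this.trans ?_
      have h0 : (0:ℝ) ≤ dist y z := dist_nonneg
      change (C:ℝ) * dist y z * M * V ≤ (C * M * V + 1) * dist y z
      nlinarith
    · intro t _
      rw [← sub_mul, norm_mul]
      refine mul_le_mul ?_ (hFM t) (norm_nonneg _) (by positivity)
      have := hC.dist_le_mul (y - t) (z - t)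
      rwa [dist_sub_right, Real.dist_eq] at this
  have hGc : Continuous G := by
    have : LipschitzWith ⟨ℓ, hℓ.le⟩ G := LipschitzWith.of_dist_le_mul fun y z => by
      rw [Real.dist_eq]; exact hGω y z
    exact this.continuous
  have hGM : ∀ z, |G z| ≤ M := by
    intro z
    have hb : ∀ y, ‖β y * F (z - y)‖ ≤ β y * M := by
      intro y
      rw [norm_mul, Real.norm_of_nonneg (hβ0 y)]
      exact mul_le_mul_of_nonneg_left (hFM _) (hβ0 y)
    have := norm_integral_le_of_norm_le
      ((hβ.integrable_of_hasCompactSupport (μ := volume) hβc).mul_const M)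
      (Eventually.of_forall hb)
    rwa [integral_mul_const, hβ1, one_mul] at this
  have hGR : ∀ z, R + ε < ‖z‖ → G z = 0 := by
    intro z hz
    refine integral_eq_zero_of_ae (Eventually.of_forall fun y => ?_)
    by_cases hy : y ∈ tsupport β
    · have h1 := hβε hy
      rw [mem_closedBall_zero_iff] at h1
      have h2 := norm_sub_norm_le z y
      simp [hFR (z - y) (by linarith)]
    · simp [image_eq_zero_of_notMem_tsupport hy]
  have hk0 : |degB (Φ k₀) f G| ≤ δ / 3 := by
    have hdc : Continuous fun x => |(Jm (Φ k₀) x).det| :=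
      (Jm_continuous ((hA.smooth k₀).of_le (by simp))).matrix_det.abs
    have : ‖degB (Φ k₀) f G‖ ≤ ∫ x in tsupport f, M * (δ / 3 / (M * D + 1) * |(Jm (Φ k₀) x).det|) := by
      refine norm_integral_le_of_norm_le (integrableOn_of_continuous (by fun_prop) hf.2.1)
        (Eventually.of_forall fun x => ?_)
      rw [norm_mul, norm_mul]
      refine mul_le_mul (hGM _) (mul_le_mul_of_nonneg_right (hfσ x) (norm_nonneg _)) (by positivity)
        hM
    refine this.trans ?_
    calc ∫ x in tsupport f, M * (δ / 3 / (M * D + 1) * |(Jm (Φ k₀) x).det|)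
        ≤ ∫ x in K, M * (δ / 3 / (M * D + 1) * |(Jm (Φ k₀) x).det|) := by
          refine setIntegral_mono_set (integrableOn_of_continuous (by fun_prop) hK)
            (Eventually.of_forall fun x => ?_) (LE.le.eventuallyLE hfK)
          simp only [Pi.zero_apply]
          positivity
      _ = M * D * (δ / 3) / (M * D + 1) := by
          rw [integral_const_mul, integral_const_mul]
          change M * (δ / 3 / (M * D + 1) * D) = _
          ring
      _ ≤ δ / 3 := by
          rw [div_le_iff₀ (by positivity)]
          nlinarith
  have hev : ∀ᶠ k in atTop, |degB (Φ k) f F| ≤ δ := by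
    filter_upwards [eventually_ge_atTop k₀,
      (hA.adjD_lim hKU hK).eventually (gt_mem_nhds one_pos)] with k hk hk1
    have h1 := hk₀ k hk k₀ le_rfl f G hf hfK hfL hGc hGM hGR (fun t ht y z hyz => by
      refine (hGω y z).trans ?_
      rw [lt_div_iff₀ hℓ] at hyz
      linarith)
    have hS' : ∫ x in K, adjS (Jm (Φ k) x) ≤ S + 1 := by
      have hJ := Jm_continuous ((hA.smooth k).of_le (by simp : (1 : WithTop ℕ∞) ≤ (⊤ : ℕ∞)))
      have hSc : Continuous fun x => adjS (Jm (Φ k) x) :=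
        continuous_finsetSum _ fun i _ => continuous_finsetSum _ fun j _ =>
          (hJ.matrix_adjugate.matrix_elem j i).abs
      calc _ ≤ ∫ x in K, (adjS (A x) + adjD (Jm (Φ k) x) (A x)) :=
            integral_mono (integrableOn_of_continuous hSc hK)
              ((hA.adjS_int hKU hK).add (hA.adjD_int hKU hK k)) fun x => adjS_le _ _
        _ ≤ S + 1 := by
            rw [integral_add (hA.adjS_int hKU hK) (hA.adjD_int hKU hK k)]
            gcongr
    have h2 : |degB (Φ k) f G - degB (Φ k) f F| ≤ δ / 3 := by
      have e : degB (Φ k) f G - degB (Φ k) f F =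
          ∫ y, β y * (degB (Φ k) f (fun z => F (z - y)) - degB (Φ k) f F) := by
        have hi : Integrable fun y => β y * degB (Φ k) f (fun z => F (z - y)) := by
          refine Continuous.integrable_of_hasCompactSupport (hβ.mul ?_) hβc.mul_right
          refine continuous_parametric_integral_of_continuous (X := En n)
            (f := fun y x => F (Φ k x - y) * (f x * (Jm (Φ k) x).det)) ?_ hf.2.1
          have h1 := (hA.smooth k).continuous
          have h2 := hf.continuous
          have h3 : Continuous fun x => (Jm (Φ k) x).det :=
            (Jm_continuous ((hA.smooth k).of_le (by simp))).matrix_det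
          exact (hF.comp ((h1.comp continuous_snd).sub continuous_fst)).mul
            ((h2.comp continuous_snd).mul (h3.comp continuous_snd))
        simp_rw [mul_sub]
        rw [integral_sub hi ((hβ.integrable_of_hasCompactSupport hβc).mul_const _),
          integral_mul_const, hβ1, one_mul, ← degB_conv (hA.smooth k) hf hβ hβc hF]
      rw [e]
      have hb : ∀ y, ‖β y * (degB (Φ k) f (fun z => F (z - y)) - degB (Φ k) f F)‖ ≤
          β y * (δ / 3) := by
        intro y
        rw [norm_mul, Real.norm_of_nonneg (hβ0 y)]
        by_cases hy : y ∈ tsupport β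
        · refine mul_le_mul_of_nonneg_left ?_ (hβ0 y)
          have hyε := hβε hy
          rw [mem_closedBall_zero_iff] at hyε
          refine (degB_shift_le (hA.smooth k) hf hF hFM hfL hε.le
            (fun i => (abs_coord_le y i).trans hyε) hK hfK hL).trans (le_trans ?_ hεδ)
          gcongr
        · simp [image_eq_zero_of_notMem_tsupport hy]
      have := norm_integral_le_of_norm_le
        ((hβ.integrable_of_hasCompactSupport (μ := volume) hβc).mul_const (δ / 3))
        (Eventually.of_forall hb)
      rwa [integral_mul_const, hβ1, one_mul] at this
    rw [abs_le] at *
    constructor <;> linarith [h1.1, h1.2, h2.1, h2.2, hk0.1, hk0.2]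
  exact le_of_tendsto (hA.tendsto hφ hn hf hF hFc).abs hev

end DegreeLimit

/-- Near `y` the limiting degree equals `c`. -/
def LocDeg {n : ℕ} (U U' : Set (En n)) (φ : En n → En n) (Φ : ℕ → En n → En n) (y : En n)
    (c : ℝ) : Prop :=
  ∃ r > 0, closedBall y r ⊆ U' ∧ ∀ f F : En n → ℝ, IsTest U f → Continuous F →
    HasCompactSupport F → tsupport F ⊆ ball y r → (∀ x ∈ U, φ x ∈ ball y r → f x = 1) →
    degN Φ f F = c * ∫ z, F z

section Degree
variable {n : ℕ} {U U' : Set (En n)} {φ ψ : En n → En n} {A : En n → Matrix (Fin n) (Fin n) ℝ}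
  {Φ : ℕ → En n → En n}

lemma Approx.degN_zero_of_open (hA : Approx U φ A Φ) (hU : IsOpen U) (hφ : ContinuousOn φ U)
    {f F : En n → ℝ} (hf : IsTest U f) {W : Set (En n)} (hW : IsOpen W) (hFW : tsupport F ⊆ W)
    (h : ∀ x ∈ U, φ x ∈ W → f x = 0) : degN Φ f F = 0 := by
  refine hA.degN_zero hφ hf fun x hx hxF => ?_
  have hn : U ∩ φ ⁻¹' W ∈ nhds x :=
    (hφ.isOpen_inter_preimage hU hW).mem_nhds ⟨hf.2.2 hx, hFW hxF⟩
  refine (notMem_tsupport_iff_eventuallyEq.2 ?_) hx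
  filter_upwards [hn] with z hz
  exact h z hz.1 hz.2

/-- A cutoff adapted to a compact subset of the target. -/
lemma exists_cutoff_image (hU : IsOpen U) (hφ : IsHomeoOn U U' φ ψ) {K : Set (En n)}
    (hK : IsCompact K) (hKU : K ⊆ U') : ∃ χ : En n → ℝ, IsTest U χ ∧
      (∀ x ∈ U, φ x ∈ K → χ x = 1 ∧ ∀ j, pd j χ x = 0) := by
  obtain ⟨hφc, hψc, hm, hm', h1, h2⟩ := hφ
  obtain ⟨χ, hχ, -, W, hW, hKW, hχ1⟩ := exists_cutoff
    (hK.image_of_continuousOn (hψc.mono hKU)) hU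
    (by rintro _ ⟨y, hy, rfl⟩; exact hm' (hKU hy))
  refine ⟨χ, hχ, fun x hx hxK => ?_⟩
  have hxW : x ∈ W := hKW ⟨φ x, hxK, h1 x hx⟩
  refine ⟨hχ1 x hxW, fun j => ?_⟩
  have : χ =ᶠ[nhds x] fun _ => 1 := by
    filter_upwards [hW.mem_nhds hxW] with z hz using hχ1 z hz
  rw [pd_congr this]
  simp [pd]

lemma Approx.exists_locDeg (hA : Approx U φ A Φ) (hn : 0 < n) (hU : IsOpen U) (hU' : IsOpen U')
    (hφ : IsHomeoOn U U' φ ψ) {y₀ : En n} (hy : y₀ ∈ U') : ∃ c, LocDeg U U' φ Φ y₀ c := by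
  obtain ⟨r₀, hr₀, hrU⟩ := Metric.nhds_basis_closedBall.mem_iff.1 (hU'.mem_nhds hy)
  set r := r₀ / 4
  have hr : 0 < r := by positivity
  have hr4 : 4 * r = r₀ := by simp [r]; ring
  obtain ⟨χ, hχ, hχ1⟩ := exists_cutoff_image hU hφ (isCompact_closedBall y₀ r₀) hrU
  have hinv : ∀ᶠ k in atTop, ∀ F : En n → ℝ, Continuous F → tsupport F ⊆ ball y₀ r →
      ∀ h : En n, ‖h‖ ≤ 2 * r → degB (Φ k) χ (fun z => F (z - h)) = degB (Φ k) χ F := by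
    filter_upwards [Metric.tendstoUniformlyOn_iff.1 (hA.unif _ hχ.2.2 hχ.2.1) r hr]
      with k hk F hF hFs h hh
    rw [← sub_eq_zero, degB_shift (hA.smooth k) hχ hF]
    refine intervalIntegral.integral_zero_ae (Eventually.of_forall fun s hs => ?_)
    rw [uIoc_of_le zero_le_one] at hs
    refine setIntegral_eq_zero_of_forall_eq_zero fun x hx => ?_
    by_cases hxb : φ x ∈ closedBall y₀ r₀
    · have : ∀ j, pd j χ x = 0 := (hχ1 x (hχ.2.2 hx) hxb).2
      simp [cofD, this]
    · rw [image_eq_zero_of_notMem_tsupport (f := F), zero_mul]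
      intro hm
      have h1 := hFs hm
      rw [mem_ball, dist_eq_norm] at h1
      rw [mem_closedBall, not_le, dist_eq_norm] at hxb
      have h2 := hk x hx
      rw [dist_eq_norm] at h2
      have h3 : ‖s • h‖ ≤ 2 * r := by
        rw [norm_smul, Real.norm_of_nonneg hs.1.le]
        nlinarith [norm_nonneg h, hs.2]
      have h4 : φ x - y₀ = (φ x - Φ k x) + (Φ k x - s • h - y₀) + s • h := by abel
      have h5 : ‖φ x - y₀‖ ≤ ‖φ x - Φ k x‖ + ‖Φ k x - s • h - y₀‖ + ‖s • h‖ := by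
        rw [h4]; exact norm_add₃_le
      linarith
  obtain ⟨β, hβs, hβc, hβr, hβ0, hβ1⟩ := exists_bump y₀ (half_pos hr)
  have hβ := hβs.continuous
  have hβr' : tsupport β ⊆ ball y₀ r := hβr.trans (closedBall_subset_ball (by linarith))
  have key : ∀ F : En n → ℝ, Continuous F → HasCompactSupport F → tsupport F ⊆ ball y₀ r →
      degN Φ χ F = degN Φ χ β * ∫ z, F z := by
    intro F hF hFc hFs
    apply degN_eq
    refine ((hA.tendsto hφ.1 hn hχ hβ hβc).mul_const _).congr' ?_
    filter_upwards [hinv] with k hk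
    have hsh : ∀ G : En n → ℝ, HasCompactSupport G → HasCompactSupport fun y => G (y + y₀) :=
      fun G hG => hG.comp_homeomorph (Homeomorph.addRight y₀)
    have e1 := degB_conv (hA.smooth k) hχ (β := fun y => β (y + y₀)) (by fun_prop) (hsh β hβc) hF
    have e2 := degB_conv (hA.smooth k) hχ (β := fun y => F (y + y₀)) (by fun_prop) (hsh F hFc) hβ
    have e3 : (fun z => ∫ y, β (y + y₀) * F (z - y)) = fun z => ∫ y, F (y + y₀) * β (z - y) := by
      ext z
      rw [← integral_sub_left_eq_self _ volume (z - y₀)]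
      congr 1
      ext y
      rw [mul_comm]
      congr 2 <;> abel
    have e4 : ∀ G H : En n → ℝ, tsupport G ⊆ ball y₀ r → Continuous H → tsupport H ⊆ ball y₀ r →
        ∫ y, G (y + y₀) * degB (Φ k) χ (fun z => H (z - y)) = (∫ y, G y) * degB (Φ k) χ H := by
      intro G H hG hH hHs
      rw [← integral_add_right_eq_self G y₀, ← integral_mul_const]
      congr 1
      ext y
      by_cases hy : y + y₀ ∈ tsupport G
      · rw [hk H hH hHs]
        have := hG hy
        rw [mem_ball, dist_eq_norm, add_sub_cancel_right] at this
        linarith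
      · simp [image_eq_zero_of_notMem_tsupport hy]
    rw [e3, e2, e4 F β hFs hβ hβr', e4 β F hβr' hF hFs, hβ1, one_mul] at e1
    rw [← e1, mul_comm]
  refine ⟨degN Φ χ β, r, hr, (closedBall_subset_closedBall (by linarith)).trans hrU, ?_⟩
  intro f F hf hF hFc hFs hf1
  have e := hA.sub_left hφ.1 hn hf hχ hF hFc 1
  rw [hA.degN_zero_of_open hU hφ.1 (hf.sub (hχ.const_mul 1)) isOpen_ball hFs] at e
  · rw [← key F hF hFc hFs]; linarith
  · intro x hx hxb
    rw [hf1 x hx hxb, (hχ1 x hx ?_).1]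
    · ring
    · exact ball_subset_closedBall (ball_subset_ball (by linarith) hxb)

lemma Approx.locDeg_ball (hA : Approx U φ A Φ) (hn : 0 < n) (hU : IsOpen U)
    (hφ : IsHomeoOn U U' φ ψ) {y₀ : En n} {c : ℝ} (h : LocDeg U U' φ Φ y₀ c) :
    ∃ r > 0, ∀ y ∈ ball y₀ r, LocDeg U U' φ Φ y c := by
  obtain ⟨r, hr, hrU, H⟩ := h
  obtain ⟨χ, hχ, hχ1⟩ := exists_cutoff_image hU hφ (isCompact_closedBall y₀ r) hrU
  refine ⟨r / 2, by positivity, fun y hy => ⟨r / 2, by positivity, ?_, ?_⟩⟩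
  · refine (closedBall_subset_closedBall' ?_).trans hrU
    rw [mem_ball] at hy
    linarith
  · have hsub : ball y (r / 2) ⊆ ball y₀ r := by
      apply ball_subset_ball'
      rw [mem_ball] at hy
      linarith
    intro f F hf hF hFc hFs hf1
    have e := hA.sub_left hφ.1 hn hf hχ hF hFc 1
    rw [hA.degN_zero_of_open hU hφ.1 (hf.sub (hχ.const_mul 1)) isOpen_ball hFs] at e
    · rw [← H χ F hχ hF hFc (hFs.trans hsub) fun x hx hxb =>
        (hχ1 x hx (ball_subset_closedBall hxb)).1]
      linarith
    · intro x hx hxb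
      rw [hf1 x hx hxb, (hχ1 x hx (ball_subset_closedBall (hsub hxb))).1]
      ring

lemma LocDeg.unique (hU : IsOpen U) (hφ : IsHomeoOn U U' φ ψ) {y : En n} {c c' : ℝ}
    (h : LocDeg U U' φ Φ y c) (h' : LocDeg U U' φ Φ y c') : c = c' := by
  obtain ⟨r, hr, hrU, H⟩ := h
  obtain ⟨r', hr', hrU', H'⟩ := h'
  obtain ⟨χ, hχ, hχ1⟩ := exists_cutoff_image hU hφ
    ((isCompact_closedBall y r).union (isCompact_closedBall y r')) (union_subset hrU hrU')
  have hm : 0 < min r r' / 2 := by positivity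
  obtain ⟨β, hβs, hβc, hβr, -, hβ1⟩ := exists_bump y hm
  have e := H χ β hχ hβs.continuous hβc (hβr.trans (closedBall_subset_ball
    (by linarith [min_le_left r r']))) fun x hx hxb => (hχ1 x hx (Or.inl (ball_subset_closedBall hxb))).1
  have e' := H' χ β hχ hβs.continuous hβc (hβr.trans (closedBall_subset_ball
    (by linarith [min_le_right r r']))) fun x hx hxb => (hχ1 x hx (Or.inr (ball_subset_closedBall hxb))).1
  rw [hβ1] at e e'
  linarith

lemma Approx.exists_deg (hA : Approx U φ A Φ) (hn : 0 < n) (hU : IsOpen U) (hU' : IsOpen U')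
    (hφ : IsHomeoOn U U' φ ψ) (hc : IsPreconnected U') : ∃ c, ∀ y ∈ U', LocDeg U U' φ Φ y c := by
  rcases U'.eq_empty_or_nonempty with he | ⟨y₀, hy₀⟩
  · exact ⟨0, by simp [he]⟩
  have hex := fun y : U' => hA.exists_locDeg hn hU hU' hφ y.2
  choose c hc' using hex
  have hl : IsLocallyConstant c := by
    rw [IsLocallyConstant.iff_eventually_eq]
    intro y
    obtain ⟨r, hr, H⟩ := hA.locDeg_ball hn hU hφ (hc' y)
    filter_upwards [ball_mem_nhds y hr] with z hz
    exact LocDeg.unique hU hφ (hc' z) (H z hz)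
  have : PreconnectedSpace U' := Subtype.preconnectedSpace hc
  refine ⟨c ⟨y₀, hy₀⟩, fun y hy => ?_⟩
  rw [hl.apply_eq_of_preconnectedSpace ⟨y₀, hy₀⟩ ⟨y, hy⟩]
  exact hc' ⟨y, hy⟩

lemma Approx.degN_of_locallyConst (hA : Approx U φ A Φ) (hn : 0 < n) (hU : IsOpen U)
    (hφ : IsHomeoOn U U' φ ψ) {c : ℝ} (hc : ∀ y ∈ U', LocDeg U U' φ Φ y c) {f F : En n → ℝ}
    (hf : IsTest U f) (hF : Continuous F) (hFc : HasCompactSupport F) (hFU : tsupport F ⊆ U')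
    (hl : ∀ y ∈ tsupport F, ∃ ε > 0, ∀ z ∈ ball y ε, z ∈ U' → f (ψ z) = f (ψ y)) :
    degN Φ f F = c * ∫ y, f (ψ y) * F y := by
  have hloc : ∀ y ∈ tsupport F, ∃ ρ > 0, ∀ g : En n → ℝ, Continuous g →
      tsupport g ⊆ ball y ρ → degN Φ f (fun z => g z * F z) = c * ∫ z, f (ψ z) * (g z * F z) ∧
      Integrable fun z => f (ψ z) * (g z * F z) := by
    intro y hy
    obtain ⟨ε, hε, hε'⟩ := hl y hy
    obtain ⟨r, hr, hrU, H⟩ := hc y (hFU hy)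
    obtain ⟨χ, hχ, hχ1⟩ := exists_cutoff_image hU hφ (isCompact_closedBall y r) hrU
    refine ⟨min ε r, by positivity, fun g hg hgs => ?_⟩
    have hGs : tsupport (fun z => g z * F z) ⊆ ball y (min ε r) :=
      (tsupport_mul_subset_left (f := g) (g := F)).trans hgs
    have hGc : HasCompactSupport fun z => g z * F z := hFc.mul_left
    have hG : Continuous fun z => g z * F z := hg.mul hF
    have e := hA.sub_left hφ.1 hn hf hχ hG hGc (f (ψ y))
    rw [hA.degN_zero_of_open hU hφ.1 (hf.sub (hχ.const_mul _)) isOpen_ball hGs] at e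
    · have hp : ∀ z, f (ψ z) * (g z * F z) = f (ψ y) * (g z * F z) := by
        intro z
        by_cases hz : z ∈ tsupport (fun z => g z * F z)
        · have hb := hGs hz
          rw [hε' z (ball_subset_ball (min_le_left _ _) hb)]
          exact hrU (ball_subset_closedBall (ball_subset_ball (min_le_right _ _) hb))
        · have : g z * F z = 0 := image_eq_zero_of_notMem_tsupport
            (f := fun z => g z * F z) hz
          rw [this]; simp
      simp_rw [hp]
      refine ⟨?_, (hG.integrable_of_hasCompactSupport hGc).const_mul _⟩
      rw [integral_const_mul]
      have := H χ _ hχ hG hGc (hGs.trans (ball_subset_ball (min_le_right _ _)))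
        fun x hx hxb => (hχ1 x hx (ball_subset_closedBall hxb)).1
      rw [this] at e
      linarith
    · intro x hx hxb
      have h1 := ball_subset_ball (min_le_right ε r) hxb
      have h2 := hε' _ (ball_subset_ball (min_le_left ε r) hxb) (hφ.2.2.1 hx)
      rw [hφ.2.2.2.2.1 x hx] at h2
      rw [(hχ1 x hx (ball_subset_closedBall h1)).1, h2]
      ring
  choose! ρ hρ H using hloc
  obtain ⟨t, ht, hcov⟩ := hFc.isCompact.elim_nhds_subcover (fun y => ball y (ρ y))
    fun y hy => ball_mem_nhds y (hρ y hy)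
  obtain ⟨g, hg1, hg2, -, -⟩ := exists_continuous_sum_one_of_isOpen_isCompact
    (s := fun i : Fin t.card => ball ((t.equivFin.symm i : En n)) (ρ (t.equivFin.symm i)))
    (fun i => isOpen_ball) hFc.isCompact (by
      intro y hy
      obtain ⟨z, hz, hyz⟩ := mem_iUnion₂.1 (hcov hy)
      exact mem_iUnion.2 ⟨t.equivFin ⟨z, hz⟩, by simpa using hyz⟩)
  have hFsum : F = fun y => ∑ i, g i y * F y := by
    ext y
    by_cases hy : y ∈ tsupport F
    · have := hg2 hy
      simp only [Finset.sum_apply, Pi.one_apply] at this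
      rw [← Finset.sum_mul, this, one_mul]
    · simp [image_eq_zero_of_notMem_tsupport hy]
  have hH := fun i => H _ (ht _ (t.equivFin.symm i).2) (g i) (g i).continuous (hg1 i)
  calc degN Φ f F = degN Φ f (fun y => ∑ i, g i y * F y) := by rw [← hFsum]
    _ = ∑ i, degN Φ f (fun y => g i y * F y) :=
      hA.sum_right hφ.1 hn hf (fun i => (g i).continuous.mul hF) fun i => hFc.mul_left
    _ = ∑ i, c * ∫ z, f (ψ z) * (g i z * F z) := Finset.sum_congr rfl fun i _ => (hH i).1
    _ = c * ∫ z, ∑ i, f (ψ z) * (g i z * F z) := by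
      rw [← Finset.mul_sum, integral_finsetSum _ fun i _ => (hH i).2]
    _ = _ := by
      simp_rw [← Finset.mul_sum]
      congr 2
      ext z
      conv_rhs => rw [hFsum]

end Degree

/-- A bounded smooth periodic function with slope one where the cosine is large. -/
lemma exists_sawtooth : ∃ P : ℝ → ℝ, ContDiff ℝ (⊤ : ℕ∞) P ∧ ∃ B > 0, (∀ x, |P x| ≤ B) ∧
    (∀ x, |deriv P x| ≤ B) ∧ ∀ x, 1 / 2 < Real.cos x → deriv P x = 1 := by
  let χ : ContDiffBump (0 : ℝ) := ⟨0.88, 0.95, by norm_num, by norm_num⟩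
  let g : ℝ → ℝ := fun s => χ s * Real.arcsin s
  have hgs : ContDiff ℝ (⊤ : ℕ∞) g := by
    rw [contDiff_iff_contDiffAt]
    intro s
    by_cases hs : s ∈ ball (0:ℝ) 1
    · rw [mem_ball_zero_iff, Real.norm_eq_abs, abs_lt] at hs
      exact χ.contDiff.contDiffAt.mul (Real.contDiffAt_arcsin (by linarith) (by linarith))
    · have : g =ᶠ[nhds s] fun _ => 0 := by
        have : s ∈ (closedBall (0:ℝ) 0.95)ᶜ := fun h => hs (closedBall_subset_ball (by norm_num) h)
        filter_upwards [isClosed_closedBall.isOpen_compl.mem_nhds this] with z hz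
        have : χ z = 0 := χ.zero_of_le_dist (by
          rw [mem_compl_iff, mem_closedBall, not_le] at hz
          exact hz.le)
        simp [g, this]
      exact contDiffAt_const.congr_of_eventuallyEq this
  have hgc : HasCompactSupport g := χ.hasCompactSupport.mul_right
  obtain ⟨B₁, hB₁⟩ := hgc.exists_bound_of_continuous hgs.continuous
  obtain ⟨B₂, hB₂⟩ := hgc.deriv.exists_bound_of_continuous (hgs.continuous_deriv (by simp))
  have hgd : Differentiable ℝ g := hgs.differentiable (by simp)
  have hd : ∀ x, HasDerivAt (fun x => g (Real.sin x)) (deriv g (Real.sin x) * Real.cos x) x :=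
    fun x => (hgd _).hasDerivAt.comp x (Real.hasDerivAt_sin x)
  refine ⟨fun x => g (Real.sin x), hgs.comp Real.contDiff_sin, |B₁| + |B₂| + 1, by positivity,
    fun x => ?_, fun x => ?_, fun x hx => ?_⟩
  · have := hB₁ (Real.sin x)
    rw [Real.norm_eq_abs] at this
    linarith [le_abs_self B₁, abs_nonneg B₂]
  · rw [(hd x).deriv, abs_mul]
    have h1 := hB₂ (Real.sin x)
    rw [Real.norm_eq_abs] at h1
    have h2 := Real.abs_cos_le_one x
    have h3 : |deriv g (Real.sin x)| * |Real.cos x| ≤ |deriv g (Real.sin x)| * 1 := by gcongr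
    linarith [le_abs_self B₂, abs_nonneg B₁]
  · rw [(hd x).deriv]
    have hs : |Real.sin x| < 0.88 := by
      apply abs_lt_of_sq_lt_sq _ (by norm_num)
      nlinarith [Real.sin_sq_add_cos_sq x]
    have hge : g =ᶠ[nhds (Real.sin x)] Real.arcsin := by
      have : Real.sin x ∈ ball (0:ℝ) 0.88 := by simpa using hs
      filter_upwards [isOpen_ball.mem_nhds this] with z hz
      have : χ z = 1 := χ.one_of_mem_closedBall (ball_subset_closedBall hz)
      simp [g, this]
    rw [hge.deriv_eq, Real.deriv_arcsin]
    have : Real.sqrt (1 - Real.sin x ^ 2) = Real.cos x := by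
      rw [← Real.cos_sq', Real.sqrt_sq (by linarith)]
    simp only [this]
    field_simp

section Degree
variable {n : ℕ} {U U' : Set (En n)} {φ ψ : En n → En n} {A : En n → Matrix (Fin n) (Fin n) ℝ}
  {Φ : ℕ → En n → En n}

lemma continuous_mul_of_tsupport (hU' : IsOpen U') {g F : En n → ℝ} (hg : ContinuousOn g U')
    (hF : Continuous F) (hFU : tsupport F ⊆ U') : Continuous fun y => F y * g y := by
  refine continuous_of_tsupport fun y hy => ?_
  have := hFU (tsupport_mul_subset_left (f := F) (g := g) hy)
  exact hF.continuousAt.mul (hg.continuousAt (hU'.mem_nhds this))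

lemma Approx.degN_sawtooth (hA : Approx U φ A Φ) (hn : 0 < n) (hU : IsOpen U)
    (hφ : IsHomeoOn U U' φ ψ) {c : ℝ} (hc : ∀ y ∈ U', LocDeg U U' φ Φ y c) {f : En n → ℝ}
    (hf : IsTest U f) {R M : ℝ} (hM : 0 ≤ M) {δ : ℝ} (hδ : 0 < δ) :
    ∃ m₀ > 0, ∀ m ≥ m₀, ∀ τ : ℝ, ∀ F : En n → ℝ, Continuous F → (∀ y, |F y| ≤ M) →
      tsupport F ⊆ U' → (∀ y, R < ‖y‖ → F y = 0) →
      (∀ y ∈ tsupport F, 1 / 2 < Real.cos (m * f (ψ y) + τ)) →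
      |degN Φ f F - c * ∫ y, f (ψ y) * F y| ≤ δ := by
  obtain ⟨P, hP, B, hB, hPB, hPB', hP1⟩ := exists_sawtooth
  obtain ⟨L, hL, hfL⟩ := pd_bound_of_isTest hf
  obtain ⟨σ, hσ, hs⟩ := hA.small hφ.1 hn hf.2.2 hf.2.1 (R := R) hM (mul_nonneg hB.le hL)
    (half_pos hδ)
  set V := volume.real (closedBall (0 : En n) R)
  have hV : 0 ≤ V := measureReal_nonneg
  set X := |c| * (M * V) + 1
  have hX : 0 < X := by positivity
  refine ⟨2 * B / min σ (δ / 2 / X), by positivity, fun m hm τ F hF hFM hFU hFR hcos => ?_⟩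
  have hmin : 0 < min σ (δ / 2 / X) := by positivity
  have hm0 : 0 < m := lt_of_lt_of_le (by positivity) hm
  have hmB : 2 * B / m ≤ min σ (δ / 2 / X) := by
    rw [ge_iff_le, div_le_iff₀ hmin] at hm
    rw [div_le_iff₀ hm0]; linarith
  have hFc : HasCompactSupport F := HasCompactSupport.intro (isCompact_closedBall (0 : En n) R)
    fun y hy => hFR y (by simpa using hy)
  set Q : ℝ → ℝ := fun t => (P (m * t + τ) - P τ) / m
  have hQ : ContDiff ℝ (⊤ : ℕ∞) Q :=
    ((hP.comp ((contDiff_const.mul contDiff_id).add contDiff_const)).sub contDiff_const).div_const _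
  have hQd : ∀ t, HasDerivAt Q (deriv P (m * t + τ)) t := by
    intro t
    have h1 : HasDerivAt (fun t => m * t + τ) m t := by
      simpa using ((hasDerivAt_id t).const_mul m).add_const τ
    have h2 := (((hP.differentiable (by simp) (m * t + τ)).hasDerivAt.comp t h1).sub_const
      (P τ)).div_const m
    simpa [hm0.ne'] using h2
  have hQ0 : Q 0 = 0 := by simp [Q]
  have hQB : ∀ t, |Q t| ≤ 2 * B / m := by
    intro t
    simp only [Q]
    rw [abs_div, abs_of_pos hm0]
    gcongr
    have h1 := hPB (m * t + τ)
    have h2 := hPB τ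
    rw [abs_le] at *
    constructor <;> linarith [h1.1, h1.2, h2.1, h2.2]
  set u : En n → ℝ := fun x => Q (f x)
  have hus : tsupport u ⊆ tsupport f := by
    refine closure_mono fun x hx hfx => hx ?_
    simp only [u]; rw [hfx, hQ0]
  have hu : IsTest U u := ⟨hQ.comp hf.1, hf.2.1.mono' ((subset_tsupport _).trans hus),
    hus.trans hf.2.2⟩
  have hpdu : ∀ j x, |pd j u x| ≤ B * L := by
    intro j x
    have : HasFDerivAt u (deriv P (m * f x + τ) • fderiv ℝ f x) x :=
      (hQd (f x)).comp_hasFDerivAt x (hf.differentiable x).hasFDerivAt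
    simp only [pd, this.fderiv, _root_.smul_apply, smul_eq_mul, abs_mul]
    exact mul_le_mul (hPB' _) (hfL j x) (abs_nonneg _) hB.le
  have e1 := hs u F hu hus hpdu (fun x => (hQB _).trans (hmB.trans (min_le_left _ _))) hF hFM hFR
  have e2 := hA.sub_left hφ.1 hn hf hu hF hFc 1
  have hψf : ContinuousOn (fun y => f (ψ y)) U' := hf.continuous.comp_continuousOn hφ.2.1
  have e3 := hA.degN_of_locallyConst hn hU hφ hc (hf.sub (hu.const_mul 1)) hF hFc hFU ?_
  · have hi1 : IntegrableOn (fun y => f (ψ y) * F y) (tsupport F) :=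
      ((hψf.mono hFU).mul hF.continuousOn).integrableOn_compact hFc
    have hi2 : IntegrableOn (fun y => u (ψ y) * F y) (tsupport F) :=
      (((hu.continuous.comp_continuousOn hφ.2.1).mono hFU).mul
        hF.continuousOn).integrableOn_compact hFc
    have hF0 : ∀ y ∉ tsupport F, F y = 0 := fun y hy => image_eq_zero_of_notMem_tsupport hy
    have hfull : ∀ g : En n → ℝ, ∫ y in tsupport F, g y * F y = ∫ y, g y * F y := fun g =>
      setIntegral_eq_integral_of_forall_compl_eq_zero fun y hy => by rw [hF0 y hy, mul_zero]
    have e4 : ∫ y, (f (ψ y) - 1 * u (ψ y)) * F y =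
        (∫ y, f (ψ y) * F y) - ∫ y, u (ψ y) * F y := by
      rw [← hfull, ← hfull, ← hfull, ← integral_sub hi1 hi2]
      congr 1; ext y; ring
    have e5 : |∫ y, u (ψ y) * F y| ≤ 2 * B / m * (M * V) := by
      have : ∫ y, u (ψ y) * F y = ∫ y in closedBall (0 : En n) R, u (ψ y) * F y := by
        rw [setIntegral_eq_integral_of_forall_compl_eq_zero]
        intro y hy
        rw [hFR y (by simpa using hy), mul_zero]
      rw [this]
      have := norm_setIntegral_le_of_norm_le_const (μ := (volume : Measure (En n)))
        (s := closedBall (0 : En n) R) (C := 2 * B / m * M)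
        (f := fun y => u (ψ y) * F y) measure_closedBall_lt_top fun y _ => by
          rw [norm_mul]
          exact mul_le_mul (hQB _) (hFM y) (norm_nonneg _) (by positivity)
      rw [Real.norm_eq_abs] at this
      rwa [mul_assoc] at this
    have e6 : |c * ∫ y, u (ψ y) * F y| ≤ δ / 2 := by
      rw [abs_mul]
      have h1 : 2 * B / m ≤ δ / 2 / X := hmB.trans (min_le_right _ _)
      rw [le_div_iff₀ hX] at h1
      have h0 : 0 ≤ 2 * B / m := by positivity
      calc |c| * |∫ y, u (ψ y) * F y| ≤ |c| * (2 * B / m * (M * V)) := by gcongr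
        _ ≤ 2 * B / m * X := by simp only [X]; nlinarith
        _ ≤ δ / 2 := h1
    rw [e4] at e3
    have e7 : degN Φ f F - c * ∫ y, f (ψ y) * F y = degN Φ u F - c * ∫ y, u (ψ y) * F y := by
      linarith
    rw [e7]
    refine (abs_sub _ _).trans ?_
    linarith
  · intro y hy
    have hop : IsOpen {t : ℝ | 1 / 2 < Real.cos (m * t + τ)} :=
      isOpen_lt continuous_const (by fun_prop)
    obtain ⟨η, hη, hη'⟩ := Metric.isOpen_iff.1 hop (f (ψ y)) (hcos y hy)
    have hcst : ∀ t ∈ ball (f (ψ y)) η, t - Q t = f (ψ y) - Q (f (ψ y)) := by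
      intro t ht
      refine isOpen_ball.is_const_of_deriv_eq_zero (f := fun t => t - Q t)
        (convex_ball _ _).isPreconnected (fun s _ => ?_) (fun s hs => ?_) ht (mem_ball_self hη)
      · exact ((hasDerivAt_id s).sub (hQd s)).differentiableAt.differentiableWithinAt
      · have hds : HasDerivAt (fun t => t - Q t) (1 - deriv P (m * s + τ)) s :=
          (hasDerivAt_id s).sub (hQd s)
        rw [hds.deriv, hP1 _ (hη' hs)]
        simp
    have hca := hψf.continuousWithinAt (hFU hy)
    obtain ⟨ε, hε, hε'⟩ := Metric.continuousWithinAt_iff.1 hca η hη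
    refine ⟨ε, hε, fun z hz hzU => ?_⟩
    simpa [u] using hcst _ (hε' hzU hz)

/-- The degree formula: the pairing is integration against `f ∘ ψ`. -/
lemma Approx.degN_eq_integral (hA : Approx U φ A Φ) (hn : 0 < n) (hU : IsOpen U) (hU' : IsOpen U')
    (hφ : IsHomeoOn U U' φ ψ) {c : ℝ} (hc : ∀ y ∈ U', LocDeg U U' φ Φ y c) {f F : En n → ℝ}
    (hf : IsTest U f) (hF : Continuous F) (hFc : HasCompactSupport F) (hFU : tsupport F ⊆ U') :
    degN Φ f F = c * ∫ y, f (ψ y) * F y := by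
  obtain ⟨M, hM⟩ := hFc.exists_bound_of_continuous hF
  obtain ⟨R, hR⟩ := hFc.isBounded.subset_closedBall (0 : En n)
  have hFR : ∀ y, R < ‖y‖ → F y = 0 := by
    intro y hy
    apply image_eq_zero_of_notMem_tsupport
    intro h
    have := hR h
    simp at this
    linarith
  have hM0 : 0 ≤ M := (norm_nonneg _).trans (hM 0)
  refine eq_of_abs_sub_le_all fun δ hδ => ?_
  obtain ⟨m, -, hm⟩ := hA.degN_sawtooth hn hU hφ hc hf (R := R) hM0 (by positivity : 0 < δ / 4)
  have hψf : ContinuousOn (fun y => f (ψ y)) U' := hf.continuous.comp_continuousOn hφ.2.1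
  let τ : Fin 4 → ℝ := fun i => (i : ℝ) * (Real.pi / 2)
  let θ : Fin 4 → ℝ → ℝ := fun i t => max (Real.cos (t + τ i) - 0.6) 0
  have hθc : ∀ i, Continuous (θ i) := fun i => by simp only [θ]; fun_prop
  have hθ0 : ∀ i t, 0 ≤ θ i t := fun i t => le_max_right _ _
  have hpos : ∀ t, 0 < ∑ i, θ i t := by
    intro t
    by_contra hcon
    have hz : ∑ i, θ i t = 0 := le_antisymm (not_lt.1 hcon) (Finset.sum_nonneg fun i _ => hθ0 i t)
    rw [Finset.sum_eq_zero_iff_of_nonneg fun i _ => hθ0 i t] at hz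
    have h : ∀ i, Real.cos (t + τ i) ≤ 0.6 := by
      intro i
      have := hz i (Finset.mem_univ i)
      have h2 : Real.cos (t + τ i) - 0.6 ≤ θ i t := le_max_left _ _
      linarith
    have a0 := h 0
    have a1 := h 1
    have a2 := h 2
    have a3 := h 3
    have b0 : τ 0 = 0 := by simp [τ]
    have b1 : τ 1 = Real.pi / 2 := by simp [τ]
    have b2 : τ 2 = Real.pi := by simp [τ]; ring
    have b3 : τ 3 = Real.pi / 2 + Real.pi := by simp [τ]; ring
    rw [b0, add_zero] at a0
    rw [b1, Real.cos_add_pi_div_two] at a1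
    rw [b2, Real.cos_add_pi] at a2
    rw [b3, ← add_assoc, Real.cos_add_pi, Real.cos_add_pi_div_two] at a3
    have := Real.sin_sq_add_cos_sq t
    norm_num at a0 a1 a2 a3
    nlinarith
  have hgc : ∀ i, Continuous fun t => θ i t / ∑ j, θ j t := fun i =>
    (hθc i).div (continuous_finsetSum _ fun j _ => hθc j) fun t => (hpos t).ne'
  let G : Fin 4 → En n → ℝ := fun i y => F y * (θ i (m * f (ψ y)) / ∑ j, θ j (m * f (ψ y)))
  have hG : ∀ i, Continuous (G i) := fun i => continuous_mul_of_tsupport hU'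
    ((hgc i).comp_continuousOn (continuousOn_const.mul hψf)) hF hFU
  have hGs : ∀ i, tsupport (G i) ⊆ tsupport F := fun i => tsupport_mul_subset_left
  have hGc : ∀ i, HasCompactSupport (G i) := fun i => hFc.mul_right
  have hGM : ∀ i y, |G i y| ≤ M := by
    intro i y
    simp only [G]
    rw [abs_mul]
    have h1 : |θ i (m * f (ψ y)) / ∑ j, θ j (m * f (ψ y))| ≤ 1 := by
      rw [abs_div, abs_of_nonneg (hθ0 _ _), abs_of_pos (hpos _), div_le_one (hpos _)]
      exact Finset.single_le_sum (f := fun j => θ j (m * f (ψ y))) (fun j _ => hθ0 j _)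
        (Finset.mem_univ i)
    calc |F y| * _ ≤ M * 1 := mul_le_mul (hM y) h1 (abs_nonneg _) hM0
      _ = M := mul_one M
  have hGcos : ∀ i, ∀ y ∈ tsupport (G i), 1 / 2 < Real.cos (m * f (ψ y) + τ i) := by
    intro i y hy
    have hyU := hFU (hGs i hy)
    by_contra hcon
    have hcw : ContinuousAt (fun y => Real.cos (m * f (ψ y) + τ i)) y := by
      have := hψf.continuousAt (hU'.mem_nhds hyU)
      exact Real.continuous_cos.continuousAt.comp
        ((continuousAt_const.mul this).add continuousAt_const)
    have : ∀ᶠ z in nhds y, Real.cos (m * f (ψ z) + τ i) < 0.6 :=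
      hcw.eventually (gt_mem_nhds (by norm_num at hcon ⊢; linarith))
    refine notMem_tsupport_iff_eventuallyEq.2 ?_ hy
    filter_upwards [this] with z hz
    have : θ i (m * f (ψ z)) = 0 := max_eq_right (by linarith)
    simp [G, this]
  have hsum : F = fun y => ∑ i, G i y := by
    ext y
    simp only [G]
    rw [← Finset.mul_sum, ← Finset.sum_div, div_self (hpos _).ne', mul_one]
  have hd : degN Φ f F = ∑ i, degN Φ f (G i) := by
    conv_lhs => rw [hsum]
    exact hA.sum_right hφ.1 hn hf hG hGc
  have hi : ∀ i, Integrable fun y => f (ψ y) * G i y := by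
    intro i
    have : IntegrableOn (fun y => f (ψ y) * G i y) (tsupport F) :=
      ((hψf.mono hFU).mul (hG i).continuousOn).integrableOn_compact hFc
    refine (integrableOn_iff_integrable_of_support_subset ?_).1 this
    intro y hy
    by_contra h
    apply hy
    have : F y = 0 := image_eq_zero_of_notMem_tsupport h
    simp [G, this]
  have hr : ∫ y, f (ψ y) * F y = ∑ i, ∫ y, f (ψ y) * G i y := by
    rw [← integral_finsetSum _ fun i _ => hi i]
    congr 1
    ext y
    rw [← Finset.mul_sum, congrFun hsum y]
  rw [hd, hr, Finset.mul_sum, ← Finset.sum_sub_distrib]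
  refine (Finset.abs_sum_le_sum_abs _ _).trans ?_
  calc ∑ i, |degN Φ f (G i) - c * ∫ y, f (ψ y) * G i y| ≤ ∑ i : Fin 4, δ / 4 :=
        Finset.sum_le_sum fun i _ => hm m le_rfl (τ i) (G i) (hG i) (hGM i)
          ((hGs i).trans hFU) (fun y hy => by simp [G, hFR y hy]) (hGcos i)
    _ = δ := by simp; ring

lemma cofD_single (f : En n → ℝ) (B : En n → Matrix (Fin n) (Fin n) ℝ) (i : Fin n) (x : En n) :
    cofD f B (EuclideanSpace.single i 1) x = ∑ j, pd j f x * (B x).adjugate j i := by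
  simp [cofD]

lemma Approx.degN_pd (hA : Approx U φ A Φ) (hφ : ContinuousOn φ U) {f η : En n → ℝ}
    (hf : IsTest U f) (hη : ContDiff ℝ (⊤ : ℕ∞) η) (hηc : HasCompactSupport η) (i : Fin n) :
    degN Φ f (pd i η) =
      -∫ x in tsupport f, η (φ x) * ∑ j, pd j f x * (A x).adjugate j i := by
  apply degN_eq
  set h : En n := EuclideanSpace.single i 1
  have hK : IsCompact (tsupport f) := hf.2.1
  obtain ⟨L, hL, hfL⟩ := pd_bound_of_isTest hf
  obtain ⟨M, hM⟩ := hηc.exists_bound_of_continuous hη.continuous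
  have hM0 : 0 ≤ M := (norm_nonneg _).trans (hM 0)
  have hh : ∀ k, |h k| ≤ 1 := fun k => (abs_coord_le h k).trans (by simp [h])
  have e : ∀ k, degB (Φ k) f (pd i η) = -∫ x in tsupport f, η (Φ k x) * cofD f (Jm (Φ k)) h x := by
    intro k
    rw [degB_eq]
    have e1 := integral_pd_comp_mul_det (hA.smooth k) hf hη i
    have e2 : ∀ x, pd i η (Φ k x) * (f x * (Jm (Φ k) x).det) =
        f x * pd i η (Φ k x) * (Jm (Φ k) x).det := fun x => by ring
    simp_rw [e2]
    rw [e1, setIntegral_eq_integral_of_forall_compl_eq_zero]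
    · simp_rw [h, cofD_single]
    · intro x hx; rw [cofD_eq_zero hx, mul_zero]
  simp_rw [e, ← cofD_single]
  refine Tendsto.neg ?_
  set S := ∫ x in tsupport f, adjS (A x)
  have hS : 0 ≤ S := integral_nonneg fun _ => adjS_nonneg _
  have hint1 : ∀ k, IntegrableOn (fun x => η (Φ k x) * cofD f (Jm (Φ k)) h x) (tsupport f) :=
    fun k => integrableOn_of_continuous ((hη.continuous.comp (hA.smooth k).continuous).mul
      (cofD_continuous (hA.smooth k) hf.1 h)) hK
  have hint0 : IntegrableOn (fun x => cofD f A h x) (tsupport f) :=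
    integrable_finsetSum _ fun i _ => (integrable_finsetSum _ fun j _ =>
      (hA.adj_int _ hf.2.2 hK j i).continuousOn_mul (hf.pd j).continuous.continuousOn hK).const_mul _
  have hint2 : IntegrableOn (fun x => η (φ x) * cofD f A h x) (tsupport f) :=
    hint0.continuousOn_mul (hη.continuous.comp_continuousOn (hφ.mono hf.2.2)) hK
  rw [Metric.tendsto_atTop]
  intro δ hδ
  set X := L * S + (M + 1) * L + 1
  have hX : 0 < X := by positivity
  obtain ⟨ε, hε, hεX⟩ : ∃ ε > 0, ε * X < δ := ⟨δ / 2 / X, by positivity, by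
    rw [div_mul_cancel₀ _ hX.ne']; linarith⟩
  obtain ⟨ω, hω, hω'⟩ := Metric.uniformContinuous_iff.1
    (hηc.uniformContinuous_of_continuous hη.continuous) ε hε
  refine eventually_atTop.1 ?_
  filter_upwards [Metric.tendstoUniformlyOn_iff.1 (hA.unif _ hf.2.2 hK) ω hω,
    (hA.adjD_lim hf.2.2 hK).eventually (gt_mem_nhds hε)] with k hk1 hk2
  rw [Real.dist_eq, ← integral_sub (hint1 k) hint2]
  have hb : |∫ x in tsupport f, (η (Φ k x) * cofD f (Jm (Φ k)) h x - η (φ x) * cofD f A h x)| ≤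
      ∫ x in tsupport f, (ε * L * adjS (A x) + M * L * adjD (Jm (Φ k) x) (A x)) := by
    refine abs_integral_le_integral_abs.trans (setIntegral_mono_on ((hint1 k).sub hint2).abs
      (((hA.adjS_int hf.2.2 hK).const_mul _).add ((hA.adjD_int hf.2.2 hK k).const_mul _))
      hK.measurableSet fun x hx => ?_)
    have e1 := abs_cofD_le (hfL · x) hh zero_le_one A
    have e2 := abs_cofD_sub_le (hfL · x) hh zero_le_one (Jm (Φ k)) A
    have e3 := (hω' (hk1 x hx)).le
    rw [Real.dist_eq, abs_sub_comm] at e3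
    have e4 : η (Φ k x) * cofD f (Jm (Φ k)) h x - η (φ x) * cofD f A h x =
      (η (Φ k x) - η (φ x)) * cofD f A h x +
        η (Φ k x) * (cofD f (Jm (Φ k)) h x - cofD f A h x) := by ring
    rw [e4]
    refine (abs_add_le _ _).trans ?_
    rw [abs_mul, abs_mul]
    have g1 := mul_le_mul e3 e1 (abs_nonneg _) hε.le
    have g2 := mul_le_mul (hM (Φ k x)) e2 (abs_nonneg _) hM0
    rw [Real.norm_eq_abs] at g2
    linarith
  refine hb.trans_lt ?_
  rw [integral_add ((hA.adjS_int hf.2.2 hK).const_mul _) ((hA.adjD_int hf.2.2 hK k).const_mul _),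
    integral_const_mul, integral_const_mul]
  refine lt_of_le_of_lt ?_ hεX
  change ε * L * S + M * L * _ ≤ ε * (L * S + (M + 1) * L + 1)
  have : M * L * ∫ x in tsupport f, adjD (Jm (Φ k) x) (A x) ≤ M * L * ε := by gcongr
  nlinarith

end Degree

section NonzeroDegree
variable {n : ℕ} {U U' : Set (En n)} {φ ψ : En n → En n} {A : En n → Matrix (Fin n) (Fin n) ℝ}
  {Φ : ℕ → En n → En n}

lemma Jm_id (x : En n) : Jm (fun y => y) x = 1 := by
  ext i j
  simp [Jm, pd_coord, Matrix.one_apply]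

lemma Jm_congr {Φ Ψ : En n → En n} {x : En n} (h : Φ =ᶠ[nhds x] Ψ) : Jm Φ x = Jm Ψ x := by
  ext i j
  exact pd_congr (h.mono fun y hy => by simp only [hy])

lemma Jm_comp {Φ Ψ : En n → En n} (hΦ : ContDiff ℝ (⊤ : ℕ∞) Φ) (hΨ : ContDiff ℝ (⊤ : ℕ∞) Ψ)
    (x : En n) : Jm (fun y => Ψ (Φ y)) x = Jm Ψ (Φ x) * Jm Φ x := by
  ext i j
  rw [Matrix.mul_apply]
  exact pd_comp (F := fun y => Ψ y i) (hΦ.differentiable (by simp))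
    ((contDiff_comp_coord hΨ i).differentiable (by simp)) j x

lemma integral_pd_comp_mul_det_eq {Θ : En n → En n} (hΘ : ContDiff ℝ (⊤ : ℕ∞) Θ) {f η : En n → ℝ}
    (hf : IsTest U f) (hη : ContDiff ℝ (⊤ : ℕ∞) η) (i : Fin n)
    (h : ∀ x, (∃ j, pd j f x ≠ 0) → Θ =ᶠ[nhds x] fun y => y) :
    ∫ x, f x * pd i η (Θ x) * (Jm Θ x).det = ∫ x, f x * pd i η x := by
  have h1 := integral_pd_comp_mul_det hΘ hf hη i
  have h2 := integral_pd_comp_mul_det (Φ := fun y => y) contDiff_id hf hη i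
  simp only [Jm_id, Matrix.det_one, mul_one] at h2
  rw [h1, h2]
  congr 2
  ext x
  by_cases hx : ∃ j, pd j f x ≠ 0
  · rw [Jm_congr (h x hx), Jm_id, (h x hx).eq_of_nhds]
  · push Not at hx
    simp [hx]

lemma pd_eq_deriv {u : En n → ℝ} {x : En n} (h : DifferentiableAt ℝ u x) (i : Fin n) :
    pd i u x = deriv (fun t : ℝ => u (x + t • EuclideanSpace.single i 1)) 0 :=
  (h.lineDeriv_eq_fderiv (v := EuclideanSpace.single i 1)).symm

lemma exists_pd_bump (x₀ : En n) {r : ℝ} (hr : 0 < r) (i : Fin n) : ∃ η : En n → ℝ,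
    ContDiff ℝ (⊤ : ℕ∞) η ∧ tsupport (pd i η) ⊆ closedBall x₀ r ∧ 0 < ∫ x, pd i η x := by
  set e : En n := EuclideanSpace.single i 1 with he
  set T := Real.smoothTransition
  have hT : ContDiff ℝ (⊤ : ℕ∞) T := Real.smoothTransition.contDiff
  set σ := r / 2
  have hσ : 0 < σ := by positivity
  let b : ContDiffBump x₀ := ⟨σ / 2, σ, by positivity, by linarith⟩
  set P : En n → En n := fun x => x - (x i - x₀ i) • e
  have hci : ContDiff ℝ (⊤ : ℕ∞) fun x : En n => x i - x₀ i := (contDiff_coord i).sub contDiff_const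
  have hP : ContDiff ℝ (⊤ : ℕ∞) P := contDiff_id.sub (hci.smul contDiff_const)
  set u : En n → ℝ := fun x => T (σ⁻¹ * (x i - x₀ i))
  set v : En n → ℝ := fun x => b (P x)
  have hu : ContDiff ℝ (⊤ : ℕ∞) u := hT.comp (contDiff_const.mul hci)
  have hv : ContDiff ℝ (⊤ : ℕ∞) v := b.contDiff.comp hP
  have hei : e i = 1 := by simp [he]
  have hPt : ∀ x (t : ℝ), P (x + t • e) = P x := by
    intro x t
    have : (x + t • e) i = x i + t := by simp [hei]
    simp only [P, this]
    module
  have hpu : ∀ x, pd i u x = σ⁻¹ * deriv T (σ⁻¹ * (x i - x₀ i)) := by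
    intro x
    rw [pd_eq_deriv (hu.differentiable (by simp) x)]
    have : (fun t : ℝ => u (x + t • e)) = fun t => T (σ⁻¹ * t + σ⁻¹ * (x i - x₀ i)) := by
      ext t
      have : (x + t • e) i = x i + t := by simp [hei]
      simp only [u, this]
      congr 1
      ring
    rw [← he, this]
    have h1 : HasDerivAt T (deriv T (σ⁻¹ * (x i - x₀ i))) (σ⁻¹ * 0 + σ⁻¹ * (x i - x₀ i)) := by
      rw [mul_zero, zero_add]
      exact (hT.differentiable (by simp) _).hasDerivAt
    have h2 : HasDerivAt (fun t : ℝ => σ⁻¹ * t + σ⁻¹ * (x i - x₀ i)) (σ⁻¹ * 1) 0 :=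
      ((hasDerivAt_id (0 : ℝ)).const_mul σ⁻¹).add_const _
    have := (HasDerivAt.comp (0 : ℝ) h1 h2).deriv
    simp only [Function.comp_def] at this
    rw [this]
    ring
  have hpv : ∀ x, pd i v x = 0 := by
    intro x
    rw [pd_eq_deriv (hv.differentiable (by simp) x)]
    simp only [v, ← he, hPt]
    simp
  have hη : ContDiff ℝ (⊤ : ℕ∞) fun x => u x * v x := hu.mul hv
  have hpd : ∀ x, pd i (fun x => u x * v x) x = σ⁻¹ * deriv T (σ⁻¹ * (x i - x₀ i)) * v x := by
    intro x
    rw [pd_mul (hu.differentiable (by simp) x) (hv.differentiable (by simp) x), hpv, hpu]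
    ring
  have hT' : ∀ s, 0 ≤ deriv T s := fun s => Real.smoothTransition.monotone.deriv_nonneg
  have hT0 : ∀ s, 1 < |s| → deriv T s = 0 := by
    intro s hs
    rcases lt_abs.1 hs with h | h
    · have : T =ᶠ[nhds s] fun _ => 1 := by
        filter_upwards [lt_mem_nhds h] with z hz
        exact Real.smoothTransition.one_of_one_le hz.le
      simp [this.deriv_eq]
    · have : T =ᶠ[nhds s] fun _ => 0 := by
        filter_upwards [gt_mem_nhds (show s < 0 by linarith)] with z hz
        exact Real.smoothTransition.zero_of_nonpos hz.le
      simp [this.deriv_eq]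
  have hsupp : tsupport (pd i fun x => u x * v x) ⊆ closedBall x₀ r := by
    refine closure_minimal (fun x hx => ?_) isClosed_closedBall
    rw [Function.mem_support, hpd] at hx
    have h1 : |x i - x₀ i| ≤ σ := by
      by_contra! h
      apply hx
      rw [hT0, mul_zero, zero_mul]
      rw [abs_mul, abs_of_pos (inv_pos.2 hσ), ← div_eq_inv_mul, one_lt_div hσ]
      exact h
    have h2 : dist (P x) x₀ ≤ σ := by
      by_contra! h
      apply hx
      simp only [v]
      rw [b.zero_of_le_dist h.le, mul_zero]
    rw [mem_closedBall, dist_eq_norm] at *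
    have h3 : x - x₀ = (P x - x₀) + (x i - x₀ i) • e := by simp only [P]; abel
    have h4 : ‖(x i - x₀ i) • e‖ ≤ σ := by
      rw [norm_smul, he]; simpa using h1
    rw [h3]
    refine (norm_add_le _ _).trans ?_
    have : r = σ + σ := by simp only [σ]; ring
    linarith
  refine ⟨_, hη, hsupp, ?_⟩
  have hcs : HasCompactSupport (pd i fun x => u x * v x) :=
    (isCompact_closedBall x₀ r).of_isClosed_subset (isClosed_tsupport _) hsupp
  obtain ⟨s, hs, hs'⟩ := exists_deriv_eq_slope T (show (0 : ℝ) < 1 by norm_num)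
    hT.continuous.continuousOn (hT.differentiable (by simp)).differentiableOn
  have hs1 : deriv T s = 1 := by
    rw [hs', show T 1 = 1 from Real.smoothTransition.one_of_one_le le_rfl,
      show T 0 = 0 from Real.smoothTransition.zero_of_nonpos le_rfl]
    norm_num
  refine Continuous.integral_pos_of_hasCompactSupport_nonneg_nonzero
    (x := x₀ + (σ * s) • e) (pd_contDiff hη i).continuous hcs ?_ ?_
  · intro x
    rw [Pi.zero_apply, hpd]
    have := b.nonneg (x := P x)
    have := hT' (σ⁻¹ * (x i - x₀ i))
    positivity
  · rw [hpd]
    have h1 : (x₀ + (σ * s) • e) i = x₀ i + σ * s := by simp [hei]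
    have h2 : v (x₀ + (σ * s) • e) = 1 := by
      simp only [v, hPt]
      have : P x₀ = x₀ := by simp [P]
      rw [this]
      exact b.one_of_mem_closedBall (mem_closedBall_self b.rIn_pos.le)
    rw [h2, h1, show σ⁻¹ * (x₀ i + σ * s - x₀ i) = s by field_simp; ring, hs1]
    positivity

lemma exists_smooth_near (hU' : IsOpen U') (hψ : ContinuousOn ψ U') {K : Set (En n)}
    (hK : IsCompact K) (hKU : K ⊆ U') {δ : ℝ} (hδ : 0 < δ) :
    ∃ Ψ : En n → En n, ContDiff ℝ (⊤ : ℕ∞) Ψ ∧ ∀ y ∈ K, dist (Ψ y) (ψ y) ≤ δ := by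
  obtain ⟨χ, hχ, -, W, -, hKW, hχ1⟩ := exists_cutoff hK hU' hKU
  have hc : ∀ i : Fin n, Continuous fun y => χ y * ψ y i := fun i =>
    continuous_mul_of_tsupport hU' (by fun_prop) hχ.continuous hχ.2.2
  have hε : 0 < δ / (n + 1) := by positivity
  choose g hg hgd using fun i => (hc i).exists_contDiff_approx (⊤ : ℕ∞)
    (ε := fun _ => δ / (n + 1)) continuous_const (fun _ => hε)
  refine ⟨fun y => WithLp.toLp 2 fun i => g i y, contDiff_piLp 2 |>.2 hg, fun y hy => ?_⟩
  rw [dist_eq_norm]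
  refine (norm_le_sum _).trans ?_
  calc ∑ i, |((WithLp.toLp 2 fun i => g i y : En n) - ψ y) i|
      ≤ ∑ _i : Fin n, δ / (n + 1) := by
        refine Finset.sum_le_sum fun i _ => ?_
        have := (hgd i).1 y
        rw [Real.dist_eq, hχ1 y (hKW hy), one_mul] at this
        simpa using this.le
    _ ≤ δ := by
        simp only [Finset.sum_const, Finset.card_univ, Fintype.card_fin, nsmul_eq_mul]
        rw [mul_div_assoc', div_le_iff₀ (by positivity)]
        nlinarith

lemma Approx.degree_ne_zero (hA : Approx U φ A Φ) (hn : 0 < n) (hU : IsOpen U) (hU' : IsOpen U')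
    (hφ : IsHomeoOn U U' φ ψ) {c : ℝ} (hne : U.Nonempty)
    (h : ∀ f F : En n → ℝ, IsTest U f → Continuous F → HasCompactSupport F → tsupport F ⊆ U' →
      degN Φ f F = c * ∫ y, f (ψ y) * F y) : c ≠ 0 := by
  obtain ⟨x₀, hx₀⟩ := hne
  obtain ⟨r, hr, hrU⟩ := Metric.nhds_basis_closedBall.mem_iff.1 (hU.mem_nhds hx₀)
  set B := closedBall x₀ r
  have hB : IsCompact B := isCompact_closedBall _ _
  set i : Fin n := ⟨0, hn⟩
  obtain ⟨η, hη, hηs, hηp⟩ := exists_pd_bump x₀ (show 0 < r / 8 by positivity) i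
  have hφB : IsCompact (φ '' B) := hB.image_of_continuousOn (hφ.1.mono hrU)
  have hφBU : φ '' B ⊆ U' := (image_mono hrU).trans hφ.2.2.1.image_subset
  obtain ⟨K, hK, hBK, hKU⟩ := exists_compact_between hφB hU' hφBU
  obtain ⟨Ψ, hΨ, hΨd⟩ := exists_smooth_near hU' hφ.2.1 hK hKU (show 0 < r / 32 by positivity)
  obtain ⟨χ₁, hχ₁, -, W₁, -, hKW₁, hχ₁1⟩ := exists_cutoff hK hU' hKU
  obtain ⟨χ₂, hχ₂, hχ₂b, W₂, hW₂, hKW₂, hχ₂1⟩ := exists_cutoff (isCompact_closedBall x₀ (r / 4))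
    isOpen_ball (closedBall_subset_ball (show r / 4 < r / 2 by linarith))
  obtain ⟨f, hf, -, W, hW, hKW, hf1⟩ := exists_cutoff (isCompact_closedBall x₀ (r / 2))
    isOpen_ball (closedBall_subset_ball (show r / 2 < r by linarith))
  have hfU : IsTest U f := hf.mono (ball_subset_closedBall.trans hrU)
  have hpη : Continuous (pd i η) := (pd_contDiff hη i).continuous
  have hη0 : ∀ z, r / 8 < dist z x₀ → pd i η z = 0 := fun z hz =>
    image_eq_zero_of_notMem_tsupport fun hz' => (mem_closedBall.1 (hηs hz')).not_gt hz
  set F : En n → ℝ := fun y => χ₁ y * (pd i η (Ψ y) * (Jm Ψ y).det)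
  have hF : Continuous F := hχ₁.continuous.mul ((hpη.comp hΨ.continuous).mul
    (Jm_continuous (hΨ.of_le (by simp))).matrix_det)
  have hFs : tsupport F ⊆ tsupport χ₁ := closure_mono fun y hy => by
    contrapose! hy
    simp only [Function.mem_support, not_not] at hy
    simp [F, hy]
  have hFc : HasCompactSupport F := hχ₁.2.1.of_isClosed_subset (isClosed_tsupport _) hFs
  have hlim : degN Φ f F = ∫ x, pd i η x := by
    apply degN_eq
    refine tendsto_const_nhds.congr' ?_
    obtain ⟨d₁, hd₁, hd₁K⟩ := hφB.exists_thickening_subset_open isOpen_interior hBK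
    have huc := hK.uniformContinuousOn_of_continuous (hφ.2.1.mono hKU)
    obtain ⟨d₂, hd₂, hd₂K⟩ := Metric.uniformContinuousOn_iff.1 huc (r / 32) (by positivity)
    filter_upwards [Metric.tendstoUniformlyOn_iff.1 (hA.unif B hrU hB) (min d₁ d₂)
      (lt_min hd₁ hd₂)] with k hk
    have hkK : ∀ x ∈ B, Φ k x ∈ K := fun x hx => interior_subset (hd₁K
      (mem_thickening_iff.2 ⟨φ x, mem_image_of_mem _ hx, by
        rw [dist_comm]; exact (hk x hx).trans_le (min_le_left _ _)⟩))
    have hΘ : ContDiff ℝ (⊤ : ℕ∞) fun x => Ψ (Φ k x) := hΨ.comp (hA.smooth k)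
    have hnear : ∀ x ∈ B, dist (Ψ (Φ k x)) x ≤ r / 16 := by
      intro x hx
      have h1 := hΨd _ (hkK x hx)
      have h2 := hd₂K _ (interior_subset (hBK (mem_image_of_mem φ hx))) _ (hkK x hx)
        ((hk x hx).trans_le (min_le_right _ _))
      rw [hφ.2.2.2.2.1 x (hrU hx), dist_comm] at h2
      linarith [dist_triangle (Ψ (Φ k x)) (ψ (Φ k x)) x]
    set Θ : En n → En n := fun x => x + χ₂ x • (Ψ (Φ k x) - x)
    have hΘs : ContDiff ℝ (⊤ : ℕ∞) Θ := contDiff_id.add (hχ₂.1.smul (hΘ.sub contDiff_id))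
    have hid := integral_pd_comp_mul_det_eq hΘs hfU hη i (fun x ⟨j, hj⟩ => by
      have hxW : x ∉ W := fun hxW => hj (by
        rw [pd_congr (v := fun _ => 1)]
        · simp [pd]
        · filter_upwards [hW.mem_nhds hxW] with y hy using hf1 y hy)
      have hx2 : x ∉ tsupport χ₂ := fun hx => hxW (hKW (ball_subset_closedBall (hχ₂.2.2 hx)))
      filter_upwards [notMem_tsupport_iff_eventuallyEq.1 hx2] with y hy
      simp [Θ, hy])
    have hfη : ∀ x, f x * pd i η x = pd i η x := by
      intro x
      by_cases hx : r / 8 < dist x x₀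
      · simp [hη0 x hx]
      · rw [hf1 x (hKW (mem_closedBall.2 (by linarith))), one_mul]
    simp only [hfη] at hid
    rw [← hid, degB_eq]
    congr 1
    ext x
    by_cases hx : x ∈ tsupport f
    swap
    · simp [image_eq_zero_of_notMem_tsupport hx]
    have hxB : x ∈ B := ball_subset_closedBall (hf.2.2 hx)
    have hF1 : F (Φ k x) = pd i η (Ψ (Φ k x)) * (Jm Ψ (Φ k x)).det := by
      simp only [F]
      rw [hχ₁1 _ (hKW₁ (hkK x hxB)), one_mul]
    rw [hF1]
    by_cases hx4 : x ∈ closedBall x₀ (r / 4)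
    · have : Θ =ᶠ[nhds x] fun y => Ψ (Φ k y) := by
        filter_upwards [hW₂.mem_nhds (hKW₂ hx4)] with y hy
        simp [Θ, hχ₂1 y hy]
      rw [Jm_congr this, this.eq_of_nhds, Jm_comp (hA.smooth k) hΨ, Matrix.det_mul]
      ring
    · have hx5 : r / 4 < dist x x₀ := by simpa using hx4
      have h1 := hnear x hxB
      have h2 : dist (Θ x) x ≤ r / 16 := by
        rw [dist_eq_norm] at h1 ⊢
        simp only [Θ, add_sub_cancel_left, norm_smul, Real.norm_eq_abs, abs_of_nonneg (hχ₂b x).1]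
        nlinarith [(hχ₂b x).2, norm_nonneg (Ψ (Φ k x) - x)]
      rw [hη0 (Θ x), hη0 (Ψ (Φ k x))]
      · ring
      · linarith [dist_triangle x (Ψ (Φ k x)) x₀, dist_comm x (Ψ (Φ k x))]
      · linarith [dist_triangle x (Θ x) x₀, dist_comm x (Θ x)]
  rintro rfl
  rw [h f F hfU hF hFc (hFs.trans hχ₁.2.2), zero_mul] at hlim
  exact hηp.ne hlim

theorem Approx.exists_ne_zero_degree_formula (hA : Approx U φ A Φ) (hn : 0 < n) (hU : IsOpen U)
    (hU' : IsOpen U') (hφ : IsHomeoOn U U' φ ψ) (hc : IsPreconnected U') (hne : U.Nonempty) :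
    ∃ c : ℝ, c ≠ 0 ∧ ∀ f η : En n → ℝ, IsTest U f → IsTest U' η → ∀ i,
      ∫ x in tsupport f, η (φ x) * ∑ j, pd j f x * (A x).adjugate j i =
        -(c * ∫ y, f (ψ y) * pd i η y) := by
  obtain ⟨c, hc'⟩ := hA.exists_deg hn hU hU' hφ hc
  refine ⟨c, hA.degree_ne_zero hn hU hU' hφ hne fun f F hf hF hFc hFU =>
    hA.degN_eq_integral hn hU hU' hφ hc' hf hF hFc hFU, fun f η hf hη i => ?_⟩
  rw [← hA.degN_eq_integral hn hU hU' hφ hc' hf (hη.pd i).continuous (hη.pd i).2.1 (hη.pd i).2.2,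
    hA.degN_pd hφ.1 hf hη.1 hη.2.1 i, neg_neg]
end NonzeroDegree

/-- Mollification of `u` with the kernel `β`. -/
def moll {n : ℕ} (β u : En n → ℝ) (x : En n) : ℝ := ∫ t, u t * β (x - t)

section Mollify
variable {n : ℕ} {U : Set (En n)}

lemma moll_eq_convolution (β u : En n → ℝ) :
    moll β u = convolution u β (ContinuousLinearMap.mul ℝ ℝ) volume := rfl

lemma moll_swap (β u : En n → ℝ) (x : En n) : moll β u x = ∫ t, u (x - t) * β t := by
  rw [moll, ← integral_sub_left_eq_self _ _ x]
  simp

lemma moll_contDiff {β u : En n → ℝ} (hβ : ContDiff ℝ (⊤ : ℕ∞) β) (hc : HasCompactSupport β)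
    (hu : LocallyIntegrable u) : ContDiff ℝ (⊤ : ℕ∞) (moll β u) := by
  rw [moll_eq_convolution]
  exact hc.contDiff_convolution_right _ hu hβ

lemma pd_moll {β u : En n → ℝ} (hβ : ContDiff ℝ (⊤ : ℕ∞) β) (hc : HasCompactSupport β)
    (hu : LocallyIntegrable u) (i : Fin n) (x : En n) :
    pd i (moll β u) x = moll (pd i β) u x := by
  have h := hc.hasFDerivAt_convolution_right (ContinuousLinearMap.mul ℝ ℝ) hu
    (hβ.of_le (by simp)) x
  rw [pd, moll_eq_convolution, h.fderiv, convolution_precompR_apply _ hu (hc.fderiv ℝ)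
    (hβ.continuous_fderiv (by simp))]
  rfl

lemma pd_comp_sub {β : En n → ℝ} (hβ : Differentiable ℝ β) (x t : En n) (i : Fin n) :
    pd i (fun s => β (x - s)) t = -pd i β (x - t) := by
  have h := (hβ (x - t)).hasFDerivAt.comp t ((hasFDerivAt_id t).const_sub x)
  rw [pd, show fderiv ℝ (fun s => β (x - s)) t = _ from h.fderiv]
  simp [pd]

lemma moll_weakPd {β u g : En n → ℝ} (hβ : ContDiff ℝ (⊤ : ℕ∞) β) (hc : HasCompactSupport β)
    {i : Fin n} (h : IsWeakPd univ i u g) (x : En n) : moll (pd i β) u x = moll β g x := by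
  have hT : IsTest univ (fun s => β (x - s)) :=
    ⟨hβ.comp (contDiff_const.sub contDiff_id),
      hc.comp_homeomorph (Homeomorph.subLeft x), subset_univ _⟩
  have := h _ hT
  simp only [Measure.restrict_univ, pd_comp_sub (hβ.differentiable (by simp)), mul_neg,
    integral_neg, neg_inj] at this
  exact this

lemma tsupport_moll {β u : En n → ℝ} {δ : ℝ} (hβ : tsupport β ⊆ closedBall 0 δ) :
    tsupport (moll β u) ⊆ cthickening δ (tsupport u) := by
  refine closure_minimal (fun x hx => ?_) isClosed_cthickening
  by_contra hxc
  apply hx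
  rw [moll]
  refine integral_eq_zero_of_ae (ae_of_all _ fun t => ?_)
  by_cases ht : t ∈ tsupport u
  · change u t * β (x - t) = 0
    rw [image_eq_zero_of_notMem_tsupport (f := β), mul_zero]
    intro h
    apply hxc
    have := hβ h
    rw [mem_closedBall, dist_zero_right, ← dist_eq_norm] at this
    exact mem_cthickening_of_dist_le x t δ _ ht this
  · simp [image_eq_zero_of_notMem_tsupport ht]

lemma abs_moll_sub_le {β u : En n → ℝ} {δ ε : ℝ} (hβc : Continuous β)
    (hβ : tsupport β ⊆ closedBall 0 δ)
    (h0 : ∀ x, 0 ≤ β x) (h1 : ∫ x, β x = 1) (hu : Continuous u) {x : En n}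
    (h : ∀ y, dist y x ≤ δ → |u y - u x| ≤ ε) : |moll β u x - u x| ≤ ε := by
  have hc : HasCompactSupport β := (isCompact_closedBall _ _).of_isClosed_subset
    (isClosed_tsupport _) hβ
  have hi : Integrable fun t => u (x - t) * β t :=
    Continuous.integrable_of_hasCompactSupport (by fun_prop) hc.mul_left
  have hi' : Integrable fun t => u x * β t :=
    Continuous.integrable_of_hasCompactSupport (by fun_prop) hc.mul_left
  have : moll β u x - u x = ∫ t, (u (x - t) - u x) * β t := by
    rw [moll_swap]
    simp_rw [sub_mul]
    rw [integral_sub hi hi', integral_const_mul, h1, mul_one]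
  rw [this]
  have hb : ∀ t, |(u (x - t) - u x) * β t| ≤ ε * β t := by
    intro t
    rw [abs_mul, abs_of_nonneg (h0 t)]
    by_cases ht : t ∈ tsupport β
    · have h2 := hβ ht
      rw [mem_closedBall, dist_zero_right] at h2
      exact mul_le_mul_of_nonneg_right (h _ (by simpa [dist_eq_norm] using h2)) (h0 t)
    · simp [image_eq_zero_of_notMem_tsupport ht]
  calc |∫ t, (u (x - t) - u x) * β t| ≤ ∫ t, |(u (x - t) - u x) * β t| :=
        abs_integral_le_integral_abs
    _ ≤ ∫ t, ε * β t := integral_mono_of_nonneg (ae_of_all _ fun _ => abs_nonneg _)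
        ((hβc.integrable_of_hasCompactSupport hc).const_mul _) (ae_of_all _ hb)
    _ = ε := by rw [integral_const_mul, h1, mul_one]

lemma eLpNorm_moll_le {β g : En n → ℝ} (hβc : Continuous β) (hc : HasCompactSupport β)
    (h0 : ∀ x, 0 ≤ β x) (h1 : ∫ x, β x = 1) {r : ℝ≥0∞} (hr : 1 ≤ r) (hr' : r ≠ ⊤)
    (hg : AEStronglyMeasurable g) : eLpNorm (moll β g) r ≤ eLpNorm g r := by
  wlog hm : Measurable g generalizing g
  · have h2 := this hg.stronglyMeasurable_mk.aestronglyMeasurable hg.stronglyMeasurable_mk.measurable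
    have h3 : moll β g = moll β (hg.mk g) := by
      ext x
      exact integral_congr_ae (hg.ae_eq_mk.mono fun t ht => by simp only [ht])
    rwa [h3, eLpNorm_congr_ae hg.ae_eq_mk]
  have hr0 : r ≠ 0 := (zero_lt_one.trans_le hr).ne'
  set s := r.toReal
  have hs : 1 ≤ s := by
    simpa using ENNReal.toReal_mono hr' hr
  have hs0 : 0 < s := by linarith
  rw [eLpNorm_eq_lintegral_rpow_enorm_toReal hr0 hr', eLpNorm_eq_lintegral_rpow_enorm_toReal hr0 hr']
  refine ENNReal.rpow_le_rpow ?_ (by positivity)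
  set ν : Measure (En n) := volume.withDensity fun t => ‖β t‖ₑ with hν
  have hβm : Measurable fun t => ‖β t‖ₑ := hβc.measurable.enorm
  have hνp : IsProbabilityMeasure ν := ⟨by
    rw [hν, withDensity_apply _ MeasurableSet.univ, Measure.restrict_univ]
    have : ∀ t, ‖β t‖ₑ = ENNReal.ofReal (β t) := fun t => by
      rw [Real.enorm_eq_ofReal (h0 t)]
    simp_rw [this]
    rw [← ofReal_integral_eq_lintegral_ofReal (hβc.integrable_of_hasCompactSupport hc)
      (ae_of_all _ h0), h1, ENNReal.ofReal_one]⟩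
  have hpt : ∀ x, ‖moll β g x‖ₑ ^ s ≤ ∫⁻ t, ‖g (x - t)‖ₑ ^ s ∂ν := by
    intro x
    have hm' : Measurable fun t => ‖g (x - t)‖ₑ := (hm.comp (measurable_const.sub measurable_id)).enorm
    have h2 : ‖moll β g x‖ₑ ≤ ∫⁻ t, ‖g (x - t)‖ₑ ∂ν := by
      rw [moll_swap, hν, lintegral_withDensity_eq_lintegral_mul _ hβm hm']
      refine (enorm_integral_le_lintegral_enorm _).trans (lintegral_mono fun t => ?_)
      rw [enorm_mul, mul_comm]; rfl
    have h3 := eLpNorm'_le_eLpNorm'_of_exponent_le (f := fun t => ‖g (x - t)‖ₑ) zero_lt_one hs ν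
      hm'.aestronglyMeasurable
    simp only [eLpNorm', enorm_eq_self, ENNReal.rpow_one, div_one] at h3
    calc ‖moll β g x‖ₑ ^ s ≤ ((∫⁻ t, ‖g (x - t)‖ₑ ^ s ∂ν) ^ (1 / s)) ^ s :=
          ENNReal.rpow_le_rpow (h2.trans h3) hs0.le
      _ = _ := by rw [← ENNReal.rpow_mul, one_div_mul_cancel hs0.ne', ENNReal.rpow_one]
  calc ∫⁻ x, ‖moll β g x‖ₑ ^ s ≤ ∫⁻ x, ∫⁻ t, ‖g (x - t)‖ₑ ^ s ∂ν := lintegral_mono hpt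
    _ = ∫⁻ t, (∫⁻ x, ‖g (x - t)‖ₑ ^ s) ∂ν := by
      apply lintegral_lintegral_swap
      exact (((hm.comp (measurable_fst.sub measurable_snd)).enorm).pow_const s).aemeasurable
    _ = ∫⁻ x, ‖g x‖ₑ ^ s := by
      simp_rw [lintegral_sub_right_eq_self (fun x => ‖g x‖ₑ ^ s)]
      simp

lemma moll_sub {β g h : En n → ℝ} (hβ : Continuous β) (hc : HasCompactSupport β)
    (hg : LocallyIntegrable g) (hh : LocallyIntegrable h) :
    moll β (g - h) = moll β g - moll β h := by
  have : ∀ {g : En n → ℝ}, LocallyIntegrable g → ∀ x, Integrable fun t => g t * β (x - t) := by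
    intro g hg x
    exact (hc.convolutionExists_right (ContinuousLinearMap.mul ℝ ℝ) hg hβ x)
  ext x
  simp only [moll, Pi.sub_apply, sub_mul]
  exact integral_sub (this hg x) (this hh x)

lemma exists_moll_eLpNorm_le {g : En n → ℝ} {r : ℝ≥0∞} (hr : 1 ≤ r) (hr' : r ≠ ⊤)
    (hg : MemLp g r) {ε : ℝ≥0∞} (hε : ε ≠ 0) : ∃ δ > 0, ∀ β : En n → ℝ, Continuous β →
      tsupport β ⊆ closedBall 0 δ → (∀ x, 0 ≤ β x) → ∫ x, β x = 1 →
      eLpNorm (moll β g - g) r ≤ ε := by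
  obtain ⟨ε', hε', hε'e⟩ : ∃ ε' : ℝ≥0∞, ε' ≠ 0 ∧ ε' + ε' + ε' ≤ ε := by
    refine ⟨ε / 3, by simp [hε], ?_⟩
    rw [ENNReal.add_thirds]
  obtain ⟨h, hhc, hgh, hh, hhL⟩ := hg.exists_hasCompactSupport_eLpNorm_sub_le hr' hε'
  set K := cthickening 1 (tsupport h)
  have hK : IsCompact K := hhc.isCompact.cthickening
  obtain ⟨η, hη, hηe⟩ : ∃ η > 0, ENNReal.ofReal η * volume K ^ (1 / r.toReal) ≤ ε' := by
    have hlim : Tendsto (fun η => ENNReal.ofReal η * volume K ^ (1 / r.toReal)) (nhdsWithin 0 (Ioi 0))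
        (nhds 0) := by
      have h1 : Tendsto ENNReal.ofReal (nhdsWithin 0 (Ioi 0)) (nhds 0) := by
        have := ENNReal.continuous_ofReal.tendsto 0
        rw [ENNReal.ofReal_zero] at this
        exact this.mono_left nhdsWithin_le_nhds
      have := ENNReal.Tendsto.mul_const (b := volume K ^ (1 / r.toReal)) h1
        (Or.inr (ENNReal.rpow_ne_top_of_nonneg (by positivity) hK.measure_lt_top.ne))
      simpa using this
    obtain ⟨η, h1, h2⟩ := ((hlim.eventually (gt_mem_nhds (pos_iff_ne_zero.2 hε'))).and
      self_mem_nhdsWithin).exists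
    exact ⟨η, h2, h1.le⟩
  obtain ⟨δ, hδ, hδu⟩ := Metric.uniformContinuous_iff.1
    (hhc.uniformContinuous_of_continuous hh) η hη
  refine ⟨min (δ / 2) 1, by positivity, fun β hβ hβs h0 h1 => ?_⟩
  have hc : HasCompactSupport β := (isCompact_closedBall _ _).of_isClosed_subset
    (isClosed_tsupport _) hβs
  have hgl := hg.locallyIntegrable hr
  have hhl := hhL.locallyIntegrable hr
  have e1 : moll β g - g = (moll β (g - h)) + ((moll β h - h) + (h - g)) := by
    rw [moll_sub hβ hc hgl hhl]; abel
  have hmc : ∀ {u : En n → ℝ}, LocallyIntegrable u → Continuous (moll β u) := fun hu =>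
    hc.continuous_convolution_right (ContinuousLinearMap.mul ℝ ℝ) hu hβ
  rw [e1]
  refine (eLpNorm_add_le (hmc (hgl.sub hhl)).aestronglyMeasurable
    (((hmc hhl).sub hh).aestronglyMeasurable.add (hhL.1.sub hg.1)) hr).trans ?_
  refine le_trans ?_ hε'e
  rw [add_assoc]
  refine add_le_add ((eLpNorm_moll_le hβ hc h0 h1 hr hr' (hg.1.sub hhL.1)).trans hgh) ?_
  refine (eLpNorm_add_le ((hmc hhl).sub hh).aestronglyMeasurable (hhL.1.sub hg.1) hr).trans ?_
  refine add_le_add ?_ (by rw [eLpNorm_sub_comm]; exact hgh)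
  refine (eLpNorm_sub_le_of_dist_bdd volume hr' hK.measurableSet hη.le (fun x => ?_) ?_ ?_).trans hηe
  · rw [Real.dist_eq]
    refine abs_moll_sub_le hβ hβs h0 h1 hh fun y hy => ?_
    have := hδu (a := y) (b := x) (hy.trans_lt ((min_le_left _ _).trans_lt (by linarith)))
    rw [Real.dist_eq] at this
    exact this.le
  · exact (subset_tsupport _).trans ((tsupport_moll hβs).trans
      (cthickening_mono (min_le_right _ _) _))
  · exact (subset_tsupport _).trans (self_subset_cthickening _)

/-- Smooth approximation of a compactly supported continuous Sobolev function. -/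
theorem exists_smooth_approx (hU : IsOpen U) {u : En n → ℝ} (hu : Continuous u)
    (huc : HasCompactSupport u) (huU : tsupport u ⊆ U) {g : Fin n → En n → ℝ} {r : ℝ≥0∞}
    (hr : 1 ≤ r) (hr' : r ≠ ⊤) (hg : ∀ i, MemLp (g i) r) (hw : ∀ i, IsWeakPd univ i u (g i))
    {ε : ℝ} (hε : 0 < ε) :
    ∃ v, IsTest U v ∧ (∀ x, |v x - u x| ≤ ε) ∧
      ∀ i, eLpNorm (pd i v - g i) r ≤ ENNReal.ofReal ε := by
  choose δ hδ hδg using fun i => exists_moll_eLpNorm_le hr hr' (hg i)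
    (ENNReal.ofReal_pos.2 hε).ne'
  obtain ⟨d₁, hd₁, hd₁u⟩ := Metric.uniformContinuous_iff.1
    (huc.uniformContinuous_of_continuous hu) ε hε
  obtain ⟨d₂, hd₂, hd₂U⟩ := huc.isCompact.exists_cthickening_subset_open hU huU
  obtain ⟨d, hd, hdd⟩ : ∃ d > 0, d ≤ d₁ / 2 ∧ d ≤ d₂ ∧ ∀ i, d ≤ δ i := by
    have : ∀ᶠ d in nhdsWithin (0 : ℝ) (Ioi 0), d ≤ d₁ / 2 ∧ d ≤ d₂ ∧ ∀ i, d ≤ δ i := by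
      have h : ∀ {a : ℝ}, 0 < a → ∀ᶠ d in nhdsWithin (0 : ℝ) (Ioi 0), d ≤ a := fun ha =>
        nhdsWithin_le_nhds (Iic_mem_nhds ha)
      exact (h (by positivity)).and ((h hd₂).and (eventually_all.2 fun i => h (hδ i)))
    obtain ⟨d, h1, h2⟩ := (this.and self_mem_nhdsWithin).exists
    exact ⟨d, h2, h1⟩
  obtain ⟨β, hβ, hβc, hβs, h0, h1⟩ := exists_bump (0 : En n) hd
  have hul : LocallyIntegrable u := hu.locallyIntegrable
  have hts : tsupport (moll β u) ⊆ cthickening d₂ (tsupport u) :=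
    (tsupport_moll hβs).trans (cthickening_mono hdd.2.1 _)
  refine ⟨moll β u, ⟨moll_contDiff hβ hβc hul,
    huc.isCompact.cthickening.of_isClosed_subset (isClosed_tsupport _) hts, hts.trans hd₂U⟩,
    fun x => abs_moll_sub_le hβ.continuous hβs h0 h1 hu fun y hy => ?_, fun i => ?_⟩
  · have := hd₁u (a := y) (b := x) (hy.trans_lt (hdd.1.trans_lt (by linarith)))
    rw [Real.dist_eq] at this
    exact this.le
  · have : pd i (moll β u) = moll β (g i) := by
      ext x
      rw [pd_moll hβ hβc hul, moll_weakPd hβ hβc (hw i)]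
    rw [this]
    exact hδg i β hβ.continuous (hβs.trans (closedBall_subset_closedBall (hdd.2.2 i))) h0 h1
end Mollify

/-- `φ` is a continuous mapping on `U` with weak Jacobi matrix `G`, locally in `L^q`. -/
structure SobMap {n : ℕ} (U : Set (En n)) (φ : En n → En n)
    (G : En n → Matrix (Fin n) (Fin n) ℝ) (q : ℝ) : Prop where
  cont : ContinuousOn φ U
  meas : ∀ i j, Measurable fun x => G x i j
  weak : ∀ i j, IsWeakPd U j (fun x => φ x i) (fun x => G x i j)
  memLp : ∀ K ⊆ U, IsCompact K → ∀ i j,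
    MemLp (fun x => G x i j) (ENNReal.ofReal q) (volume.restrict K)

/-- Composition with `φ` is bounded on test functions. -/
def CompTest {n : ℕ} (U U' : Set (En n)) (φ : En n → En n) (p q : ℝ) (w : En n → ℝ)
    (C : ℝ≥0∞) : Prop :=
  ∀ f, IsTest U' f → ∃ g : Fin n → En n → ℝ, ∀ i, LocallyIntegrableOn (g i) U ∧
    IsWeakPd U i (fun x => f (φ x)) (g i) ∧
    ∫⁻ x in U, ‖g i x * w x‖ₑ ^ q ≤ C * (∫⁻ y, (∑ j, ‖pd j f y‖ₑ) ^ p) ^ (q / p)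

section Sobolev
variable {n : ℕ} {U U' : Set (En n)}

lemma isWeakPd_mul_test (hU : IsOpen U) {u g χ : En n → ℝ} (hu : ContinuousOn u U)
    (hg : LocallyIntegrableOn g U) {i : Fin n} (hw : IsWeakPd U i u g) (hχ : IsTest U χ) :
    IsWeakPd univ i (fun x => χ x * u x) (fun x => χ x * g x + pd i χ x * u x) := by
  intro v hv
  have hul : LocallyIntegrableOn u U := hu.locallyIntegrableOn hU.measurableSet
  have h1 : IsTest U fun x => χ x * v x := hχ.mul_right hv.1
  have h2 : IsTest U fun x => χ x * pd i v x := hχ.mul_right (pd_contDiff hv.1 i)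
  have h3 : IsTest U fun x => pd i χ x * v x := (hχ.pd i).mul_right hv.1
  have i2 := integrable_mul_of_locallyIntegrableOn hul h2.continuous h2.2.1 h2.2.2
  have i3 := integrable_mul_of_locallyIntegrableOn hul h3.continuous h3.2.1 h3.2.2
  have i1 := integrable_mul_of_locallyIntegrableOn hg h1.continuous h1.2.1 h1.2.2
  have h := hw _ h1
  rw [setIntegral_mul_test ((tsupport_pd i).trans h1.2.2), setIntegral_mul_test h1.2.2] at h
  have e : ∀ x, u x * pd i (fun x => χ x * v x) x = u x * (χ x * pd i v x) +
      u x * (pd i χ x * v x) := fun x => by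
    rw [pd_mul (hχ.differentiable x) (hv.differentiable x)]; ring
  simp_rw [e] at h
  rw [integral_add i2 i3] at h
  have e2 : ∀ x, (χ x * g x + pd i χ x * u x) * v x = g x * (χ x * v x) + u x * (pd i χ x * v x) :=
    fun x => by ring
  have e3 : ∀ x, χ x * u x * pd i v x = u x * (χ x * pd i v x) := fun x => by ring
  simp only [Measure.restrict_univ]
  simp_rw [e2, e3]
  rw [integral_add i1 i3]
  linarith

lemma exists_exhaustion (hU : IsOpen U) : ∃ (V : ℕ → Set (En n)) (χ : ℕ → En n → ℝ),
    (∀ k, IsOpen (V k)) ∧ Monotone V ∧ (⋃ k, V k) = U ∧ (∀ k, IsTest U (χ k)) ∧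
    (∀ k, ∀ x ∈ V k, χ k x = 1) := by
  have : LocallyCompactSpace U := hU.locallyCompactSpace
  let C := CompactExhaustion.choice U
  have hC : ∀ k, IsCompact ((↑) '' C k : Set (En n)) := fun k =>
    (C.isCompact k).image continuous_subtype_val
  have hCU : ∀ k, ((↑) '' C k : Set (En n)) ⊆ U := fun k => by
    rintro _ ⟨x, -, rfl⟩; exact x.2
  choose χ hχ _ W _ hW hχ1 using fun k => exists_cutoff (hC k) hU (hCU k)
  refine ⟨fun k => (↑) '' interior (C k), χ, fun k => hU.isOpenMap_subtype_val _ isOpen_interior,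
    fun k l h => image_mono (interior_mono (C.subset h)), ?_, hχ,
    fun k x hx => hχ1 k x (hW k (image_mono interior_subset hx))⟩
  have h2 : ⋃ k, interior (C k) = univ := eq_univ_of_forall fun x => by
    obtain ⟨k, hk⟩ := C.exists_mem x
    exact mem_iUnion_of_mem (k + 1) (C.subset_interior_succ k hk)
  rw [← image_iUnion, h2]
  simp

lemma subset_of_compact_iUnion {V : ℕ → Set (En n)} (hV : ∀ k, IsOpen (V k)) (hm : Monotone V)
    {K : Set (En n)} (hK : IsCompact K) (hKV : K ⊆ ⋃ k, V k) : ∃ k, K ⊆ V k :=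
  hK.elim_directed_cover V hV hKV hm.directed_le

lemma IsWeakPd.congr_ae (hU : IsOpen U) {i : Fin n} {f g g' : En n → ℝ} (h : IsWeakPd U i f g)
    (hg : ∀ᵐ x, x ∈ U → g x = g' x) : IsWeakPd U i f g' := by
  intro u hu
  rw [h u hu]
  congr 1
  refine setIntegral_congr_ae hU.measurableSet ?_
  filter_upwards [hg] with x hx hxU
  rw [hx hxU]

lemma IsWeakPd.congr_left (hU : IsOpen U) {i : Fin n} {f f' g : En n → ℝ} (h : IsWeakPd U i f g)
    (hf : ∀ x ∈ U, f x = f' x) : IsWeakPd U i f' g := by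
  intro u hu
  rw [← h u hu]
  exact setIntegral_congr_fun hU.measurableSet fun x hx => by simp only [hf x hx]

lemma locallyIntegrableOn_of_memLp (hU : IsOpen U) {g : En n → ℝ} {q : ℝ≥0∞} (hq : 1 ≤ q)
    (h : ∀ K ⊆ U, IsCompact K → MemLp g q (volume.restrict K)) : LocallyIntegrableOn g U := by
  rw [locallyIntegrableOn_iff hU.isLocallyClosed]
  intro K hK hKc
  have : IsFiniteMeasure (volume.restrict K) := ⟨by simpa using hKc.measure_lt_top⟩
  exact (h K hK hKc).integrable hq

lemma exists_glued (hU : IsOpen U) {i : Fin n} {f : En n → ℝ} {V : ℕ → Set (En n)}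
    (hV : ∀ k, IsOpen (V k)) (hm : Monotone V) (hVU : (⋃ k, V k) = U) {g : ℕ → En n → ℝ}
    (hw : ∀ k, IsWeakPd (V k) i f (g k)) {q : ℝ≥0∞} (hq : 1 ≤ q)
    (hg : ∀ k, ∀ K ⊆ V k, IsCompact K → MemLp (g k) q (volume.restrict K)) :
    ∃ G, Measurable G ∧ IsWeakPd U i f G ∧
      ∀ K ⊆ U, IsCompact K → MemLp G q (volume.restrict K) := by
  classical
  have hgl : ∀ k, LocallyIntegrableOn (g k) (V k) := fun k =>
    locallyIntegrableOn_of_memLp (hV k) hq (hg k)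
  have hae : ∀ᵐ x, ∀ k l, k ≤ l → x ∈ V k → g k x = g l x := by
    rw [ae_all_iff]; intro k
    rw [ae_all_iff]; intro l
    by_cases hkl : k ≤ l
    · filter_upwards [(hw k).unique (hV k) ((hw l).mono (hm hkl)) (hgl k)
        ((hgl l).mono_set (hm hkl))] with x hx _ using hx
    · exact ae_of_all _ fun x h => absurd h hkl
  set G₀ : En n → ℝ := fun x => if h : ∃ k, x ∈ V k then g (Nat.find h) x else 0
  have hG₀ : ∀ᵐ x, ∀ k, x ∈ V k → G₀ x = g k x := by
    filter_upwards [hae] with x hx k hk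
    have h : ∃ k, x ∈ V k := ⟨k, hk⟩
    simp only [G₀, dif_pos h]
    exact hx _ _ (Nat.find_min' h hk) (Nat.find_spec h)
  have hG₀m : AEStronglyMeasurable G₀ (volume.restrict U) := by
    rw [← hVU, aestronglyMeasurable_iUnion_iff]
    intro k
    refine (hgl k).aestronglyMeasurable.congr ?_
    rw [EventuallyEq, ae_restrict_iff' (hV k).measurableSet]
    filter_upwards [hG₀] with x hx hxk using (hx k hxk).symm
  have hG : ∀ᵐ x, ∀ k, x ∈ V k → g k x = hG₀m.mk G₀ x := by
    have := hG₀m.ae_eq_mk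
    rw [EventuallyEq, ae_restrict_iff' hU.measurableSet] at this
    filter_upwards [hG₀, this] with x hx h2 k hk
    rw [← h2 (hVU ▸ mem_iUnion_of_mem k hk), hx k hk]
  refine ⟨hG₀m.mk G₀, hG₀m.stronglyMeasurable_mk.measurable, fun u hu => ?_, fun K hKU hK => ?_⟩
  · obtain ⟨k, hk⟩ := subset_of_compact_iUnion hV hm hu.2.1 (hu.2.2.trans hVU.ge)
    have hu' : IsTest (V k) u := ⟨hu.1, hu.2.1, hk⟩
    have h2 : IsWeakPd (V k) i f (hG₀m.mk G₀) :=
      (hw k).congr_ae (hV k) (hG.mono fun x hx => hx k)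
    have h3 := h2 u hu'
    rw [setIntegral_mul_test ((tsupport_pd i).trans hk), setIntegral_mul_test hk] at h3
    rwa [setIntegral_mul_test ((tsupport_pd i).trans hu.2.2), setIntegral_mul_test hu.2.2]
  · obtain ⟨k, hk⟩ := subset_of_compact_iUnion hV hm hK (hKU.trans hVU.ge)
    refine (hg k K hk hK).ae_eq ?_
    rw [EventuallyEq, ae_restrict_iff' hK.measurableSet]
    filter_upwards [hG] with x hx hxK using hx k (hk hxK)

lemma memLp_of_weighted {w g : En n → ℝ} (hw : ContinuousOn w U)
    (hw0 : ∀ x ∈ U, 0 < w x) {q : ℝ} (hq : 0 < q) (hg : LocallyIntegrableOn g U)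
    (h : ∫⁻ x in U, ‖g x * w x‖ₑ ^ q ≠ ⊤) {K : Set (En n)} (hKU : K ⊆ U) (hK : IsCompact K) :
    MemLp g (ENNReal.ofReal q) (volume.restrict K) := by
  have hm : AEStronglyMeasurable g (volume.restrict K) :=
    (hg.integrableOn_compact_subset hKU hK).aestronglyMeasurable
  refine ⟨hm, ?_⟩
  rw [eLpNorm_lt_top_iff_lintegral_rpow_enorm_lt_top (by simpa using hq) ENNReal.ofReal_ne_top,
    ENNReal.toReal_ofReal hq.le]
  obtain ⟨m, hm0, hmw⟩ : ∃ m > 0, ∀ x ∈ K, m ≤ w x := by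
    rcases K.eq_empty_or_nonempty with rfl | hne
    · exact ⟨1, one_pos, by simp⟩
    · obtain ⟨x, hx, hxm⟩ := hK.exists_isMinOn hne (hw.mono hKU)
      exact ⟨w x, hw0 x (hKU hx), fun y hy => hxm hy⟩
  have hb : ∀ x ∈ K, ‖g x‖ₑ ^ q ≤ ENNReal.ofReal (m⁻¹) ^ q * ‖g x * w x‖ₑ ^ q := by
    intro x hx
    rw [← ENNReal.mul_rpow_of_nonneg _ _ hq.le]
    refine ENNReal.rpow_le_rpow ?_ hq.le
    rw [← ofReal_norm, ← ofReal_norm, ← ENNReal.ofReal_mul (by positivity)]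
    refine ENNReal.ofReal_le_ofReal ?_
    rw [norm_mul, Real.norm_of_nonneg (hw0 x (hKU hx)).le, inv_mul_eq_div, le_div_iff₀ hm0]
    exact mul_le_mul_of_nonneg_left (hmw x hx) (norm_nonneg _)
  calc ∫⁻ x in K, ‖g x‖ₑ ^ q ≤ ∫⁻ x in K, ENNReal.ofReal (m⁻¹) ^ q * ‖g x * w x‖ₑ ^ q :=
        setLIntegral_mono' hK.measurableSet hb
    _ = ENNReal.ofReal (m⁻¹) ^ q * ∫⁻ x in K, ‖g x * w x‖ₑ ^ q :=
        lintegral_const_mul' _ _ (ENNReal.rpow_ne_top_of_nonneg hq.le ENNReal.ofReal_ne_top)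
    _ ≤ ENNReal.ofReal (m⁻¹) ^ q * ∫⁻ x in U, ‖g x * w x‖ₑ ^ q := by
        gcongr
    _ < ⊤ := ENNReal.mul_lt_top
        (ENNReal.rpow_lt_top_of_nonneg hq.le ENNReal.ofReal_ne_top) h.lt_top

lemma lintegral_pd_lt_top {f : En n → ℝ} (hf : IsTest U f) {p : ℝ} (hp : 0 < p) :
    ∫⁻ y, (∑ j, ‖pd j f y‖ₑ) ^ p < ⊤ := by
  have hc : ∀ j, Continuous fun y => ‖pd j f y‖₊ := fun j => (hf.pd j).continuous.nnnorm
  have hc' : Continuous fun y => (∑ j, ‖pd j f y‖₊) ^ p :=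
    (NNReal.continuous_rpow_const hp.le).comp (continuous_finsetSum _ fun j _ => hc j)
  have hs : HasCompactSupport fun y => (∑ j, ‖pd j f y‖₊) ^ p := by
    refine hf.2.1.mono' fun y hy => ?_
    by_contra h
    apply hy
    simp [pd_eq_zero_of_notMem h, hp.ne']
  have : ∀ y, (∑ j, ‖pd j f y‖ₑ) ^ p = (((∑ j, ‖pd j f y‖₊) ^ p : NNReal) : ℝ≥0∞) := by
    intro y
    rw [ENNReal.coe_rpow_of_nonneg _ hp.le]
    push_cast
    rfl
  simp_rw [this]
  have h2 : Integrable (fun y => (((∑ j, ‖pd j f y‖₊) ^ p : NNReal) : ℝ)) :=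
    (NNReal.continuous_coe.comp hc').integrable_of_hasCompactSupport
      (hs.comp_left (g := fun x : NNReal => (x : ℝ)) rfl)
  have := h2.2
  rw [HasFiniteIntegral] at this
  refine lt_of_le_of_lt (lintegral_mono fun y => ?_) this
  rw [← ofReal_norm, Real.norm_of_nonneg (NNReal.coe_nonneg _), ENNReal.ofReal_coe_nnreal]

lemma CompTest.exists_sobMap {φ : En n → En n} {p q : ℝ} {w : En n → ℝ} {C : ℝ≥0∞}
    (h : CompTest U U' φ p q w C) (hC : C ≠ ⊤) (hU : IsOpen U) (hU' : IsOpen U')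
    (hφ : ContinuousOn φ U) (hφU : MapsTo φ U U') (hq : 1 ≤ q) (hp : 0 < p)
    (hw : ContinuousOn w U) (hw0 : ∀ x ∈ U, 0 < w x) : ∃ G, SobMap U φ G q := by
  obtain ⟨V, χ, hV, hVm, hVU, hχ, hχ1⟩ := exists_exhaustion hU'
  have hq0 : 0 < q := by linarith
  have key : ∀ i j, ∃ G, Measurable G ∧ IsWeakPd U j (fun x => φ x i) G ∧
      ∀ K ⊆ U, IsCompact K → MemLp G (ENNReal.ofReal q) (volume.restrict K) := by
    intro i j
    have hf : ∀ k, IsTest U' fun y => χ k y * y i := fun k => (hχ k).mul_right (contDiff_coord i)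
    choose g hg using fun k => h _ (hf k)
    have hVo : ∀ k, IsOpen (U ∩ φ ⁻¹' V k) := fun k => hφ.isOpen_inter_preimage hU (hV k)
    refine exists_glued hU (V := fun k => U ∩ φ ⁻¹' V k) hVo
      (fun k l hkl => inter_subset_inter_right _ (preimage_mono (hVm hkl))) ?_
      (g := fun k => g k j) (fun k => ?_) (by simpa using hq) (fun k K hKV hK => ?_)
    · rw [← inter_iUnion, ← preimage_iUnion, hVU]
      exact inter_eq_left.2 hφU
    · refine ((hg k j).2.1.mono inter_subset_left).congr_left (hVo k) fun x hx => ?_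
      rw [hχ1 k _ hx.2, one_mul]
    · refine memLp_of_weighted hw hw0 hq0 (hg k j).1 (ne_top_of_le_ne_top ?_ (hg k j).2.2)
        (hKV.trans inter_subset_left) hK
      exact ENNReal.mul_ne_top hC (ENNReal.rpow_ne_top_of_nonneg (by positivity)
        (lintegral_pd_lt_top (hf k) hp).ne)
  choose G hGm hGw hGL using key
  exact ⟨fun x => Matrix.of fun i j => G i j x, hφ, hGm, hGw, fun K hKU hK i j => hGL i j K hKU hK⟩
end Sobolev

/-- Sum of the `(n-1)`-st powers of the entries. -/
def powS {n : ℕ} (M : Matrix (Fin n) (Fin n) ℝ) : ℝ := ∑ i, ∑ j, |M i j| ^ (n - 1)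

section Approximation
variable {n : ℕ} {U : Set (En n)}

lemma powS_nonneg (M : Matrix (Fin n) (Fin n) ℝ) : 0 ≤ powS M :=
  Finset.sum_nonneg fun _ _ => Finset.sum_nonneg fun _ _ => by positivity

lemma le_powS (M : Matrix (Fin n) (Fin n) ℝ) (i j : Fin n) : |M i j| ^ (n - 1) ≤ powS M :=
  (Finset.single_le_sum (f := fun j => |M i j| ^ (n - 1)) (fun _ _ => by positivity)
    (Finset.mem_univ j)).trans
    (Finset.single_le_sum (f := fun i => ∑ j, |M i j| ^ (n - 1))
      (fun _ _ => Finset.sum_nonneg fun _ _ => by positivity) (Finset.mem_univ i))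

lemma powS_add_le (M N : Matrix (Fin n) (Fin n) ℝ) :
    powS (M + N) ≤ 2 ^ (n - 1 - 1) * (powS M + powS N) := by
  simp only [powS, ← Finset.sum_add_distrib, Finset.mul_sum]
  refine Finset.sum_le_sum fun i _ => Finset.sum_le_sum fun j _ => ?_
  rw [Matrix.add_apply]
  exact (pow_le_pow_left₀ (abs_nonneg _) (abs_add_le _ _) _).trans
    (add_pow_le (abs_nonneg _) (abs_nonneg _) _)

lemma abs_adjugate_le (M : Matrix (Fin n) (Fin n) ℝ) (i j : Fin n) :
    |M.adjugate i j| ≤ (n - 1).factorial * powS M := by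
  obtain _ | m := n
  · exact i.elim0
  obtain ⟨ab, -, hab⟩ := Finset.exists_max_image (Finset.univ : Finset (Fin (m + 1) × Fin (m + 1)))
    (fun ab => |M ab.1 ab.2|) ⟨(i, j), Finset.mem_univ _⟩
  rw [Matrix.adjugate_fin_succ_eq_det_submatrix, abs_mul, abs_pow, abs_neg, abs_one, one_pow,
    one_mul]
  have h := Matrix.det_le (A := M.submatrix j.succAbove i.succAbove)
    (abv := AbsoluteValue.abs) (x := |M ab.1 ab.2|) (fun a b => hab (_, _) (Finset.mem_univ _))
  simp only [Fintype.card_fin, nsmul_eq_mul] at h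
  refine h.trans ?_
  have := le_powS M ab.1 ab.2
  simp only [Nat.add_sub_cancel] at this ⊢
  gcongr

lemma measurable_adjugate {G : En n → Matrix (Fin n) (Fin n) ℝ}
    (hG : ∀ i j, Measurable fun x => G x i j) (i j : Fin n) :
    Measurable fun x => (G x).adjugate i j := by
  have h1 : Measurable fun x => (fun i j => G x i j : Fin n → Fin n → ℝ) :=
    measurable_pi_iff.2 fun i => measurable_pi_iff.2 fun j => hG i j
  have h2 : Continuous fun M : Matrix (Fin n) (Fin n) ℝ => M.adjugate i j :=
    continuous_id.matrix_adjugate.matrix_elem i j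
  have h3 : Continuous fun M : Fin n → Fin n → ℝ => (Matrix.of M).adjugate i j := h2
  exact h3.measurable.comp h1

lemma lintegral_pow_le {f : En n → ℝ} {μ : Measure (En n)} {m : ℕ} (hm : m ≠ 0) {a : ℝ≥0∞}
    (h : eLpNorm f m μ ≤ a) : ∫⁻ x, ‖f x‖ₑ ^ m ∂μ ≤ a ^ m := by
  rw [eLpNorm_eq_lintegral_rpow_enorm_toReal (by simpa using hm) (by simp)] at h
  simp only [ENNReal.toReal_natCast, ENNReal.rpow_natCast] at h
  calc ∫⁻ x, ‖f x‖ₑ ^ m ∂μ = ((∫⁻ x, ‖f x‖ₑ ^ m ∂μ) ^ (1 / (m : ℝ))) ^ m := by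
        rw [← ENNReal.rpow_natCast, ← ENNReal.rpow_mul, one_div_mul_cancel (by simpa using hm),
          ENNReal.rpow_one]
    _ ≤ a ^ m := by gcongr

lemma memLp_mul_add (hU : IsOpen U) {u g χ : En n → ℝ} (hu : ContinuousOn u U) {r : ℝ≥0∞}
    (hg : ∀ K ⊆ U, IsCompact K → MemLp g r (volume.restrict K)) (hgm : Measurable g) {i : Fin n}
    (hχ : IsTest U χ) : MemLp (fun x => χ x * g x + pd i χ x * u x) r := by
  refine MemLp.add ?_ ?_
  · obtain ⟨C, hC⟩ := hχ.2.1.exists_bound_of_continuous hχ.continuous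
    have h := (memLp_indicator_iff_restrict hχ.2.1.isCompact.measurableSet).2
      (hg _ hχ.2.2 hχ.2.1)
    refine h.of_le_mul (c := C) (hχ.continuous.measurable.mul hgm).aestronglyMeasurable
      (ae_of_all _ fun x => ?_)
    by_cases hx : x ∈ tsupport χ
    · rw [indicator_of_mem hx, norm_mul]
      exact mul_le_mul_of_nonneg_right (hC x) (norm_nonneg _)
    · simp [image_eq_zero_of_notMem_tsupport hx, indicator_of_notMem hx]
  · have hc := continuous_mul_of_tsupport hU hu (hχ.pd i).continuous (hχ.pd i).2.2
    exact hc.memLp_of_hasCompactSupport (hχ.pd i).2.1.mul_right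

lemma SobMap.locallyIntegrableOn {φ : En n → En n} {G : En n → Matrix (Fin n) (Fin n) ℝ} {q : ℝ}
    (hG : SobMap U φ G q) (hU : IsOpen U) (hq : 1 ≤ q) (i j : Fin n) :
    LocallyIntegrableOn (fun x => G x i j) U :=
  locallyIntegrableOn_of_memLp hU (by simpa using hq) fun K hKU hK => hG.memLp K hKU hK i j

lemma SobMap.continuousOn_coord {φ : En n → En n} {G : En n → Matrix (Fin n) (Fin n) ℝ} {q : ℝ}
    (hG : SobMap U φ G q) (i : Fin n) : ContinuousOn (fun x => φ x i) U :=
  (contDiff_coord i).continuous.comp_continuousOn hG.cont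

theorem SobMap.exists_approx {φ : En n → En n} {G : En n → Matrix (Fin n) (Fin n) ℝ} {q : ℝ}
    (hG : SobMap U φ G q) (hU : IsOpen U) (hn : 2 ≤ n) (hq : (n : ℝ) - 1 ≤ q) :
    ∃ Φ, Approx U φ G Φ := by
  set m := n - 1 with hm
  have hm0 : m ≠ 0 := by omega
  have hmc : (m : ℝ) = n - 1 := by rw [hm, Nat.cast_sub (by omega), Nat.cast_one]
  have hm1 : (1 : ℝ≥0∞) ≤ m := by exact_mod_cast Nat.one_le_iff_ne_zero.2 hm0
  have hq1 : 1 ≤ q := by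
    have : (1 : ℝ) ≤ m := by exact_mod_cast Nat.one_le_iff_ne_zero.2 hm0
    linarith
  have hGr : ∀ i j, ∀ K ⊆ U, IsCompact K → MemLp (fun x => G x i j) m (volume.restrict K) := by
    intro i j K hKU hK
    have : IsFiniteMeasure (volume.restrict K) := ⟨by simpa using hK.measure_lt_top⟩
    refine (hG.memLp K hKU hK i j).mono_exponent ?_
    rw [← ENNReal.ofReal_natCast]
    exact ENNReal.ofReal_le_ofReal (by linarith)
  obtain ⟨V, χ, hV, hVm, hVU, hχ, hχ1⟩ := exists_exhaustion hU
  set D : ℕ → Fin n → Fin n → En n → ℝ := fun k i j x => χ k x * G x i j + pd j (χ k) x * φ x i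
  have hε : ∀ k : ℕ, (0 : ℝ) < (1 / 2) ^ k := fun k => by positivity
  have happ : ∀ (k : ℕ) i, ∃ v, IsTest U v ∧ (∀ x, |v x - χ k x * φ x i| ≤ (1 / 2) ^ k) ∧
      ∀ j, eLpNorm (pd j v - D k i j) m ≤ ENNReal.ofReal ((1 / 2) ^ k) := fun k i =>
    exists_smooth_approx hU
      (continuous_mul_of_tsupport hU (hG.continuousOn_coord i) (hχ k).continuous (hχ k).2.2)
      (hχ k).2.1.mul_right ((closure_mono (Function.support_mul_subset_left _ _)).trans (hχ k).2.2)
      hm1 (by simp) (fun j => memLp_mul_add hU (hG.continuousOn_coord i) (hGr i j) (hG.meas i j)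
        (hχ k))
      (fun j => isWeakPd_mul_test hU (hG.continuousOn_coord i)
        (hG.locallyIntegrableOn hU hq1 i j) (hG.weak i j) (hχ k)) (hε k)
  choose v hv hvu hvD using happ
  set Φ : ℕ → En n → En n := fun k x => WithLp.toLp 2 fun i => v k i x
  have hΦs : ∀ k, ContDiff ℝ (⊤ : ℕ∞) (Φ k) := fun k => contDiff_piLp 2 |>.2 fun i => (hv k i).1
  set E : ℕ → En n → Matrix (Fin n) (Fin n) ℝ := fun k x =>
    Matrix.of fun i j => pd j (v k i) x - D k i j x
  have hΦE : ∀ k, ∀ x ∈ V k, Jm (Φ k) x = G x + E k x := by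
    intro k x hx
    ext i j
    have h1 : pd j (χ k) x = 0 := by
      rw [pd_congr (v := fun _ => 1)]
      · simp [pd]
      · filter_upwards [(hV k).mem_nhds hx] with y hy using hχ1 k y hy
    simp [Jm, E, D, Φ, hχ1 k x hx, h1]
  have hEm : ∀ k, AEMeasurable (fun x => ENNReal.ofReal (powS (E k x))) := by
    intro k
    refine AEMeasurable.ennreal_ofReal ?_
    refine Finset.aemeasurable_fun_sum _ fun i _ => Finset.aemeasurable_fun_sum _ fun j _ => ?_
    have : AEMeasurable (fun x => E k x i j) :=
      ((hv k i).pd j).continuous.aemeasurable.sub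
        (memLp_mul_add hU (hG.continuousOn_coord i) (hGr i j) (hG.meas i j) (hχ k)).1.aemeasurable
    exact (continuous_abs.measurable.comp_aemeasurable this).pow_const _
  have hEi : ∀ k, ∫⁻ x, ENNReal.ofReal (powS (E k x)) ≤
      ((n : ℝ≥0∞) * n) * ENNReal.ofReal ((1 / 2) ^ k) := by
    intro k
    have e1 : ∀ x, ENNReal.ofReal (powS (E k x)) = ∑ i, ∑ j, ‖E k x i j‖ₑ ^ m := by
      intro x
      rw [powS, ENNReal.ofReal_sum_of_nonneg
        (fun _ _ => Finset.sum_nonneg fun _ _ => by positivity)]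
      refine Finset.sum_congr rfl fun i _ => ?_
      rw [ENNReal.ofReal_sum_of_nonneg (fun _ _ => by positivity)]
      refine Finset.sum_congr rfl fun j _ => ?_
      rw [ENNReal.ofReal_pow (abs_nonneg _), ← Real.norm_eq_abs, ofReal_norm]
    have hmm : ∀ i j, AEMeasurable fun x => ‖E k x i j‖ₑ ^ m := fun i j => by
      have : AEMeasurable (fun x => E k x i j) :=
        ((hv k i).pd j).continuous.aemeasurable.sub
          (memLp_mul_add hU (hG.continuousOn_coord i) (hGr i j) (hG.meas i j)
            (hχ k)).1.aemeasurable
      exact this.enorm.pow_const _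
    simp_rw [e1]
    rw [lintegral_finsetSum' _ fun i _ => Finset.aemeasurable_fun_sum _ fun j _ => hmm i j]
    have hb : ∀ i j, ∫⁻ x, ‖E k x i j‖ₑ ^ m ≤ ENNReal.ofReal ((1 / 2) ^ k) := by
      intro i j
      refine (lintegral_pow_le hm0 (hvD k i j)).trans ?_
      refine pow_le_of_le_one bot_le ?_ hm0
      rw [← ENNReal.ofReal_one]
      exact ENNReal.ofReal_le_ofReal (pow_le_one₀ (by norm_num) (by norm_num))
    calc ∑ i, ∫⁻ x, ∑ j, ‖E k x i j‖ₑ ^ m = ∑ i, ∑ j, ∫⁻ x, ‖E k x i j‖ₑ ^ m := by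
          refine Finset.sum_congr rfl fun i _ => ?_
          rw [lintegral_finsetSum' _ fun j _ => hmm i j]
      _ ≤ ∑ _i : Fin n, ∑ _j : Fin n, ENNReal.ofReal ((1 / 2) ^ k) :=
          Finset.sum_le_sum fun i _ => Finset.sum_le_sum fun j _ => hb i j
      _ = _ := by simp [mul_assoc]
  set W : En n → ℝ≥0∞ := fun x => ∑' k, ENNReal.ofReal (powS (E k x))
  have hW : ∫⁻ x, W x ≠ ⊤ := by
    rw [lintegral_tsum hEm]
    refine ne_top_of_le_ne_top ?_ (ENNReal.tsum_le_tsum hEi)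
    rw [ENNReal.tsum_mul_left]
    refine ENNReal.mul_ne_top (by finiteness) ?_
    have : ∀ k : ℕ, ENNReal.ofReal ((1 / 2) ^ k) = (2⁻¹ : ℝ≥0∞) ^ k := fun k => by
      rw [ENNReal.ofReal_pow (by norm_num), one_div, ENNReal.ofReal_inv_of_pos (by norm_num)]
      simp
    simp_rw [this]
    rw [ENNReal.tsum_geometric]
    simp
  have hWm : AEMeasurable W := AEMeasurable.tsum hEm
  have hWi : Integrable fun x => (W x).toReal := integrable_toReal_of_lintegral_ne_top hWm hW
  have hWf : ∀ᵐ x, W x ≠ ⊤ := (ae_lt_top' hWm hW).mono fun x hx => hx.ne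
  have hEW : ∀ᵐ x, ∀ k, powS (E k x) ≤ (W x).toReal := by
    filter_upwards [hWf] with x hx k
    rw [← ENNReal.ofReal_le_iff_le_toReal hx]
    exact ENNReal.le_tsum k
  have hE0 : ∀ᵐ x, ∀ i j, Tendsto (fun k => E k x i j) atTop (nhds 0) := by
    filter_upwards [hWf] with x hx i j
    have h1 := ENNReal.tendsto_atTop_zero_of_tsum_ne_top hx
    have h2 : Tendsto (fun k => powS (E k x)) atTop (nhds 0) := by
      have := (ENNReal.tendsto_toReal ENNReal.zero_ne_top).comp h1
      simpa [Function.comp_def, ENNReal.toReal_ofReal (powS_nonneg _)] using this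
    have h3 : Tendsto (fun k => |E k x i j| ^ m) atTop (nhds 0) :=
      squeeze_zero (fun k => by positivity) (fun k => le_powS (E k x) i j) h2
    have h4 : Tendsto (fun k => (|E k x i j| ^ m) ^ ((m : ℝ)⁻¹)) atTop (nhds 0) := by
      have := h3.rpow_const (p := (m : ℝ)⁻¹) (Or.inr (by positivity))
      rwa [Real.zero_rpow (by simpa using hm0)] at this
    simp_rw [Real.pow_rpow_inv_natCast (abs_nonneg _) hm0] at h4
    exact (tendsto_zero_iff_abs_tendsto_zero _).2 h4
  have hGS : ∀ K ⊆ U, IsCompact K → IntegrableOn (fun x => powS (G x)) K := by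
    intro K hKU hK
    refine integrable_finsetSum _ fun i _ => integrable_finsetSum _ fun j _ => ?_
    exact (hGr i j K hKU hK).integrable_norm_pow hm0
  have hadjm : ∀ i j, Measurable fun x => (G x).adjugate i j := by
    intro i j
    exact measurable_adjugate hG.meas i j
  have hadj_int : ∀ K ⊆ U, IsCompact K → ∀ i j, IntegrableOn (fun x => (G x).adjugate i j) K :=
    fun K hKU hK i j => ((hGS K hKU hK).const_mul ((n - 1).factorial : ℝ)).mono'
      (hadjm i j).aestronglyMeasurable (ae_of_all _ fun x => abs_adjugate_le _ i j)
  refine ⟨Φ, hΦs, fun K hKU hK => ?_, hadj_int, fun K hKU hK i j => ?_⟩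
  · obtain ⟨k₀, hk₀⟩ := subset_of_compact_iUnion hV hVm hK (hKU.trans hVU.ge)
    have h0 : Tendsto (fun k : ℕ => (n : ℝ) * (1 / 2) ^ k) atTop (nhds 0) := by
      simpa using (tendsto_pow_atTop_nhds_zero_of_lt_one (r := (1 / 2 : ℝ)) (by norm_num)
        (by norm_num)).const_mul (n : ℝ)
    rw [Metric.tendstoUniformlyOn_iff]
    intro ε hε'
    filter_upwards [h0.eventually (gt_mem_nhds hε'), eventually_ge_atTop k₀] with k hk hkk x hx
    rw [dist_comm, dist_eq_norm]
    refine ((norm_le_sum _).trans ?_).trans_lt hk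
    calc ∑ i, |(Φ k x - φ x) i| ≤ ∑ _i : Fin n, (1 / 2 : ℝ) ^ k := by
          refine Finset.sum_le_sum fun i _ => ?_
          have := hvu k i x
          rw [hχ1 k x (hVm hkk (hk₀ hx)), one_mul] at this
          exact this
      _ = _ := by simp
  · obtain ⟨k₀, hk₀⟩ := subset_of_compact_iUnion hV hVm hK (hKU.trans hVU.ge)
    set c : ℝ := ((n - 1).factorial : ℝ)
    have hc0 : 0 ≤ c := by positivity
    have hlim := tendsto_integral_filter_of_dominated_convergence (μ := volume.restrict K)
      (l := atTop) (F := fun k x => |(Jm (Φ k) x).adjugate i j - (G x).adjugate i j|)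
      (f := fun _ => (0 : ℝ))
      (fun x => c * (2 ^ (n - 1 - 1) * (powS (G x) + (W x).toReal)) + c * powS (G x)) ?_ ?_ ?_ ?_
    · simpa using hlim
    · refine Eventually.of_forall fun k => ?_
      have h1 : Continuous fun x => (Jm (Φ k) x).adjugate i j :=
        ((Jm_continuous ((hΦs k).of_le (by simp))).matrix_adjugate).matrix_elem i j
      exact (h1.measurable.sub (hadjm i j)).abs.aestronglyMeasurable
    · filter_upwards [eventually_ge_atTop k₀] with k hk
      rw [ae_restrict_iff' hK.measurableSet]
      filter_upwards [hEW] with x hx hxK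
      rw [Real.norm_eq_abs, abs_abs, hΦE k x (hVm hk (hk₀ hxK))]
      refine (abs_sub _ _).trans ?_
      refine add_le_add ?_ (abs_adjugate_le _ i j)
      refine (abs_adjugate_le _ i j).trans ?_
      refine mul_le_mul_of_nonneg_left ?_ hc0
      refine (powS_add_le _ _).trans ?_
      have := hx k
      gcongr
    · exact ((((hGS K hKU hK).add hWi.restrict).const_mul _).const_mul _).add
        ((hGS K hKU hK).const_mul _)
    · rw [ae_restrict_iff' hK.measurableSet]
      filter_upwards [hE0] with x hx hxK
      have h1 : Tendsto (fun k => Jm (Φ k) x) atTop (nhds (G x)) := by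
        have h2 : Tendsto (fun k => G x + E k x) atTop (nhds (G x + 0)) :=
          tendsto_const_nhds.add (tendsto_pi_nhds.2 fun i => tendsto_pi_nhds.2 fun j => hx i j)
        rw [add_zero] at h2
        refine h2.congr' ?_
        filter_upwards [eventually_ge_atTop k₀] with k hk
        rw [hΦE k x (hVm hk (hk₀ hxK))]
      have h3 : Continuous fun M : Matrix (Fin n) (Fin n) ℝ => M.adjugate i j :=
        continuous_id.matrix_adjugate.matrix_elem i j
      have h4 := ((h3.tendsto (G x)).comp h1).sub_const ((G x).adjugate i j)
      simpa using h4.abs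
end Approximation

section Chain
variable {n : ℕ} {U : Set (En n)}

/-- Bounded pointwise convergence times `L¹` convergence. -/
lemma tendsto_integral_mul {H : ℕ → En n → ℝ} {H₀ : En n → ℝ} {P : ℕ → En n → ℝ} {P₀ : En n → ℝ}
    {M : ℝ} (hH : ∀ k, AEStronglyMeasurable (H k)) (hM : ∀ k x, |H k x| ≤ M)
    (hlim : ∀ x, Tendsto (fun k => H k x) atTop (nhds (H₀ x))) (hP : ∀ k, Integrable (P k))
    (hP₀ : Integrable P₀) (hPl : Tendsto (fun k => eLpNorm (P k - P₀) 1) atTop (nhds 0)) :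
    Tendsto (fun k => ∫ x, H k x * P k x) atTop (nhds (∫ x, H₀ x * P₀ x)) := by
  have i1 : ∀ k, Integrable fun x => H k x * (P k x - P₀ x) := fun k =>
    ((hP k).sub hP₀).bdd_mul (hH k) (ae_of_all _ (hM k))
  have i2 : ∀ k, Integrable fun x => H k x * P₀ x := fun k =>
    hP₀.bdd_mul (hH k) (ae_of_all _ (hM k))
  have h1 : Tendsto (fun k => ∫ x, H k x * (P k x - P₀ x)) atTop (nhds 0) := by
    refine tendsto_zero_iff_norm_tendsto_zero.2 (squeeze_zero (fun _ => norm_nonneg _)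
      (g := fun k => M * (eLpNorm (P k - P₀) 1).toReal) (fun k => ?_) ?_)
    · refine (norm_integral_le_integral_norm _).trans ?_
      have : (eLpNorm (P k - P₀) 1).toReal = ∫ x, ‖P k x - P₀ x‖ := by
        rw [eLpNorm_one_eq_lintegral_enorm]
        exact (integral_norm_eq_lintegral_enorm ((hP k).sub hP₀).aestronglyMeasurable).symm
      rw [this, ← integral_const_mul]
      refine integral_mono (i1 k).norm (((hP k).sub hP₀).norm.const_mul M) fun x => ?_
      simp only [norm_mul]
      exact mul_le_mul_of_nonneg_right (hM k x) (norm_nonneg _)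
    · simpa using ((ENNReal.tendsto_toReal ENNReal.zero_ne_top).comp hPl).const_mul M
  have h2 : Tendsto (fun k => ∫ x, H k x * P₀ x) atTop (nhds (∫ x, H₀ x * P₀ x)) := by
    refine tendsto_integral_of_dominated_convergence (fun x => M * |P₀ x|)
      (fun k => (i2 k).aestronglyMeasurable) (hP₀.norm.const_mul M) (fun k => ae_of_all _ fun x => ?_)
      (ae_of_all _ fun x => (hlim x).mul_const _)
    rw [norm_mul]
    exact mul_le_mul_of_nonneg_right (hM k x) (norm_nonneg _)
  have h3 := h1.add h2
  rw [zero_add] at h3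
  refine h3.congr fun k => ?_
  rw [← integral_add (i1 k) (i2 k)]
  congr 1
  funext x
  ring

theorem SobMap.chain {φ : En n → En n} {G : En n → Matrix (Fin n) (Fin n) ℝ} {q : ℝ}
    (hG : SobMap U φ G q) (hU : IsOpen U) (hq : 1 ≤ q) {F : En n → ℝ} (hF : IsTest univ F)
    (j : Fin n) :
    IsWeakPd U j (fun x => F (φ x)) (fun x => ∑ i, pd i F (φ x) * G x i j) := by
  intro u hu
  obtain ⟨χ, hχ, -, W, hW, hKW, hχ1⟩ := exists_cutoff hu.2.1.isCompact hU hu.2.2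
  have hr1 : ∀ i j, ∀ K ⊆ U, IsCompact K → MemLp (fun x => G x i j) 1 (volume.restrict K) := by
    intro i j K hKU hK
    have : IsFiniteMeasure (volume.restrict K) := ⟨by simpa using hK.measure_lt_top⟩
    exact (hG.memLp K hKU hK i j).mono_exponent (by simpa using hq)
  have hm := fun i j => memLp_mul_add (i := j) hU (hG.continuousOn_coord i) (hr1 i j) (hG.meas i j) hχ
  have happ : ∀ (k : ℕ) i, ∃ v, IsTest U v ∧ (∀ x, |v x - χ x * φ x i| ≤ (1 / 2) ^ k) ∧
      ∀ j, eLpNorm (pd j v - fun x => χ x * G x i j + pd j χ x * φ x i) 1 ≤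
        ENNReal.ofReal ((1 / 2) ^ k) := fun k i =>
    exists_smooth_approx hU
      (continuous_mul_of_tsupport hU (hG.continuousOn_coord i) hχ.continuous hχ.2.2)
      hχ.2.1.mul_right
      ((closure_mono (Function.support_mul_subset_left _ _)).trans hχ.2.2)
      le_rfl (by simp) (fun j => hm i j)
      (fun j => isWeakPd_mul_test hU (hG.continuousOn_coord i)
        (hG.locallyIntegrableOn hU hq i j) (hG.weak i j) hχ) (by positivity)
  choose v hv hvu hvD using happ
  set Φ : ℕ → En n → En n := fun k x => WithLp.toLp 2 fun i => v k i x with hΦ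
  have hΦs : ∀ k, ContDiff ℝ (⊤ : ℕ∞) (Φ k) := fun k => contDiff_piLp 2 |>.2 fun i => (hv k i).1
  have h0 : Tendsto (fun k : ℕ => ((1 : ℝ) / 2) ^ k) atTop (nhds 0) :=
    tendsto_pow_atTop_nhds_zero_of_lt_one (by norm_num) (by norm_num)
  have hΦl : ∀ x ∈ tsupport u, Tendsto (fun k => Φ k x) atTop (nhds (φ x)) := by
    intro x hx
    have h1 : ∀ i, Tendsto (fun k => v k i x) atTop (nhds (φ x i)) := by
      intro i
      have h2 := squeeze_zero (fun k => abs_nonneg _) (fun k => hvu k i x) h0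
      rw [hχ1 x (hKW hx), one_mul] at h2
      exact tendsto_sub_nhds_zero_iff.1 ((tendsto_zero_iff_abs_tendsto_zero _).2 h2)
    have h3 := ((PiLp.continuous_toLp 2 fun _ : Fin n => ℝ).tendsto _).comp (tendsto_pi_nhds.2 h1)
    exact h3
  have key : ∀ (L : En n → ℝ), Continuous L → HasCompactSupport L → ∀ (g : En n → ℝ),
      Continuous g → HasCompactSupport g → tsupport g ⊆ tsupport u →
      (∀ k, AEStronglyMeasurable fun x => g x * L (Φ k x)) ∧ (∃ M, ∀ k x, |g x * L (Φ k x)| ≤ M) ∧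
      ∀ x, Tendsto (fun k => g x * L (Φ k x)) atTop (nhds (g x * L (φ x))) := by
    intro L hL hLc g hg hgc hgu
    refine ⟨fun k => (hg.mul (hL.comp (hΦs k).continuous)).aestronglyMeasurable, ?_, fun x => ?_⟩
    · obtain ⟨A, hA⟩ := hLc.exists_bound_of_continuous hL
      obtain ⟨B, hB⟩ := hgc.exists_bound_of_continuous hg
      refine ⟨B * A, fun k x => ?_⟩
      rw [abs_mul]
      exact mul_le_mul (hB x) (hA _) (abs_nonneg _) ((norm_nonneg _).trans (hB x))
    · by_cases hx : x ∈ tsupport g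
      · exact ((hL.tendsto _).comp (hΦl x (hgu hx))).const_mul _
      · simp [image_eq_zero_of_notMem_tsupport hx]
  have hF0 := fun i => (hF.pd i)
  -- the identity for the smooth approximations
  have hk : ∀ k, ∫ x, pd j u x * F (Φ k x) * 1 =
      -∑ i, ∫ x, u x * pd i F (Φ k x) * pd j (v k i) x := by
    intro k
    have hc : ContDiff ℝ (⊤ : ℕ∞) fun x => F (Φ k x) := hF.1.comp (hΦs k)
    have h1 := integral_pd_mul (hc.of_le (by simp)) (hu.1.of_le (by simp)) hu.2.1 j
    rw [← integral_finsetSum]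
    · calc _ = ∫ x, F (Φ k x) * pd j u x := by
            congr 1; funext x; ring
        _ = _ := h1
        _ = _ := by
            congr 2
            funext x
            rw [pd_comp ((hΦs k).differentiable (by simp)) hF.differentiable, Finset.sum_mul]
            refine Finset.sum_congr rfl fun i _ => ?_
            have : Jm (Φ k) x i j = pd j (v k i) x := rfl
            rw [this]
            ring
    · intro i _
      exact (((hu.continuous.mul ((hF.pd i).continuous.comp (hΦs k).continuous)).mul
        ((hv k i).pd j).continuous).integrable_of_hasCompactSupport hu.2.1.mul_right.mul_right)
  have hL : Tendsto (fun k => ∫ x, pd j u x * F (Φ k x) * 1) atTop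
      (nhds (∫ x, pd j u x * F (φ x))) := by
    obtain ⟨a, ⟨M, b⟩, c⟩ := key F hF.continuous hF.2.1 (pd j u) (hu.pd j).continuous (hu.pd j).2.1
      (tsupport_pd j)
    have hintg : Integrable (pd j u) :=
      (hu.pd j).continuous.integrable_of_hasCompactSupport (hu.pd j).2.1
    obtain ⟨A, hA⟩ := hF.2.1.exists_bound_of_continuous hF.continuous
    refine tendsto_integral_of_dominated_convergence (fun x => A * ‖pd j u x‖)
      (fun k => by simpa using a k) (hintg.norm.const_mul _) (fun k => ae_of_all _ fun x => ?_)
      (ae_of_all _ fun x => by simpa using c x)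
    rw [mul_one, norm_mul, mul_comm]
    exact mul_le_mul_of_nonneg_right (hA _) (norm_nonneg _)
  have hR : ∀ i, Tendsto (fun k => ∫ x, u x * pd i F (Φ k x) * pd j (v k i) x) atTop
      (nhds (∫ x, u x * pd i F (φ x) * (χ x * G x i j + pd j χ x * φ x i))) := by
    intro i
    obtain ⟨a, ⟨M, b⟩, c⟩ := key (pd i F) (hF.pd i).continuous (hF.pd i).2.1 u hu.continuous hu.2.1
      le_rfl
    refine tendsto_integral_mul a b c (fun k => ((hv k i).pd j).continuous.integrable_of_hasCompactSupport
      ((hv k i).pd j).2.1) (memLp_one_iff_integrable.1 (hm i j)) ?_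
    refine tendsto_of_tendsto_of_tendsto_of_le_of_le tendsto_const_nhds ?_ (fun _ => bot_le)
      (fun k => hvD k i j)
    simpa using ENNReal.tendsto_ofReal h0
  have hfin := tendsto_nhds_unique hL
    (((tendsto_finsetSum _ fun i _ => hR i).neg).congr fun k => (hk k).symm)
  have hpt : ∀ i x, u x * pd i F (φ x) * (χ x * G x i j + pd j χ x * φ x i) =
      pd i F (φ x) * G x i j * u x := by
    intro i x
    by_cases hx : x ∈ tsupport u
    · have h1 : pd j χ x = 0 := by
        rw [pd_congr (v := fun _ => 1)]
        · simp [pd]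
        · filter_upwards [hW.mem_nhds (hKW hx)] with y hy using hχ1 y hy
      rw [hχ1 x (hKW hx), h1]
      ring
    · simp [image_eq_zero_of_notMem_tsupport hx]
  simp_rw [hpt] at hfin
  have e1 : ∫ x in U, F (φ x) * pd j u x = ∫ x, pd j u x * F (φ x) := by
    rw [setIntegral_mul_test ((tsupport_pd j).trans hu.2.2)]
    congr 1; funext x; ring
  rw [e1, hfin, setIntegral_mul_test hu.2.2]
  rw [← integral_finsetSum]
  · congr 2
    funext x
    rw [Finset.sum_mul]
  · intro i _
    have hc := continuous_mul_of_tsupport hU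
      ((hF.pd i).continuous.comp_continuousOn hG.cont) hu.continuous hu.2.2
    have h1 := integrable_mul_of_locallyIntegrableOn (hG.locallyIntegrableOn hU hq i j) hc
      hu.2.1.mul_right
      ((closure_mono (Function.support_mul_subset_left _ _)).trans hu.2.2)
    refine h1.congr (ae_of_all _ fun x => ?_)
    simp only [Function.comp_apply]
    ring
end Chain

section KeyTest
variable {n : ℕ} {U U' : Set (En n)}

lemma lintegral_le_of_tendsto {α : Type*} [MeasurableSpace α] {μ : Measure α}
    {F : ℕ → α → ℝ≥0∞} {F₀ : α → ℝ≥0∞} (hF : ∀ k, AEMeasurable (F k) μ)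
    (hlim : ∀ᵐ x ∂μ, Tendsto (fun k => F k x) atTop (nhds (F₀ x))) {B : ℕ → ℝ≥0∞} {b : ℝ≥0∞}
    (hB : ∀ k, ∫⁻ x, F k x ∂μ ≤ B k) (hb : Tendsto B atTop (nhds b)) : ∫⁻ x, F₀ x ∂μ ≤ b :=
  calc ∫⁻ x, F₀ x ∂μ = ∫⁻ x, liminf (fun k => F k x) atTop ∂μ :=
        lintegral_congr_ae (hlim.mono fun x hx => hx.liminf_eq.symm)
    _ ≤ liminf (fun k => ∫⁻ x, F k x ∂μ) atTop := lintegral_liminf_le' hF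
    _ ≤ liminf B atTop := liminf_le_liminf (Eventually.of_forall hB)
    _ = b := hb.liminf_eq

lemma pd_comp_coord {g : ℝ → ℝ} {g' : ℝ} {y : En n} {i : Fin n} (hg : HasDerivAt g g' (y i))
    (l : Fin n) : pd l (fun y => g (y i)) y = if i = l then g' else 0 := by
  have h1 : HasFDerivAt (fun y : En n => y i) (EuclideanSpace.proj i : En n →L[ℝ] ℝ) y :=
    (EuclideanSpace.proj i : En n →L[ℝ] ℝ).hasFDerivAt
  have h2 := hg.comp_hasFDerivAt y h1
  have h3 : fderiv ℝ (fun y : En n => g (y i)) y = g' • (EuclideanSpace.proj i : En n →L[ℝ] ℝ) :=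
    h2.fderiv
  rw [pd, h3]
  by_cases h : i = l <;> simp [h]

/-- Testing with an oscillating factor: one half of the key inequality. -/
lemma CompTest.oscillating {φ : En n → En n} {p q : ℝ} {w : En n → ℝ} {C : ℝ≥0∞}
    (h : CompTest U U' φ p q w C) {G : En n → Matrix (Fin n) (Fin n) ℝ} (hG : SobMap U φ G q)
    (hU : IsOpen U) (hq : 1 ≤ q) (hp : 0 < p) {η : En n → ℝ} (hη : IsTest U' η) (i j : Fin n)
    {s c : ℝ → ℝ} (hs : ContDiff ℝ (⊤ : ℕ∞) s) (hsc : ∀ r, HasDerivAt s (c r) r) {ε : ℝ}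
    (hε : ∀ r, |s r| ≤ ε) (hc : ∀ r, |c r| ≤ 1) :
    ∃ g : En n → ℝ, AEStronglyMeasurable g (volume.restrict U) ∧
      (∀ᵐ x, x ∈ U → g x = η (φ x) * c (φ x i) * G x i j +
        s (φ x i) * ∑ l, pd l η (φ x) * G x l j) ∧
      ∫⁻ x in U, ‖g x * w x‖ₑ ^ q ≤
        C * (∫⁻ y, (‖η y‖ₑ + ENNReal.ofReal ε * ∑ l, ‖pd l η y‖ₑ) ^ p) ^ (q / p) := by
  have hsS : ContDiff ℝ (⊤ : ℕ∞) fun y : En n => s (y i) := hs.comp (contDiff_coord i)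
  have hf : IsTest U' fun y => η y * s (y i) := hη.mul_right hsS
  have hpd : ∀ l y, pd l (fun y => η y * s (y i)) y =
      (if i = l then η y * c (y i) else 0) + s (y i) * pd l η y := by
    intro l y
    rw [pd_mul hη.differentiable.differentiableAt (hsS.differentiable (by simp)).differentiableAt,
      pd_comp_coord (hsc _)]
    split_ifs <;> ring
  obtain ⟨g, hg⟩ := h _ hf
  obtain ⟨h1, h2, h3⟩ := hg j
  have hch := hG.chain hU hq (hf.mono (subset_univ _)) j
  have hloc : LocallyIntegrableOn
      (fun x => ∑ l, pd l (fun y => η y * s (y i)) (φ x) * G x l j) U := by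
    rw [locallyIntegrableOn_iff hU.isLocallyClosed]
    intro K hKU hK
    refine integrable_finsetSum _ fun l _ => ?_
    exact IntegrableOn.continuousOn_mul
      (((hf.pd l).continuous.comp_continuousOn hG.cont).mono hKU)
      ((locallyIntegrableOn_iff hU.isLocallyClosed).1 (hG.locallyIntegrableOn hU hq l j) K hKU hK)
      hK
  refine ⟨g j, h1.aestronglyMeasurable, ?_, h3.trans ?_⟩
  · filter_upwards [IsWeakPd.unique hU h2 hch h1 hloc] with x hx hxU
    rw [hx hxU]
    simp only [hpd, add_mul, Finset.sum_add_distrib, ite_mul, zero_mul, Finset.sum_ite_eq,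
      Finset.mem_univ, if_true, Finset.mul_sum, mul_assoc]
  · gcongr with y
    calc ∑ l, ‖pd l (fun y => η y * s (y i)) y‖ₑ
        ≤ ∑ l, ((if i = l then ‖η y‖ₑ else 0) + ENNReal.ofReal ε * ‖pd l η y‖ₑ) := by
          refine Finset.sum_le_sum fun l _ => ?_
          rw [hpd]
          refine (enorm_add_le _ _).trans (add_le_add ?_ ?_)
          · split_ifs
            · rw [enorm_mul]
              refine mul_le_of_le_one_right' ?_
              rw [← ofReal_norm, ← ENNReal.ofReal_one]
              exact ENNReal.ofReal_le_ofReal (hc _)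
            · simp
          · rw [enorm_mul]
            gcongr
            rw [← ofReal_norm]
            exact ENNReal.ofReal_le_ofReal (hε _)
      _ = _ := by
          simp [Finset.sum_add_distrib, Finset.mul_sum]

theorem CompTest.key_test {φ : En n → En n} {p q : ℝ} {w : En n → ℝ} {C : ℝ≥0∞}
    (h : CompTest U U' φ p q w C) (hC : C ≠ ⊤) {G : En n → Matrix (Fin n) (Fin n) ℝ}
    (hG : SobMap U φ G q)
    (hU : IsOpen U) (hq : 1 ≤ q) (hp : 0 < p) (hw : Measurable w) {η : En n → ℝ}
    (hη : IsTest U' η) (i j : Fin n) :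
    ∫⁻ x in U, ‖η (φ x) * G x i j * w x‖ₑ ^ q ≤
      2 ^ q * C * (∫⁻ y, ‖η y‖ₑ ^ p) ^ (q / p) := by
  have hq0 : 0 ≤ q := by linarith
  set e : ℕ → ℝ := fun k => 1 / ((k : ℝ) + 1)
  have hepos : ∀ k, 0 < e k := fun k => by positivity
  set B : ℕ → ℝ≥0∞ := fun k =>
    (∫⁻ y, (‖η y‖ₑ + ENNReal.ofReal (e k) * ∑ l, ‖pd l η y‖ₑ) ^ p) ^ (q / p)
  have hstep : ∀ k, ∫⁻ x in U, ‖η (φ x) * G x i j * w x‖ₑ ^ q ≤ 2 ^ q * C * B k := by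
    intro k
    have hne : e k ≠ 0 := (hepos k).ne'
    obtain ⟨g, hgm, hge, hgi⟩ := h.oscillating hG hU hq hp hη i j
      (s := fun r => e k * Real.sin (r / e k)) (c := fun r => Real.cos (r / e k)) (ε := e k)
      (contDiff_const.mul (Real.contDiff_sin.comp (contDiff_id.div_const _)))
      (fun r => by
        have := ((hasDerivAt_id r).div_const (e k)).sin.const_mul (e k)
        refine this.congr_deriv ?_
        simp only [id]
        field_simp)
      (fun r => by
        rw [abs_mul, abs_of_pos (hepos k)]
        exact mul_le_of_le_one_right (hepos k).le (Real.abs_sin_le_one _))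
      (fun r => Real.abs_cos_le_one _)
    obtain ⟨g', hgm', hge', hgi'⟩ := h.oscillating hG hU hq hp hη i j
      (s := fun r => e k * Real.cos (r / e k)) (c := fun r => -Real.sin (r / e k)) (ε := e k)
      (contDiff_const.mul (Real.contDiff_cos.comp (contDiff_id.div_const _)))
      (fun r => by
        have := ((hasDerivAt_id r).div_const (e k)).cos.const_mul (e k)
        refine this.congr_deriv ?_
        simp only [id]
        field_simp)
      (fun r => by
        rw [abs_mul, abs_of_pos (hepos k)]
        exact mul_le_of_le_one_right (hepos k).le (Real.abs_cos_le_one _))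
      (fun r => by rw [abs_neg]; exact Real.abs_sin_le_one _)
    calc ∫⁻ x in U, ‖η (φ x) * G x i j * w x‖ₑ ^ q
        ≤ ∫⁻ x in U, (2 : ℝ≥0∞) ^ (q - 1) * (‖g x * w x‖ₑ ^ q + ‖g' x * w x‖ₑ ^ q) := by
          refine lintegral_mono_ae ?_
          rw [ae_restrict_iff' hU.measurableSet]
          filter_upwards [hge, hge'] with x hx hx' hxU
          refine le_trans ?_ (ENNReal.rpow_add_le_mul_rpow_add_rpow _ _ hq)
          refine ENNReal.rpow_le_rpow ?_ hq0
          rw [enorm_mul, enorm_mul (g x), enorm_mul (g' x), ← add_mul]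
          gcongr
          have e1 : η (φ x) * G x i j = Real.cos (φ x i / e k) * g x
              + -Real.sin (φ x i / e k) * g' x := by
            rw [hx hxU, hx' hxU]
            have := Real.sin_sq_add_cos_sq (φ x i / e k)
            linear_combination (-(η (φ x) * G x i j)) * this
          rw [e1]
          refine (enorm_add_le _ _).trans (add_le_add ?_ ?_)
          · rw [enorm_mul]
            refine mul_le_of_le_one_left' ?_
            rw [← ofReal_norm, ← ENNReal.ofReal_one]
            exact ENNReal.ofReal_le_ofReal (Real.abs_cos_le_one _)
          · rw [enorm_mul]
            refine mul_le_of_le_one_left' ?_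
            rw [enorm_neg, ← ofReal_norm, ← ENNReal.ofReal_one]
            exact ENNReal.ofReal_le_ofReal (Real.abs_sin_le_one _)
      _ = 2 ^ (q - 1) * ((∫⁻ x in U, ‖g x * w x‖ₑ ^ q) + ∫⁻ x in U, ‖g' x * w x‖ₑ ^ q) := by
          rw [lintegral_const_mul' _ _ (by finiteness), lintegral_add_left']
          exact ((hgm.aemeasurable.mul hw.aemeasurable).enorm).pow_const _
      _ ≤ 2 ^ (q - 1) * (C * B k + C * B k) :=
          mul_le_mul_right (add_le_add hgi hgi') _
      _ = 2 ^ q * C * B k := by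
          have : (2 : ℝ≥0∞) ^ q = 2 ^ (q - 1) * 2 := by
            rw [ENNReal.rpow_sub _ _ (by simp) (by simp), ENNReal.rpow_one,
              ENNReal.div_mul_cancel (by simp) (by simp)]
          rw [this]
          ring
  have hη' : ∀ l, Measurable fun y => ‖pd l η y‖ₑ := fun l =>
    (hη.pd l).continuous.measurable.enorm
  have hsum : Measurable fun y => ∑ l, ‖pd l η y‖ₑ := Finset.measurable_fun_sum _ fun l _ => hη' l
  have he0 : Tendsto (fun k => ENNReal.ofReal (e k)) atTop (nhds 0) := by
    simpa [e] using ENNReal.tendsto_ofReal tendsto_one_div_add_atTop_nhds_zero_nat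
  have hfin : ∫⁻ y, (‖η y‖ₑ + ∑ l, ‖pd l η y‖ₑ) ^ p ≠ ⊤ := by
    have h1 : ∫⁻ y, ‖η y‖ₑ ^ p ≠ ⊤ := by
      have := (hη.continuous.memLp_of_hasCompactSupport (p := ENNReal.ofReal p)
        (μ := volume) hη.2.1).2
      rw [eLpNorm_lt_top_iff_lintegral_rpow_enorm_lt_top (by simpa using hp) (by simp),
        ENNReal.toReal_ofReal hp.le] at this
      exact this.ne
    have h2 := (lintegral_pd_lt_top hη hp).ne
    refine ne_top_of_le_ne_top (b := ∫⁻ y, (2 : ℝ≥0∞) ^ p * (‖η y‖ₑ ^ p +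
      (∑ l, ‖pd l η y‖ₑ) ^ p)) ?_ (lintegral_mono fun y => ?_)
    · rw [lintegral_const_mul' _ _ (by finiteness), lintegral_add_left
        (hη.continuous.measurable.enorm.pow_const _)]
      exact ENNReal.mul_ne_top (by finiteness) (ENNReal.add_ne_top.2 ⟨h1, h2⟩)
    · calc (‖η y‖ₑ + ∑ l, ‖pd l η y‖ₑ) ^ p
          ≤ (2 * max ‖η y‖ₑ (∑ l, ‖pd l η y‖ₑ)) ^ p := by
            gcongr
            rw [two_mul]
            exact add_le_add (le_max_left _ _) (le_max_right _ _)
        _ = 2 ^ p * (max ‖η y‖ₑ (∑ l, ‖pd l η y‖ₑ)) ^ p := ENNReal.mul_rpow_of_nonneg _ _ hp.le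
        _ ≤ _ := by
            gcongr
            rcases max_choice ‖η y‖ₑ (∑ l, ‖pd l η y‖ₑ) with hm | hm <;> rw [hm]
            · exact le_self_add
            · exact le_add_self
  have hB : Tendsto B atTop (nhds ((∫⁻ y, ‖η y‖ₑ ^ p) ^ (q / p))) := by
    refine (ENNReal.continuous_rpow_const.tendsto _).comp ?_
    refine tendsto_lintegral_of_dominated_convergence
      (fun y => (‖η y‖ₑ + ∑ l, ‖pd l η y‖ₑ) ^ p) (fun k => ?_) (fun k => ae_of_all _ fun y => ?_)
      hfin (ae_of_all _ fun y => ?_)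
    · exact (hη.continuous.measurable.enorm.add (hsum.const_mul _)).pow_const _
    · refine ENNReal.rpow_le_rpow ?_ hp.le
      gcongr
      refine mul_le_of_le_one_left' ?_
      rw [← ENNReal.ofReal_one]
      refine ENNReal.ofReal_le_ofReal ?_
      rw [div_le_one (by positivity)]
      linarith [(Nat.cast_nonneg k : (0 : ℝ) ≤ k)]
    · refine (ENNReal.continuous_rpow_const.tendsto _).comp ?_
      have h1 : Tendsto (fun k => ENNReal.ofReal (e k) * ∑ l, ‖pd l η y‖ₑ) atTop
          (nhds (0 * ∑ l, ‖pd l η y‖ₑ)) :=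
        ENNReal.Tendsto.mul_const he0 (Or.inr (ENNReal.sum_ne_top.2 fun _ _ => enorm_ne_top))
      simpa using h1.const_add ‖η y‖ₑ
  exact ge_of_tendsto' (ENNReal.Tendsto.const_mul hB (Or.inr (by finiteness))) hstep
end KeyTest

section Key
variable {n : ℕ} {U U' : Set (En n)} {φ : En n → En n} {p q : ℝ} {w : En n → ℝ} {C : ℝ≥0∞}
  {G : En n → Matrix (Fin n) (Fin n) ℝ}

lemma CompTest.key_compactSupport (h : CompTest U U' φ p q w C) (hC : C ≠ ⊤)
    (hG : SobMap U φ G q) (hU : IsOpen U) (hq : 1 ≤ q) (hp : 0 < p) (hw : Measurable w)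
    {u : En n → ℝ} (hu : Continuous u) (huc : HasCompactSupport u) (huU : tsupport u ⊆ U')
    (i j : Fin n) :
    ∫⁻ x in U, ‖u (φ x) * G x i j * w x‖ₑ ^ q ≤
      2 ^ q * C * (∫⁻ y, ‖u y‖ₑ ^ p) ^ (q / p) := by
  have hepos : ∀ k : ℕ, 0 < 1 / ((k : ℝ) + 1) := fun k => by positivity
  choose v hv hvd hvs using fun k : ℕ => hu.exists_contDiff_approx (⊤ : ℕ∞)
    (ε := fun _ => 1 / ((k : ℝ) + 1)) continuous_const (fun _ => hepos k)
  have hvt : ∀ k, IsTest U' (v k) := fun k =>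
    ⟨hv k, huc.mono (hvs k), (closure_mono (hvs k)).trans huU⟩
  have hlim : ∀ y, Tendsto (fun k => v k y) atTop (nhds (u y)) := fun y => by
    rw [tendsto_iff_dist_tendsto_zero]
    exact squeeze_zero (fun _ => dist_nonneg) (fun k => (hvd k y).le)
      tendsto_one_div_add_atTop_nhds_zero_nat
  have hcon : Continuous fun r : ℝ => ‖r‖ₑ ^ q := by fun_prop
  have hconp : Continuous fun r : ℝ => ‖r‖ₑ ^ p := by fun_prop
  refine lintegral_le_of_tendsto (F := fun k x => ‖v k (φ x) * G x i j * w x‖ₑ ^ q) (fun k => ?_)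
    (ae_of_all _ fun x => ?_) (fun k => h.key_test hC hG hU hq hp hw (hvt k) i j) ?_
  · have h1 : AEMeasurable (fun x => v k (φ x)) (volume.restrict U) :=
      ((hvt k).continuous.comp_continuousOn hG.cont).aemeasurable hU.measurableSet
    exact hcon.measurable.comp_aemeasurable
      ((h1.mul (hG.meas i j).aemeasurable).mul hw.aemeasurable)
  · exact (hcon.tendsto _).comp (((hlim (φ x)).mul_const _).mul_const _)
  · refine ENNReal.Tendsto.const_mul ?_ (Or.inr (by finiteness))
    refine (ENNReal.continuous_rpow_const.tendsto _).comp ?_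
    obtain ⟨M, hM⟩ := huc.exists_bound_of_continuous hu
    refine tendsto_lintegral_of_dominated_convergence
      ((tsupport u).indicator fun _ => ENNReal.ofReal (M + 1) ^ p)
      (fun k => hconp.measurable.comp (hv k).continuous.measurable)
      (fun k => ae_of_all _ fun y => ?_) ?_ (ae_of_all _ fun y => (hconp.tendsto _).comp (hlim y))
    · by_cases hy : y ∈ tsupport u
      · rw [indicator_of_mem hy]
        refine ENNReal.rpow_le_rpow ?_ hp.le
        rw [← ofReal_norm]
        refine ENNReal.ofReal_le_ofReal ?_
        have h1 := hvd k y
        rw [dist_eq_norm] at h1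
        have h2 : 1 / ((k : ℝ) + 1) ≤ 1 := by
          rw [div_le_one (by positivity)]
          linarith [(Nat.cast_nonneg k : (0 : ℝ) ≤ k)]
        calc ‖v k y‖ = ‖u y + (v k y - u y)‖ := by ring_nf
          _ ≤ ‖u y‖ + ‖v k y - u y‖ := norm_add_le _ _
          _ ≤ M + 1 := add_le_add (hM y) (by linarith)
      · have : v k y = 0 := by
          by_contra hne
          exact hy (subset_tsupport _ (hvs k hne))
        simp [this, hp]
    · rw [lintegral_indicator_const huc.measurableSet]
      exact ENNReal.mul_ne_top (by finiteness) huc.measure_lt_top.ne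

lemma CompTest.key_lowerSemicontinuous (h : CompTest U U' φ p q w C) (hC : C ≠ ⊤)
    (hG : SobMap U φ G q) (hU : IsOpen U) (hU' : IsOpen U') (hφU : MapsTo φ U U') (hq : 1 ≤ q)
    (hp : 0 < p) (hw : Measurable w) {g : En n → ℝ≥0∞} (hg : LowerSemicontinuous g)
    (i j : Fin n) :
    ∫⁻ x in U, g (φ x) ^ q * ‖G x i j * w x‖ₑ ^ q ≤
      2 ^ q * C * (∫⁻ y in U', g y ^ p) ^ (q / p) := by
  have hq0 : 0 ≤ q := by linarith
  set P : (En n → ℝ) → Prop := fun u => Continuous u ∧ HasCompactSupport u ∧ tsupport u ⊆ U' ∧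
    (∀ y, 0 ≤ u y) ∧ ∀ y, ENNReal.ofReal (u y) ≤ g y with hPdef
  have hP0 : P 0 := ⟨continuous_zero, .zero, by simp [tsupport], fun _ => le_rfl,
    fun _ => by simp⟩
  have hPmax : ∀ u v, P u → P v → P fun y => max (u y) (v y) := by
    intro u v hu hv
    have hs : (Function.support fun y => max (u y) (v y)) ⊆ tsupport u ∪ tsupport v := by
      intro y hy
      by_contra hn
      rw [mem_union, not_or] at hn
      exact hy (by simp [image_eq_zero_of_notMem_tsupport hn.1,
        image_eq_zero_of_notMem_tsupport hn.2])
    have hs' := closure_minimal hs ((isClosed_tsupport u).union (isClosed_tsupport v))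
    refine ⟨hu.1.max hv.1, (hu.2.1.isCompact.union hv.2.1.isCompact).of_isClosed_subset
      (isClosed_tsupport _) hs', hs'.trans (union_subset hu.2.2.1 hv.2.2.1),
      fun y => le_max_of_le_left (hu.2.2.2.1 y), fun y => ?_⟩
    show ENNReal.ofReal (max (u y) (v y)) ≤ g y
    rcases max_choice (u y) (v y) with hm | hm <;> rw [hm]
    exacts [hu.2.2.2.2 y, hv.2.2.2.2 y]
  set 𝓕 : Set (En n → ℝ≥0∞) := {f | ∃ u, P u ∧ f = fun y => ENNReal.ofReal (u y)}
  have hLUB : IsLUB 𝓕 (U'.indicator g) := by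
    rw [isLUB_pi]
    intro y
    constructor
    · rintro _ ⟨_, ⟨u, hu, rfl⟩, rfl⟩
      simp only [Function.eval]
      by_cases hy : y ∈ U'
      · rw [indicator_of_mem hy]
        exact hu.2.2.2.2 y
      · rw [image_eq_zero_of_notMem_tsupport fun hh => hy (hu.2.2.1 hh)]
        simp
    · intro b hb
      by_cases hy : y ∈ U'
      · rw [indicator_of_mem hy]
        refine le_of_forall_lt fun a ha => ?_
        obtain ⟨a', haa', ha'⟩ := exists_between ha
        have hat : a' ≠ ⊤ := ha'.ne_top
        have hO : IsOpen (U' ∩ g ⁻¹' Ioi a') := hU'.inter (hg.isOpen_preimage a')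
        obtain ⟨χ, hχ, hχb, W, -, hKW, hχ1⟩ := exists_cutoff (isCompact_singleton (x := y)) hO
          (singleton_subset_iff.2 ⟨hy, ha'⟩)
        refine haa'.trans_le (hb ⟨fun y => ENNReal.ofReal (a'.toReal * χ y), ⟨_,
          ⟨continuous_const.mul hχ.continuous, hχ.2.1.mul_left, ?_, fun z =>
            mul_nonneg ENNReal.toReal_nonneg (hχb z).1, fun z => ?_⟩, rfl⟩, ?_⟩)
        · exact (closure_mono (Function.support_mul_subset_right _ _)).trans
            (hχ.2.2.trans inter_subset_left)
        · by_cases hz : z ∈ tsupport χ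
          · refine le_trans ?_ (le_of_lt (hχ.2.2 hz).2 : a' ≤ g z)
            rw [ENNReal.ofReal_le_iff_le_toReal hat]
            exact mul_le_of_le_one_right ENNReal.toReal_nonneg (hχb z).2
          · simp [image_eq_zero_of_notMem_tsupport hz]
        · simp [hχ1 y (hKW rfl), ENNReal.ofReal_toReal hat]
      · rw [indicator_of_notMem hy]
        exact bot_le
  obtain ⟨𝓕', hsub, hcount, hLUB'⟩ := exists_countable_lowerSemicontinuous_isLUB
    (by
      rintro _ ⟨u, hu, rfl⟩
      exact (ENNReal.continuous_ofReal.comp hu.1).lowerSemicontinuous) hLUB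
  obtain ⟨f, hf⟩ := (hcount.insert fun _ => 0).exists_eq_range (insert_nonempty _ _)
  have hfP : ∀ k, ∃ u, P u ∧ f k = fun y => ENNReal.ofReal (u y) := by
    intro k
    have hk : f k ∈ insert (fun _ => 0) 𝓕' := hf ▸ mem_range_self k
    rcases hk with hk | hk
    · exact ⟨0, hP0, by simp [hk]⟩
    · exact hsub hk
  choose u hu huf using hfP
  set V : ℕ → En n → ℝ := fun k => Nat.rec (u 0) (fun m v y => max (v y) (u (m + 1) y)) k
  have hV0 : V 0 = u 0 := rfl
  have hVs : ∀ k, V (k + 1) = fun y => max (V k y) (u (k + 1) y) := fun k => rfl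
  have hVP : ∀ k, P (V k) := by
    intro k
    induction k with
    | zero => exact hu 0
    | succ k ih => exact hPmax _ _ ih (hu _)
  have hVu : ∀ m k, m ≤ k → ∀ y, u m y ≤ V k y := by
    intro m k hmk
    induction k, hmk using Nat.le_induction with
    | base =>
      intro y
      cases m with
      | zero => exact le_rfl
      | succ m => exact le_max_right _ _
    | succ k _ ih => exact fun y => (ih y).trans (le_max_left _ _)
  have hlim : ∀ y ∈ U', Tendsto (fun k => ENNReal.ofReal (V k y)) atTop (nhds (g y)) := by
    intro y hy
    refine tendsto_order.2 ⟨fun a ha => ?_, fun a ha => ?_⟩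
    · have h1 := (isLUB_pi.1 hLUB') y
      rw [indicator_of_mem hy] at h1
      obtain ⟨_, ⟨f₀, hf₀, rfl⟩, hlt⟩ := (lt_isLUB_iff h1).1 ha
      have : f₀ ∈ range f := hf ▸ mem_insert_of_mem _ hf₀
      obtain ⟨m, rfl⟩ := this
      filter_upwards [eventually_ge_atTop m] with k hk
      refine hlt.trans_le ?_
      rw [huf]
      exact ENNReal.ofReal_le_ofReal (hVu m k hk y)
    · exact Eventually.of_forall fun k => ((hVP k).2.2.2.2 y).trans_lt ha
  have hcon : Continuous fun r : ℝ≥0∞ => r ^ q := ENNReal.continuous_rpow_const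
  have henorm : ∀ k y, ‖V k y‖ₑ = ENNReal.ofReal (V k y) := fun k y =>
    Real.enorm_eq_ofReal ((hVP k).2.2.2.1 y)
  refine lintegral_le_of_tendsto
    (F := fun k x => ENNReal.ofReal (V k (φ x)) ^ q * ‖G x i j * w x‖ₑ ^ q) (fun k => ?_) ?_
    (fun k => ?_) tendsto_const_nhds
  · have h1 : AEMeasurable (fun x => V k (φ x)) (volume.restrict U) :=
      ((hVP k).1.comp_continuousOn hG.cont).aemeasurable hU.measurableSet
    exact (h1.ennreal_ofReal.pow_const _).mul
      (((hG.meas i j).mul hw).enorm.pow_const _).aemeasurable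
  · rw [ae_restrict_iff' hU.measurableSet]
    refine ae_of_all _ fun x hx => ?_
    refine ENNReal.Tendsto.mul_const ((hcon.tendsto _).comp (hlim _ (hφU hx))) (Or.inr ?_)
    finiteness
  · calc ∫⁻ x in U, ENNReal.ofReal (V k (φ x)) ^ q * ‖G x i j * w x‖ₑ ^ q
        = ∫⁻ x in U, ‖V k (φ x) * G x i j * w x‖ₑ ^ q := by
          congr 1
          funext x
          rw [mul_assoc, enorm_mul (V k (φ x)), ENNReal.mul_rpow_of_nonneg _ _ hq0, henorm]
      _ ≤ 2 ^ q * C * (∫⁻ y, ‖V k y‖ₑ ^ p) ^ (q / p) :=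
          h.key_compactSupport hC hG hU hq hp hw (hVP k).1 (hVP k).2.1 (hVP k).2.2.1 i j
      _ ≤ _ := by
          refine mul_le_mul_right (ENNReal.rpow_le_rpow ?_ (by positivity)) _
          rw [← lintegral_indicator hU'.measurableSet]
          refine lintegral_mono fun y => ?_
          rw [henorm]
          by_cases hy : y ∈ U'
          · rw [indicator_of_mem hy]
            exact ENNReal.rpow_le_rpow ((hVP k).2.2.2.2 y) hp.le
          · rw [image_eq_zero_of_notMem_tsupport fun hh => hy ((hVP k).2.2.1 hh)]
            simp [hp]

/-- The key inequality for arbitrary measurable functions on the target. -/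
theorem CompTest.key (h : CompTest U U' φ p q w C) (hC : C ≠ ⊤)
    (hG : SobMap U φ G q) (hU : IsOpen U) (hU' : IsOpen U') (hφU : MapsTo φ U U') (hq : 1 ≤ q)
    (hp : 0 < p) (hw : Measurable w) {g : En n → ℝ≥0∞} (hg : Measurable g) (i j : Fin n) :
    ∫⁻ x in U, g (φ x) ^ q * ‖G x i j * w x‖ₑ ^ q ≤
      2 ^ q * C * (∫⁻ y in U', g y ^ p) ^ (q / p) := by
  have hq0 : 0 ≤ q := by linarith
  have hlim : Tendsto (fun k : ℕ => 2 ^ q * C *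
      ((∫⁻ y in U', g y ^ p) + ((k : ℝ≥0∞))⁻¹) ^ (q / p)) atTop
      (nhds (2 ^ q * C * (∫⁻ y in U', g y ^ p) ^ (q / p))) := by
    refine ENNReal.Tendsto.const_mul ?_ (Or.inr (by finiteness))
    refine (ENNReal.continuous_rpow_const.tendsto _).comp ?_
    simpa using ENNReal.tendsto_inv_nat_nhds_zero.const_add (∫⁻ y in U', g y ^ p)
  refine ge_of_tendsto' hlim fun k => ?_
  obtain ⟨H, hH, hHl, hHi⟩ := exists_le_lowerSemicontinuous_lintegral_ge volume
    (U'.indicator fun y => g y ^ p) ((hg.pow_const p).indicator hU'.measurableSet)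
    (ε := ((k : ℝ≥0∞))⁻¹) (by simp)
  rw [lintegral_indicator hU'.measurableSet] at hHi
  have hlsc : LowerSemicontinuous fun y => H y ^ (1 / p) :=
    ENNReal.continuous_rpow_const.comp_lowerSemicontinuous hHl
      (ENNReal.monotone_rpow_of_nonneg (by positivity))
  calc ∫⁻ x in U, g (φ x) ^ q * ‖G x i j * w x‖ₑ ^ q
      ≤ ∫⁻ x in U, (H (φ x) ^ (1 / p)) ^ q * ‖G x i j * w x‖ₑ ^ q := by
        refine setLIntegral_mono' hU.measurableSet fun x hx => ?_
        gcongr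
        have h1 := hH (φ x)
        rw [indicator_of_mem (hφU hx)] at h1
        calc g (φ x) = (g (φ x) ^ p) ^ (1 / p) := by
              rw [← ENNReal.rpow_mul, mul_one_div_cancel hp.ne', ENNReal.rpow_one]
          _ ≤ _ := by gcongr
    _ ≤ 2 ^ q * C * (∫⁻ y in U', (H y ^ (1 / p)) ^ p) ^ (q / p) :=
        h.key_lowerSemicontinuous hC hG hU hU' hφU hq hp hw hlsc i j
    _ ≤ _ := by
        gcongr
        refine le_trans ?_ hHi
        simp_rw [← ENNReal.rpow_mul, one_div_mul_cancel hp.ne', ENNReal.rpow_one]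
        exact setLIntegral_le_lintegral _ _
end Key

section Density
variable {n : ℕ} {U U' : Set (En n)} {φ ψ : En n → En n}

open scoped NNReal in
/-- The image of Lebesgue measure on `U'` under `φ⁻¹` has a finite density. -/
lemma IsHomeoOn.exists_density (hU : IsOpen U) (hU' : IsOpen U') (h : IsHomeoOn U U' φ ψ)
    (hN : LuzinN U φ) (hφm : Measurable φ) (hψm : Measurable ψ) :
    ∃ R : En n → ℝ≥0, Measurable R ∧ (∀ x ∉ U, R x = 0) ∧
      Measure.map ψ (volume.restrict U') = volume.withDensity (fun x => (R x : ℝ≥0∞)) := by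
  obtain ⟨-, -, -, hψU, hinv, hinv'⟩ := h
  set ν := Measure.map ψ (volume.restrict U') with hν
  have hνm : ∀ E, MeasurableSet E → ν E = volume (ψ ⁻¹' E ∩ U') := fun E hE => by
    rw [hν, Measure.map_apply hψm hE, Measure.restrict_apply (hψm hE)]
  have hac : ν ≪ volume := by
    refine Measure.AbsolutelyContinuous.mk fun E hE hE0 => ?_
    rw [hνm E hE]
    refine measure_mono_null ?_ (hN (E ∩ U) inter_subset_right
      (measure_mono_null inter_subset_left hE0))
    exact fun y hy => ⟨ψ y, ⟨hy.1, hψU hy.2⟩, hinv' y hy.2⟩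
  have hfin : ∀ m : ℕ, ν (φ ⁻¹' ball 0 m) ≠ ⊤ := fun m => by
    rw [hνm _ (hφm measurableSet_ball)]
    refine ((measure_mono ?_).trans_lt (measure_ball_lt_top (x := (0 : En n)) (r := m))).ne
    intro y hy
    have h1 : φ (ψ y) ∈ ball (0 : En n) m := hy.1
    rwa [hinv' y hy.2] at h1
  have hUν : ν.restrict U = ν := by
    refine Measure.restrict_eq_self_of_ae_mem ?_
    refine (ae_map_iff hψm.aemeasurable hU.measurableSet).2 ?_
    rw [ae_restrict_iff' hU'.measurableSet]
    exact ae_of_all _ fun y hy => hψU hy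
  set r := ν.rnDeriv volume with hr
  have hrm : Measurable r := Measure.measurable_rnDeriv _ _
  have hνr : volume.withDensity r = ν := Measure.withDensity_rnDeriv_eq _ _ hac
  have hrt : ∀ᵐ x, r x < ⊤ := by
    have h1 : ∀ m : ℕ, ∀ᵐ x, x ∈ φ ⁻¹' ball 0 m → r x < ⊤ := fun m => by
      rw [← ae_restrict_iff' (hφm measurableSet_ball)]
      refine ae_lt_top hrm ?_
      rw [← withDensity_apply _ (hφm measurableSet_ball), hνr]
      exact hfin m
    filter_upwards [ae_all_iff.2 h1] with x hx
    obtain ⟨m, hm⟩ := exists_nat_gt ‖φ x‖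
    exact hx m (by simpa using hm)
  refine ⟨U.indicator fun x => (r x).toNNReal, hrm.ennreal_toNNReal.indicator hU.measurableSet,
    fun x hx => indicator_of_notMem hx _, ?_⟩
  have h2 : (fun x => ((U.indicator (fun x => (r x).toNNReal) x : ℝ≥0) : ℝ≥0∞)) =ᵐ[volume]
      U.indicator r := by
    filter_upwards [hrt] with x hx
    by_cases hxU : x ∈ U
    · rw [indicator_of_mem hxU, indicator_of_mem hxU, ENNReal.coe_toNNReal hx.ne]
    · rw [indicator_of_notMem hxU, indicator_of_notMem hxU, ENNReal.coe_zero]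
  rw [withDensity_congr_ae h2, withDensity_indicator hU.measurableSet, ← restrict_withDensity
    hU.measurableSet, hνr, hUν]

variable {p q : ℝ} {w : En n → ℝ} {C : ℝ≥0∞} {G : En n → Matrix (Fin n) (Fin n) ℝ}

open scoped NNReal in
/-- The key inequality expressed on the source domain. -/
lemma CompTest.key_source (h : CompTest U U' φ p q w C) (hC : C ≠ ⊤)
    (hG : SobMap U φ G q) (hU : IsOpen U) (hU' : IsOpen U') (hφ : IsHomeoOn U U' φ ψ) (hq : 1 ≤ q)
    (hp : 0 < p) (hw : Measurable w) (hψm : Measurable ψ) {R : En n → ℝ≥0} (hRm : Measurable R)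
    (hR : Measure.map ψ (volume.restrict U') = volume.withDensity (fun x => (R x : ℝ≥0∞)))
    {g : En n → ℝ≥0∞} (hg : Measurable g) (i j : Fin n) :
    ∫⁻ x in U, g x ^ q * ‖G x i j * w x‖ₑ ^ q ≤
      2 ^ q * C * (∫⁻ x, R x * g x ^ p) ^ (q / p) := by
  have h1 := h.key hC hG hU hU' hφ.2.2.1 hq hp hw (hg.comp hψm) i j
  have h2 : ∫⁻ x, R x * g x ^ p = ∫⁻ y in U', (g ∘ ψ) y ^ p := by
    have := lintegral_map (μ := volume.restrict U') (hg.pow_const p) hψm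
    rw [hR, lintegral_withDensity_eq_lintegral_mul _ hRm.coe_nnreal_ennreal (hg.pow_const p)]
      at this
    exact this
  rw [h2]
  refine le_trans (le_of_eq (setLIntegral_congr_fun hU.measurableSet fun x hx => ?_)) h1
  simp only [Function.comp, hφ.2.2.2.2.1 x hx]

open scoped NNReal in
lemma CompTest.eq_zero_of_density (h : CompTest U U' φ p q w C) (hC : C ≠ ⊤)
    (hG : SobMap U φ G q) (hU : IsOpen U) (hU' : IsOpen U') (hφ : IsHomeoOn U U' φ ψ) (hq : 1 ≤ q)
    (hp : 0 < p) (hw : Measurable w) (hw0 : ∀ x ∈ U, 0 < w x) (hψm : Measurable ψ)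
    {R : En n → ℝ≥0} (hRm : Measurable R)
    (hR : Measure.map ψ (volume.restrict U') = volume.withDensity (fun x => (R x : ℝ≥0∞))) :
    ∀ᵐ x, x ∈ U → R x = 0 → G x = 0 := by
  have hZ : MeasurableSet {x | R x = 0} := hRm (measurableSet_singleton 0)
  have key : ∀ i j, ∀ᵐ x, x ∈ U → R x = 0 → G x i j = 0 := by
    intro i j
    have h1 := h.key_source hC hG hU hU' hφ hq hp hw hψm hRm hR
      (g := {x | R x = 0}.indicator 1) (measurable_one.indicator hZ) i j
    have h2 : ∀ x, (R x : ℝ≥0∞) * ({x | R x = 0}.indicator 1 x : ℝ≥0∞) ^ p = 0 := by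
      intro x
      by_cases hx : R x = 0
      · simp [hx]
      · rw [indicator_of_notMem (show x ∉ {x | R x = 0} from hx), ENNReal.zero_rpow_of_pos hp,
          mul_zero]
    have hqp : 0 < q / p := by positivity
    simp only [h2, lintegral_zero, ENNReal.zero_rpow_of_pos hqp, mul_zero, nonpos_iff_eq_zero] at h1
    have hm : Measurable fun x => ({x | R x = 0}.indicator 1 x : ℝ≥0∞) ^ q *
        ‖G x i j * w x‖ₑ ^ q :=
      ((measurable_one.indicator hZ).pow_const q).mul (((hG.meas i j).mul hw).enorm.pow_const q)
    rw [lintegral_eq_zero_iff hm, Filter.EventuallyEq, ae_restrict_iff' hU.measurableSet] at h1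
    filter_upwards [h1] with x hx hxU hx0
    have h3 := hx hxU
    rw [indicator_of_mem (show x ∈ {x | R x = 0} from hx0)] at h3
    have hq0 : 0 < q := by linarith
    have h4 : ‖G x i j * w x‖ₑ = 0 := by
      simpa [hq0, hq0.not_gt] using h3
    rw [enorm_eq_zero, mul_eq_zero] at h4
    exact h4.resolve_right (hw0 x hxU).ne'
  filter_upwards [ae_all_iff.2 fun i => ae_all_iff.2 fun j => key i j] with x hx hxU hx0
  ext i j
  exact hx i j hxU hx0
end Density

section DualNorm
variable {n : ℕ} {U U' : Set (En n)} {φ ψ : En n → En n}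
  {p q : ℝ} {w : En n → ℝ} {C : ℝ≥0∞} {G : En n → Matrix (Fin n) (Fin n) ℝ}

/-- The density of the dual gradient on the source domain, before dividing by the Jacobian. -/
def dualGrad {n : ℕ} (G : En n → Matrix (Fin n) (Fin n) ℝ) (gf : Fin n → En n → ℝ) (i : Fin n)
    (x : En n) : ℝ :=
  ∑ j, gf j x * (G x).adjugate j i

lemma measurable_dualGrad (hG : ∀ i j, Measurable fun x => G x i j) {gf : Fin n → En n → ℝ}
    (hgf : ∀ j, Measurable (gf j)) (i : Fin n) : Measurable (dualGrad G gf i) :=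
  Finset.measurable_fun_sum _ fun j _ => (hgf j).mul (measurable_adjugate hG j i)

lemma enorm_dualGrad_le (gf : Fin n → En n → ℝ) (i : Fin n) (x : En n) :
    ‖dualGrad G gf i x‖ₑ ≤ (n - 1).factorial *
      ((∑ j, ‖gf j x‖ₑ) * ∑ a, ∑ b, ‖G x a b‖ₑ ^ (n - 1)) := by
  have h1 : ∀ j, ‖(G x).adjugate j i‖ₑ ≤ (n - 1).factorial * ∑ a, ∑ b, ‖G x a b‖ₑ ^ (n - 1) := by
    intro j
    have h2 := ENNReal.ofReal_le_ofReal (abs_adjugate_le (G x) j i)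
    rw [← Real.enorm_eq_ofReal_abs, ENNReal.ofReal_mul (by positivity), ENNReal.ofReal_natCast,
      powS, ENNReal.ofReal_sum_of_nonneg fun _ _ => by positivity] at h2
    refine h2.trans (le_of_eq ?_)
    congr 1
    refine Finset.sum_congr rfl fun a _ => ?_
    rw [ENNReal.ofReal_sum_of_nonneg fun _ _ => by positivity]
    refine Finset.sum_congr rfl fun b _ => ?_
    rw [ENNReal.ofReal_pow (abs_nonneg _), ← Real.enorm_eq_ofReal_abs]
  calc ‖dualGrad G gf i x‖ₑ ≤ ∑ j, ‖gf j x * (G x).adjugate j i‖ₑ := enorm_sum_le _ _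
    _ ≤ ∑ j, ‖gf j x‖ₑ * ((n - 1).factorial * ∑ a, ∑ b, ‖G x a b‖ₑ ^ (n - 1)) := by
        refine Finset.sum_le_sum fun j _ => ?_
        rw [enorm_mul]
        exact mul_le_mul_right (h1 j) _
    _ = _ := by
        rw [← Finset.sum_mul]
        ring

open scoped NNReal in
lemma lintegral_holder_step (hn : 2 ≤ n) (hq : (n : ℝ) - 1 < q) (hp : (n : ℝ) - 1 < p)
    (hw : Measurable w) (hU : IsOpen U) (hw0 : ∀ x ∈ U, 0 < w x)
    (hGm : ∀ i j, Measurable fun x => G x i j) {B : ℝ≥0∞} {R : En n → ℝ≥0}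
    (hkey : ∀ g : En n → ℝ≥0∞, Measurable g → ∀ i j,
      ∫⁻ x in U, g x ^ q * ‖G x i j * w x‖ₑ ^ q ≤ B * (∫⁻ x, R x * g x ^ p) ^ (q / p))
    {A s : En n → ℝ≥0∞} (hA : Measurable A) (hs : Measurable s) (a b : Fin n) :
    ∫⁻ x in U, s x ^ (p / (p - n + 1) - 1) * (A x * ‖G x a b‖ₑ ^ (n - 1)) ≤
      (∫⁻ x in U, (A x * ENNReal.ofReal (w x) ^ (1 - (n : ℝ))) ^ (q / (q - n + 1))) ^
        (1 / (q / (q - n + 1))) *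
      (B ^ (((n : ℝ) - 1) / q) *
        (∫⁻ x, R x * s x ^ (p / (p - n + 1))) ^ (((n : ℝ) - 1) / p)) := by
  have hn' : (1 : ℝ) ≤ (n : ℝ) - 1 := by
    have : (2 : ℝ) ≤ n := by exact_mod_cast hn
    linarith
  have hq1 : 0 < q - n + 1 := by linarith
  have hp1 : 0 < p - n + 1 := by linarith
  have hq0 : 0 < q := by linarith
  have hp0 : 0 < p := by linarith
  have hpt : p / (p - n + 1) - 1 = (n - 1) / (p - n + 1) := by
    field_simp
    ring
  set t := p / (p - n + 1) - 1 with ht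
  have ht0 : 0 ≤ t := by rw [hpt]; positivity
  have hcast : ((n - 1 : ℕ) : ℝ) = (n : ℝ) - 1 := by
    rw [Nat.cast_sub (by omega), Nat.cast_one]
  have hconj : (q / (q - n + 1)).HolderConjugate (q / ((n : ℝ) - 1)) := by
    rw [Real.holderConjugate_iff]
    refine ⟨?_, ?_⟩
    · rw [lt_div_iff₀ hq1]
      linarith
    · rw [inv_div, inv_div]
      field_simp
      ring
  calc ∫⁻ x in U, s x ^ t * (A x * ‖G x a b‖ₑ ^ (n - 1))
      = ∫⁻ x in U, ((fun x => A x * ENNReal.ofReal (w x) ^ (1 - (n : ℝ))) *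
          fun x => s x ^ t * ‖G x a b * w x‖ₑ ^ ((n : ℝ) - 1)) x := by
        refine setLIntegral_congr_fun hU.measurableSet fun x hx => ?_
        simp only [Pi.mul_apply]
        have hw1 : ENNReal.ofReal (w x) ≠ 0 := by simpa using hw0 x hx
        have h1 : ENNReal.ofReal (w x) ^ (1 - (n : ℝ)) * ENNReal.ofReal (w x) ^ ((n : ℝ) - 1) = 1 := by
          rw [← ENNReal.rpow_add _ _ hw1 ENNReal.ofReal_ne_top]
          norm_num
        rw [enorm_mul, Real.enorm_eq_ofReal (hw0 x hx).le,
          ENNReal.mul_rpow_of_nonneg _ _ (by linarith), ← hcast, ENNReal.rpow_natCast, hcast]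
        calc s x ^ t * (A x * ‖G x a b‖ₑ ^ (n - 1))
            = s x ^ t * (A x * ‖G x a b‖ₑ ^ (n - 1)) *
              (ENNReal.ofReal (w x) ^ (1 - (n : ℝ)) * ENNReal.ofReal (w x) ^ ((n : ℝ) - 1)) := by
              rw [h1, mul_one]
          _ = _ := by
              rw [← hcast, ENNReal.rpow_natCast]
              ring
    _ ≤ _ := ENNReal.lintegral_mul_le_Lp_mul_Lq _ hconj
        (hA.mul (hw.ennreal_ofReal.pow_const _)).aemeasurable
        ((hs.pow_const _).mul (((hGm a b).mul hw).enorm.pow_const _)).aemeasurable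
    _ ≤ _ := by
        refine mul_le_mul_right ?_ _
        have h2 := hkey (fun x => s x ^ (t / ((n : ℝ) - 1))) (hs.pow_const _) a b
        have h3 : t / ((n : ℝ) - 1) * p = p / (p - n + 1) := by
          rw [hpt]
          field_simp
        have h4 : ∀ x, (s x ^ t * ‖G x a b * w x‖ₑ ^ ((n : ℝ) - 1)) ^ (q / ((n : ℝ) - 1)) =
            (s x ^ (t / ((n : ℝ) - 1))) ^ q * ‖G x a b * w x‖ₑ ^ q := by
          intro x
          rw [ENNReal.mul_rpow_of_nonneg _ _ (by positivity), ← ENNReal.rpow_mul,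
            ← ENNReal.rpow_mul, ← ENNReal.rpow_mul]
          congr 2
          · field_simp
          · field_simp
        simp only [← ENNReal.rpow_mul, h3] at h2
        simp only [h4, ← ENNReal.rpow_mul]
        calc _ ≤ (B * (∫⁻ x, R x * s x ^ (p / (p - n + 1))) ^ (q / p)) ^ (1 / (q / ((n : ℝ) - 1))) :=
              ENNReal.rpow_le_rpow h2 (by positivity)
          _ = _ := by
              rw [ENNReal.mul_rpow_of_nonneg _ _ (by positivity), ← ENNReal.rpow_mul]
              congr 2
              · field_simp
              · field_simp

lemma le_of_le_mul_rpow {X D : ℝ≥0∞} {s t : ℝ} (hX : X ≠ ⊤) (hs : 0 < s)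
    (hst : 1 / s + t = 1) (h : X ≤ D * X ^ t) : X ≤ D ^ s := by
  rcases eq_or_ne X 0 with rfl | hX0
  · exact bot_le
  have h1 : X ^ (1 / s) ≤ D := by
    have h2 : X ^ (1 / s) * X ^ t ≤ D * X ^ t := by
      rwa [← ENNReal.rpow_add _ _ hX0 hX, hst, ENNReal.rpow_one]
    exact (ENNReal.mul_le_mul_iff_left (by simp [hX0, hX]) (by simp [hX0, hX])).1 h2
  calc X = (X ^ (1 / s)) ^ s := by
        rw [← ENNReal.rpow_mul, one_div_mul_cancel hs.ne', ENNReal.rpow_one]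
    _ ≤ _ := ENNReal.rpow_le_rpow h1 hs.le

open scoped NNReal in
lemma lintegral_dualGrad_le (hn : 2 ≤ n) (hq : (n : ℝ) - 1 < q) (hp : (n : ℝ) - 1 < p)
    (hw : Measurable w) (hU : IsOpen U) (hw0 : ∀ x ∈ U, 0 < w x)
    (hGm : ∀ i j, Measurable fun x => G x i j) {B : ℝ≥0∞} {R : En n → ℝ≥0} (hRm : Measurable R)
    (hR0 : ∀ x ∉ U, R x = 0)
    (hkey : ∀ g : En n → ℝ≥0∞, Measurable g → ∀ i j,
      ∫⁻ x in U, g x ^ q * ‖G x i j * w x‖ₑ ^ q ≤ B * (∫⁻ x, R x * g x ^ p) ^ (q / p))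
    {E : ℕ → Set (En n)} (hE : ∀ m, MeasurableSet (E m)) (hEm : Monotone E)
    (hEU : ∀ x, ∃ m, x ∈ E m) (hEf : ∀ m, ∫⁻ x in E m, R x ≠ ⊤)
    {gf : Fin n → En n → ℝ} (hgf : ∀ j, Measurable (gf j)) (i : Fin n) :
    ∫⁻ x, R x * ‖dualGrad G gf i x / R x‖ₑ ^ (p / (p - n + 1)) ≤
      (((n - 1).factorial * ((n : ℝ≥0∞) * n)) * B ^ (((n : ℝ) - 1) / q) *
      (∫⁻ x in U, ((∑ j, ‖gf j x‖ₑ) * ENNReal.ofReal (w x) ^ (1 - (n : ℝ))) ^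
        (q / (q - n + 1))) ^ (1 / (q / (q - n + 1)))) ^ (p / (p - n + 1)) := by
  have hn' : (1 : ℝ) ≤ (n : ℝ) - 1 := by
    have : (2 : ℝ) ≤ n := by exact_mod_cast hn
    linarith
  have hp1 : 0 < p - n + 1 := by linarith
  have hp0 : 0 < p := by linarith
  set pt := p / (p - n + 1) with hpt
  have hpt0 : 0 < pt := by positivity
  have hpt1 : 0 ≤ pt - 1 := by
    have : pt - 1 = (n - 1) / (p - n + 1) := by
      rw [hpt]
      field_simp
      ring
    rw [this]
    positivity
  set S : En n → ℝ≥0∞ := fun x => ‖dualGrad G gf i x / R x‖ₑ with hS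
  have hSm : Measurable S :=
    ((measurable_dualGrad hGm hgf i).div hRm.coe_nnreal_real).enorm
  set s : ℕ → En n → ℝ≥0∞ := fun m => (E m).indicator fun x => min (S x) m with hs
  have hsm : ∀ m, Measurable (s m) := fun m => (hSm.min measurable_const).indicator (hE m)
  have hsS : ∀ m x, s m x ≤ S x := fun m x =>
    indicator_le' (fun _ _ => min_le_left _ _) (fun _ _ => bot_le) x
  have hbound : ∀ m, ∫⁻ x, R x * s m x ^ pt ≤
      (((n - 1).factorial * ((n : ℝ≥0∞) * n)) * B ^ (((n : ℝ) - 1) / q) *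
      (∫⁻ x in U, ((∑ j, ‖gf j x‖ₑ) * ENNReal.ofReal (w x) ^ (1 - (n : ℝ))) ^
        (q / (q - n + 1))) ^ (1 / (q / (q - n + 1)))) ^ pt := by
    intro m
    refine le_of_le_mul_rpow (t := ((n : ℝ) - 1) / p) ?_ hpt0 ?_ ?_
    · have h1 : ∀ x, (R x : ℝ≥0∞) * s m x ^ pt ≤ (E m).indicator (fun x => R x * (m : ℝ≥0∞) ^ pt) x := by
        intro x
        by_cases hx : x ∈ E m
        · rw [hs, indicator_of_mem hx]
          simp only [indicator_of_mem hx]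
          gcongr
          exact min_le_right _ _
        · rw [hs, indicator_of_notMem hx]
          simp only [indicator_of_notMem hx, ENNReal.zero_rpow_of_pos hpt0, mul_zero, le_refl]
      refine ((lintegral_mono h1).trans_lt ?_).ne
      rw [lintegral_indicator (hE m), lintegral_mul_const _ hRm.coe_nnreal_ennreal]
      exact ENNReal.mul_lt_top (hEf m).lt_top (by finiteness)
    · rw [hpt]
      field_simp
      ring
    · set A : En n → ℝ≥0∞ := fun x => ∑ j, ‖gf j x‖ₑ with hA
      have hAm : Measurable A := Finset.measurable_fun_sum _ fun j _ => (hgf j).enorm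
      have hpoint : ∀ x, (R x : ℝ≥0∞) * s m x ^ pt ≤ U.indicator (fun x => (n - 1).factorial *
          ∑ a, ∑ b, s m x ^ (pt - 1) * (A x * ‖G x a b‖ₑ ^ (n - 1))) x := by
        intro x
        by_cases hRx : R x = 0
        · simp [hRx]
        have hxU : x ∈ U := by
          by_contra hxU
          exact hRx (hR0 x hxU)
        rw [indicator_of_mem hxU]
        calc (R x : ℝ≥0∞) * s m x ^ pt = s m x ^ (pt - 1) * (s m x * R x) := by
              rw [← mul_assoc, mul_comm (R x : ℝ≥0∞)]
              congr 1
              conv_rhs => rw [← ENNReal.rpow_one (s m x), ← ENNReal.rpow_mul, one_mul]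
              rw [← ENNReal.rpow_add_of_nonneg _ _ hpt1 zero_le_one, sub_add_cancel]
          _ ≤ s m x ^ (pt - 1) * (S x * R x) := by
              gcongr
              exact hsS m x
          _ = s m x ^ (pt - 1) * ‖dualGrad G gf i x‖ₑ := by
              have h2 : S x * R x = ‖dualGrad G gf i x / R x * R x‖ₑ := by
                rw [enorm_mul]
                congr 1
                simp
              rw [h2, div_mul_cancel₀ _ (by exact_mod_cast hRx)]
          _ ≤ s m x ^ (pt - 1) * ((n - 1).factorial *
              (A x * ∑ a, ∑ b, ‖G x a b‖ₑ ^ (n - 1))) :=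
              mul_le_mul_right (enorm_dualGrad_le gf i x) _
          _ = _ := by
              simp only [Finset.mul_sum]
              refine Finset.sum_congr rfl fun a _ => Finset.sum_congr rfl fun b _ => ?_
              ring
      have hterm : ∀ a b, Measurable fun x => s m x ^ (pt - 1) * (A x * ‖G x a b‖ₑ ^ (n - 1)) :=
        fun a b => ((hsm m).pow_const _).mul (hAm.mul ((hGm a b).enorm.pow_const _))
      calc ∫⁻ x, R x * s m x ^ pt ≤ ∫⁻ x in U, (n - 1).factorial *
            ∑ a, ∑ b, s m x ^ (pt - 1) * (A x * ‖G x a b‖ₑ ^ (n - 1)) := by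
            rw [← lintegral_indicator hU.measurableSet]
            exact lintegral_mono hpoint
        _ = (n - 1).factorial *
            ∑ a, ∑ b, ∫⁻ x in U, s m x ^ (pt - 1) * (A x * ‖G x a b‖ₑ ^ (n - 1)) := by
            rw [lintegral_const_mul _ (Finset.measurable_fun_sum _ fun a _ =>
              Finset.measurable_fun_sum _ fun b _ => hterm a b),
              lintegral_finsetSum _ fun a _ => Finset.measurable_fun_sum _ fun b _ => hterm a b]
            congr 1
            refine Finset.sum_congr rfl fun a _ => ?_
            rw [lintegral_finsetSum _ fun b _ => hterm a b]
        _ ≤ (n - 1).factorial * ∑ a : Fin n, ∑ b : Fin n, _ :=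
            mul_le_mul_right (Finset.sum_le_sum fun a _ => Finset.sum_le_sum fun b _ =>
              lintegral_holder_step hn hq hp hw hU hw0 hGm hkey hAm (hsm m) a b) _
        _ = _ := by
            simp only [Finset.sum_const, Finset.card_univ, Fintype.card_fin, nsmul_eq_mul]
            ring
  refine lintegral_le_of_tendsto (F := fun m x => R x * s m x ^ pt) (fun m => ?_)
    (ae_of_all _ fun x => ?_) hbound tendsto_const_nhds
  · exact (hRm.coe_nnreal_ennreal.mul ((hsm m).pow_const _)).aemeasurable
  · refine tendsto_const_nhds.congr' ?_
    obtain ⟨m₀, hm₀⟩ := hEU x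
    obtain ⟨m₁, hm₁⟩ := ENNReal.exists_nat_gt (r := S x) enorm_ne_top
    filter_upwards [eventually_ge_atTop m₀, eventually_ge_atTop m₁] with m h0 h1
    have h2 : S x ≤ m := hm₁.le.trans (by exact_mod_cast h1)
    rw [hs]
    simp only [indicator_of_mem (hEm h0 hm₀), min_eq_left h2]
    rfl
end DualNorm

section SobolevDegree
variable {n : ℕ} {U U' : Set (En n)} {φ ψ : En n → En n}
  {q : ℝ} {G : En n → Matrix (Fin n) (Fin n) ℝ}

lemma tendsto_integral_mul_of_eLpNorm {μ : Measure (En n)} {r s : ℝ≥0∞} [HolderTriple s r 1]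
    {a : En n → ℝ} (ha : MemLp a s μ) {P : ℕ → En n → ℝ} {P₀ : En n → ℝ}
    (hP : ∀ k, MemLp (P k) r μ) (hP₀ : MemLp P₀ r μ)
    (hlim : Tendsto (fun k => eLpNorm (P k - P₀) r μ) atTop (nhds 0)) :
    Tendsto (fun k => ∫ x, a x * P k x ∂μ) atTop (nhds (∫ x, a x * P₀ x ∂μ)) := by
  refine tendsto_integral_of_L1' (fun x => a x * P₀ x) ((hP₀.mul ha :
    MemLp (fun x => a x * P₀ x) 1 μ).aestronglyMeasurable)
    (Eventually.of_forall fun k => memLp_one_iff_integrable.1 ((hP k).mul ha :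
      MemLp (fun x => a x * P k x) 1 μ)) ?_
  have hb : ∀ k, eLpNorm ((fun x => a x * P k x) - fun x => a x * P₀ x) 1 μ ≤
      eLpNorm a s μ * eLpNorm (P k - P₀) r μ := by
    intro k
    have h1 : ((fun x => a x * P k x) - fun x => a x * P₀ x) = a • (P k - P₀) := by
      funext x
      simp only [Pi.sub_apply, Pi.smul_apply', smul_eq_mul]
      ring
    rw [h1]
    exact eLpNorm_smul_le_mul_eLpNorm ((hP k).sub hP₀).aestronglyMeasurable ha.aestronglyMeasurable
  refine tendsto_of_tendsto_of_tendsto_of_le_of_le tendsto_const_nhds ?_ (fun _ => bot_le) hb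
  simpa using ENNReal.Tendsto.const_mul hlim (Or.inr ha.eLpNorm_ne_top)

lemma SobMap.memLp_adjugate (hG : SobMap U φ G q) (hn : 2 ≤ n)
    {K : Set (En n)} (hKU : K ⊆ U) (hK : IsCompact K) (i j : Fin n) :
    MemLp (fun x => (G x).adjugate i j) (ENNReal.ofReal (q / ((n : ℝ) - 1)))
      (volume.restrict K) := by
  have hn' : (1 : ℝ) ≤ (n : ℝ) - 1 := by
    have : (2 : ℝ) ≤ n := by exact_mod_cast hn
    linarith
  have hcast : ((n - 1 : ℕ) : ℝ) = (n : ℝ) - 1 := by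
    rw [Nat.cast_sub (by omega), Nat.cast_one]
  have h1 : MemLp (fun x => powS (G x)) (ENNReal.ofReal (q / ((n : ℝ) - 1)))
      (volume.restrict K) := by
    refine memLp_finsetSum _ fun a _ => memLp_finsetSum _ fun b _ => ?_
    have h2 := (hG.memLp K hKU hK a b).norm_rpow_div (ENNReal.ofReal ((n : ℝ) - 1))
    rw [ENNReal.toReal_ofReal (by linarith), ← ENNReal.ofReal_div_of_pos (by linarith)] at h2
    simpa only [← hcast, Real.rpow_natCast, Real.norm_eq_abs] using h2
  refine h1.of_le_mul (c := (n - 1).factorial)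
    (measurable_adjugate hG.meas i j).aestronglyMeasurable (ae_of_all _ fun x => ?_)
  rw [Real.norm_eq_abs, Real.norm_eq_abs, abs_of_nonneg (powS_nonneg _)]
  exact abs_adjugate_le _ _ _

/-- The degree formula for a continuous Sobolev function in place of a test function. -/
theorem SobMap.degree_formula (hG : SobMap U φ G q) (hn : 2 ≤ n) (hq : (n : ℝ) - 1 < q)
    (hU : IsOpen U) (hφ : IsHomeoOn U U' φ ψ) (hψm : Measurable ψ) {c : ℝ}
    (hc : ∀ f η : En n → ℝ, IsTest U f → IsTest U' η → ∀ i,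
      ∫ x in tsupport f, η (φ x) * ∑ j, pd j f x * (G x).adjugate j i =
        -(c * ∫ y, f (ψ y) * pd i η y))
    {f : En n → ℝ} (hf : ContinuousOn f U) {gf : Fin n → En n → ℝ} (hgm : ∀ j, Measurable (gf j))
    (hg : ∀ K ⊆ U, IsCompact K → ∀ j,
      MemLp (gf j) (ENNReal.ofReal (q / (q - n + 1))) (volume.restrict K))
    (hw : ∀ j, IsWeakPd U j f (gf j)) {η : En n → ℝ} (hη : IsTest U' η) (i : Fin n) :
    ∫ x in U, η (φ x) * dualGrad G gf i x = -(c * ∫ y, f (ψ y) * pd i η y) := by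
  have hn' : (1 : ℝ) ≤ (n : ℝ) - 1 := by
    have : (2 : ℝ) ≤ n := by exact_mod_cast hn
    linarith
  have hq1 : 0 < q - n + 1 := by linarith
  have hq0 : 0 < q := by linarith
  have hqt : 1 ≤ q / (q - n + 1) := by
    rw [le_div_iff₀ hq1]
    linarith
  have hconj : (q / ((n : ℝ) - 1)).HolderConjugate (q / (q - n + 1)) := by
    rw [Real.holderConjugate_iff]
    refine ⟨?_, ?_⟩
    · rw [lt_div_iff₀ (by linarith)]
      linarith
    · rw [inv_div, inv_div]
      field_simp
      ring
  have hr1 : 1 ≤ ENNReal.ofReal (q / (q - n + 1)) := by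
    simpa using ENNReal.ofReal_le_ofReal hqt
  have : HolderTriple (ENNReal.ofReal (q / ((n : ℝ) - 1))) (ENNReal.ofReal (q / (q - n + 1))) 1 :=
    hconj.ennrealOfReal
  have hgl : ∀ j, LocallyIntegrableOn (gf j) U := fun j =>
    locallyIntegrableOn_of_memLp hU hr1 fun K hKU hK => hg K hKU hK j
  set K := ψ '' tsupport η with hKdef
  have hK : IsCompact K := hη.2.1.isCompact.image_of_continuousOn (hφ.2.1.mono hη.2.2)
  have hKU : K ⊆ U := by
    rintro _ ⟨y, hy, rfl⟩
    exact hφ.2.2.2.1 (hη.2.2 hy)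
  have hout : ∀ x ∈ U \ K, η (φ x) = 0 := by
    rintro x ⟨hxU, hxK⟩
    refine image_eq_zero_of_notMem_tsupport fun hh => hxK ⟨φ x, hh, hφ.2.2.2.2.1 x hxU⟩
  obtain ⟨χ, hχ, hχb, W, hW, hKW, hχ1⟩ := exists_cutoff hK hU hKU
  set u : En n → ℝ := fun x => χ x * f x with hu
  have huc : Continuous u := continuous_mul_of_tsupport hU hf hχ.continuous hχ.2.2
  have hus : tsupport u ⊆ tsupport χ := closure_mono (Function.support_mul_subset_left _ _)
  set gu : Fin n → En n → ℝ := fun j x => χ x * gf j x + pd j χ x * f x with hgu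
  have hgum : ∀ j, MemLp (gu j) (ENNReal.ofReal (q / (q - n + 1))) := fun j =>
    memLp_mul_add hU hf (fun K hKU hK => hg K hKU hK j) (hgm j) hχ
  have hguw : ∀ j, IsWeakPd univ j u (gu j) := fun j =>
    isWeakPd_mul_test hU hf (hgl j) (hw j) hχ
  have huC : HasCompactSupport u := hχ.2.1.of_isClosed_subset (isClosed_tsupport _) hus
  have hepos : ∀ k : ℕ, 0 < 1 / ((k : ℝ) + 1) := fun k => by positivity
  choose v hv hvu hvg using fun k : ℕ => exists_smooth_approx hU huc huC (hus.trans hχ.2.2)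
    hr1 ENNReal.ofReal_ne_top hgum hguw (hepos k)
  have heps : Tendsto (fun k : ℕ => 1 / ((k : ℝ) + 1)) atTop (nhds 0) :=
    tendsto_one_div_add_atTop_nhds_zero_nat
  have hvm : ∀ k j, MemLp (pd j (v k)) (ENNReal.ofReal (q / (q - n + 1))) := fun k j =>
    ((hv k).pd j).continuous.memLp_of_hasCompactSupport ((hv k).pd j).2.1
  have ha : ∀ j, MemLp (fun x => η (φ x) * (G x).adjugate j i)
      (ENNReal.ofReal (q / ((n : ℝ) - 1))) (volume.restrict K) := by
    intro j
    obtain ⟨M, hM⟩ := hη.2.1.exists_bound_of_continuous hη.continuous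
    refine (hG.memLp_adjugate hn hKU hK j i).of_le_mul (c := M) ?_ (ae_of_all _ fun x => ?_)
    · exact ((hη.continuous.comp_continuousOn (hG.cont.mono hKU)).aestronglyMeasurable
        hK.measurableSet).mul (measurable_adjugate hG.meas j i).aestronglyMeasurable
    · rw [norm_mul]
      exact mul_le_mul_of_nonneg_right (hM _) (norm_nonneg _)
  have hintg : ∀ j (P : En n → ℝ), MemLp P (ENNReal.ofReal (q / (q - n + 1))) →
      Integrable (fun x => (η (φ x) * (G x).adjugate j i) * P x) (volume.restrict K) :=
    fun j P hP => memLp_one_iff_integrable.1 ((hP.restrict K).mul (ha j))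
  -- The left-hand side.
  have hL : ∀ k, ∫ x in tsupport (v k), η (φ x) * ∑ j, pd j (v k) x * (G x).adjugate j i =
      ∑ j, ∫ x in K, (η (φ x) * (G x).adjugate j i) * pd j (v k) x := by
    intro k
    rw [← integral_finsetSum _ fun j _ => hintg j _ (hvm k j),
      ← setIntegral_eq_of_subset_of_forall_sdiff_eq_zero hU.measurableSet (hv k).2.2 ?_,
      setIntegral_eq_of_subset_of_forall_sdiff_eq_zero hU.measurableSet hKU ?_]
    · congr 1
      funext x
      rw [Finset.mul_sum]
      refine Finset.sum_congr rfl fun j _ => ?_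
      ring
    · intro x hx
      rw [hout x hx, zero_mul]
    · rintro x ⟨-, hx⟩
      simp [pd_eq_zero_of_notMem hx]
  have hLlim : Tendsto (fun k => ∑ j, ∫ x in K, (η (φ x) * (G x).adjugate j i) * pd j (v k) x) atTop
      (nhds (∑ j, ∫ x in K, (η (φ x) * (G x).adjugate j i) * gu j x)) := by
    refine tendsto_finsetSum _ fun j _ => ?_
    refine tendsto_integral_mul_of_eLpNorm (r := ENNReal.ofReal (q / (q - n + 1))) (ha j)
      (fun k => (hvm k j).restrict _) ((hgum j).restrict _) ?_
    refine tendsto_of_tendsto_of_tendsto_of_le_of_le tendsto_const_nhds ?_ (fun _ => bot_le)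
      fun k => (eLpNorm_mono_measure _ Measure.restrict_le_self).trans (hvg k j)
    simpa using ENNReal.tendsto_ofReal heps
  have hLeq : ∑ j, ∫ x in K, (η (φ x) * (G x).adjugate j i) * gu j x =
      ∫ x in U, η (φ x) * dualGrad G gf i x := by
    rw [← integral_finsetSum _ fun j _ => hintg j _ (hgum j),
      setIntegral_eq_of_subset_of_forall_sdiff_eq_zero hU.measurableSet hKU fun x hx => by
        rw [hout x hx, zero_mul]]
    refine setIntegral_congr_fun hK.measurableSet fun x hx => ?_
    have h1 : ∀ j, gu j x = gf j x := by
      intro j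
      have h2 : χ =ᶠ[nhds x] fun _ => 1 := by
        filter_upwards [hW.mem_nhds (hKW hx)] with z hz using hχ1 z hz
      have h3 : pd j χ x = 0 := by
        rw [pd_congr h2]
        simp [pd]
      simp only [hgu, h3, hχ1 x (hKW hx), one_mul, zero_mul, add_zero]
    simp only [h1, dualGrad, Finset.mul_sum]
    refine Finset.sum_congr rfl fun j _ => ?_
    ring
  -- The right-hand side.
  have hRlim : Tendsto (fun k => -(c * ∫ y, v k (ψ y) * pd i η y)) atTop
      (nhds (-(c * ∫ y, f (ψ y) * pd i η y))) := by
    refine (Tendsto.const_mul c ?_).neg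
    obtain ⟨M, hM⟩ := huC.exists_bound_of_continuous huc
    refine tendsto_integral_of_dominated_convergence (fun y => (M + 1) * ‖pd i η y‖) (fun k => ?_)
      ?_ (fun k => ae_of_all _ fun y => ?_) (ae_of_all _ fun y => ?_)
    · exact (((hv k).continuous.measurable.comp hψm).mul
        (hη.pd i).continuous.measurable).aestronglyMeasurable
    · exact (((hη.pd i).continuous.integrable_of_hasCompactSupport (hη.pd i).2.1).norm.const_mul _)
    · rw [norm_mul]
      refine mul_le_mul_of_nonneg_right ?_ (norm_nonneg _)
      have h1 := hvu k (ψ y)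
      have h2 : 1 / ((k : ℝ) + 1) ≤ 1 := by
        rw [div_le_one (by positivity)]
        linarith [(Nat.cast_nonneg k : (0 : ℝ) ≤ k)]
      calc ‖v k (ψ y)‖ = ‖u (ψ y) + (v k (ψ y) - u (ψ y))‖ := by ring_nf
        _ ≤ ‖u (ψ y)‖ + ‖v k (ψ y) - u (ψ y)‖ := norm_add_le _ _
        _ ≤ M + 1 := add_le_add (hM _) (by rw [Real.norm_eq_abs]; linarith)
    · by_cases hy : y ∈ tsupport η
      · have h1 : f (ψ y) = u (ψ y) := by
          simp only [hu, hχ1 _ (hKW ⟨y, hy, rfl⟩), one_mul]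
        rw [h1]
        refine Tendsto.mul_const _ ?_
        rw [tendsto_iff_dist_tendsto_zero]
        exact squeeze_zero (fun _ => dist_nonneg) (fun k => hvu k (ψ y)) heps
      · simp only [pd_eq_zero_of_notMem hy, mul_zero]
        exact tendsto_const_nhds
  refine tendsto_nhds_unique ?_ hRlim
  rw [← hLeq]
  refine hLlim.congr fun k => ?_
  rw [← hL k, hc (v k) η (hv k) hη i]
end SobolevDegree

section Dual
variable {n : ℕ} {U U' : Set (En n)} {φ ψ : En n → En n}
  {p q : ℝ} {w : En n → ℝ} {C : ℝ≥0∞}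

open scoped NNReal in
/-- Composition duality for measurable representatives of the homeomorphism and its inverse. -/
lemma CompTest.exists_dual_of_measurable (hn : 2 ≤ n) (hq : (n : ℝ) - 1 < q) (hqp : q ≤ p)
    (hU : IsOpen U) (hU' : IsOpen U') (hφ : IsHomeoOn U U' φ ψ) (hφm : Measurable φ)
    (hψm : Measurable ψ) (hconn : IsPreconnected U') (hne : U.Nonempty) (hN : LuzinN U φ)
    (h : CompTest U U' φ p q w C) (hC : C ≠ ⊤) (hw : ContinuousOn w U) (hwm : Measurable w)
    (hw0 : ∀ x ∈ U, 0 < w x) :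
    ∃ K : ℝ≥0∞, K ≠ ⊤ ∧ ∀ (f : En n → ℝ) (gf : Fin n → En n → ℝ), ContinuousOn f U →
      (∀ j, LocallyIntegrableOn (gf j) U) → (∀ j, IsWeakPd U j f (gf j)) →
      ∫⁻ x in U, ((∑ j, ‖gf j x‖ₑ) * ENNReal.ofReal (w x) ^ (1 - (n : ℝ))) ^ (q / (q - n + 1)) ≠ ⊤ →
      ∃ g : Fin n → En n → ℝ, (∀ i, Measurable (g i)) ∧
        (∀ i, IsWeakPd U' i (fun y => f (ψ y)) (g i)) ∧
        ∀ i, ∫⁻ y in U', ‖g i y‖ₑ ^ (p / (p - n + 1)) ≤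
          (K * (∫⁻ x in U, ((∑ j, ‖gf j x‖ₑ) * ENNReal.ofReal (w x) ^ (1 - (n : ℝ))) ^
            (q / (q - n + 1))) ^ (1 / (q / (q - n + 1)))) ^ (p / (p - n + 1)) := by
  have hn' : (1 : ℝ) ≤ (n : ℝ) - 1 := by
    have : (2 : ℝ) ≤ n := by exact_mod_cast hn
    linarith
  have hnp : (n : ℝ) - 1 < p := hq.trans_le hqp
  have hq1 : 1 ≤ q := by linarith
  have hp0 : 0 < p := by linarith
  have hqn : 0 < q - n + 1 := by linarith
  have hpn : 0 < p - n + 1 := by linarith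
  have hqt1 : 1 ≤ q / (q - n + 1) := by
    rw [le_div_iff₀ hqn]
    linarith
  have hqt0 : 0 < q / (q - n + 1) := by linarith
  have hpt0 : 0 < p / (p - n + 1) := by positivity
  have : Nontrivial (Fin n) := Fin.nontrivial_iff_two_le.2 hn
  obtain ⟨G, hG⟩ := h.exists_sobMap hC hU hU' hφ.1 hφ.2.2.1 hq1 hp0 hw hw0
  obtain ⟨Φ, hΦ⟩ := hG.exists_approx hU hn hq.le
  obtain ⟨c, hc0, hc⟩ := hΦ.exists_ne_zero_degree_formula (by omega) hU hU' hφ hconn hne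
  obtain ⟨R, hRm, hR0, hR⟩ := hφ.exists_density hU hU' hN hφm hψm
  have hzero := h.eq_zero_of_density hC hG hU hU' hφ hq1 hp0 hwm hw0 hψm hRm hR
  have hkey : ∀ g : En n → ℝ≥0∞, Measurable g → ∀ i j,
      ∫⁻ x in U, g x ^ q * ‖G x i j * w x‖ₑ ^ q ≤
        2 ^ q * C * (∫⁻ x, R x * g x ^ p) ^ (q / p) :=
    fun g hg i j => h.key_source hC hG hU hU' hφ hq1 hp0 hwm hψm hRm hR hg i j
  refine ⟨‖c⁻¹‖ₑ * (((n - 1).factorial * ((n : ℝ≥0∞) * n)) *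
    (2 ^ q * C) ^ (((n : ℝ) - 1) / q)), ?_, ?_⟩
  · have h1 : (2 ^ q * C : ℝ≥0∞) ^ (((n : ℝ) - 1) / q) ≠ ⊤ :=
      ENNReal.rpow_ne_top_of_nonneg (by positivity) (by finiteness)
    finiteness
  intro f gf₀ hf hgl₀ hw₀ hfin₀
  set gf : Fin n → En n → ℝ := fun j => (hgl₀ j).aestronglyMeasurable.mk _ with hgfdef
  have hgm : ∀ j, Measurable (gf j) := fun j =>
    (hgl₀ j).aestronglyMeasurable.stronglyMeasurable_mk.measurable
  have hgae : ∀ j, gf₀ j =ᵐ[volume.restrict U] gf j := fun j =>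
    (hgl₀ j).aestronglyMeasurable.ae_eq_mk
  have hNeq : ∫⁻ x in U, ((∑ j, ‖gf₀ j x‖ₑ) * ENNReal.ofReal (w x) ^ (1 - (n : ℝ))) ^
      (q / (q - n + 1)) = ∫⁻ x in U, ((∑ j, ‖gf j x‖ₑ) * ENNReal.ofReal (w x) ^ (1 - (n : ℝ))) ^
      (q / (q - n + 1)) := by
    refine lintegral_congr_ae ?_
    filter_upwards [ae_all_iff.2 hgae] with x hx
    simp only [hx]
  rw [hNeq] at hfin₀ ⊢
  have hgw : ∀ j, IsWeakPd U j f (gf j) := fun j =>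
    (hw₀ j).congr_ae hU ((ae_restrict_iff' hU.measurableSet).1 (hgae j))
  have hgl : ∀ j, LocallyIntegrableOn (gf j) U := by
    intro j
    rw [locallyIntegrableOn_iff hU.isLocallyClosed] at *
    intro K hKU hK
    exact ((locallyIntegrableOn_iff hU.isLocallyClosed).1 (hgl₀ j) K hKU hK).congr
      (ae_restrict_of_ae_restrict_of_subset hKU (hgae j))
  have hgL : ∀ K ⊆ U, IsCompact K → ∀ j,
      MemLp (gf j) (ENNReal.ofReal (q / (q - n + 1))) (volume.restrict K) := by
    intro K hKU hK j
    refine memLp_of_weighted (w := fun x => w x ^ (1 - (n : ℝ)))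
      (hw.rpow_const fun x hx => Or.inl (hw0 x hx).ne') (fun x hx => Real.rpow_pos_of_pos (hw0 x hx) _)
      hqt0 (hgl j) (ne_top_of_le_ne_top hfin₀ ?_) hKU hK
    refine setLIntegral_mono' hU.measurableSet fun x hx => ?_
    refine ENNReal.rpow_le_rpow ?_ hqt0.le
    rw [enorm_mul, Real.enorm_eq_ofReal (Real.rpow_nonneg (hw0 x hx).le _),
      ENNReal.ofReal_rpow_of_pos (hw0 x hx)]
    gcongr
    exact Finset.single_le_sum (f := fun j => ‖gf j x‖ₑ) (fun _ _ => bot_le) (Finset.mem_univ j)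
  set S : Fin n → En n → ℝ := fun i x => dualGrad G gf i x / R x with hS
  have hSm : ∀ i, Measurable (S i) := fun i =>
    (measurable_dualGrad hG.meas hgm i).div hRm.coe_nnreal_real
  refine ⟨fun i y => c⁻¹ * S i (ψ y), fun i => ((hSm i).comp hψm).const_mul _, fun i η hη => ?_,
    fun i => ?_⟩
  · have h1 := hG.degree_formula hn hq hU hφ hψm hc hf hgm hgL hgw hη i
    have h2 : ∫ y in U', S i (ψ y) * η y = ∫ x in U, η (φ x) * dualGrad G gf i x := by
      have h3 : ∫ y in U', S i (ψ y) * η y = ∫ y in U', η (φ (ψ y)) * S i (ψ y) := by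
        refine setIntegral_congr_fun hU'.measurableSet fun y hy => ?_
        simp only [hφ.2.2.2.2.2 y hy]
        ring
      have h4 : ∫ x, η (φ x) * S i x ∂(Measure.map ψ (volume.restrict U')) =
          ∫ y in U', η (φ (ψ y)) * S i (ψ y) :=
        integral_map hψm.aemeasurable
          ((hη.continuous.measurable.comp hφm).mul (hSm i)).aestronglyMeasurable
      rw [h3, ← h4, hR, integral_withDensity_eq_integral_smul hRm,
        ← setIntegral_eq_integral_of_forall_compl_eq_zero (s := U) fun x hx => by simp [hR0 x hx]]
      refine setIntegral_congr_ae hU.measurableSet ?_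
      filter_upwards [hzero] with x hx hxU
      rw [NNReal.smul_def, smul_eq_mul]
      by_cases hRx : R x = 0
      · simp [hRx, dualGrad, hx hxU hRx]
      · have hRx' : (R x : ℝ) ≠ 0 := by exact_mod_cast hRx
        simp only [hS]
        field_simp
    rw [setIntegral_mul_test ((hη.pd i).2.2)]
    have h5 : ∫ y in U', c⁻¹ * S i (ψ y) * η y = c⁻¹ * ∫ y in U', S i (ψ y) * η y := by
      rw [← integral_const_mul]
      simp only [mul_assoc]
    rw [h5, h2, h1]
    field_simp
  · have h1 : ∫⁻ y in U', ‖c⁻¹ * S i (ψ y)‖ₑ ^ (p / (p - n + 1)) =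
        ‖c⁻¹‖ₑ ^ (p / (p - n + 1)) * ∫⁻ x, R x * ‖S i x‖ₑ ^ (p / (p - n + 1)) := by
      have h2 := lintegral_map (μ := volume.restrict U')
        ((hSm i).enorm.pow_const (p / (p - n + 1))) hψm
      rw [hR, lintegral_withDensity_eq_lintegral_mul _ hRm.coe_nnreal_ennreal
        ((hSm i).enorm.pow_const _)] at h2
      simp only [Pi.mul_apply] at h2
      have hm : Measurable fun y => ‖S i (ψ y)‖ₑ ^ (p / (p - n + 1)) :=
        ((hSm i).comp hψm).enorm.pow_const _
      rw [h2, ← lintegral_const_mul _ hm]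
      refine lintegral_congr fun y => ?_
      rw [enorm_mul, ENNReal.mul_rpow_of_nonneg _ _ hpt0.le]
    have h3 : ∫⁻ x, R x * ‖S i x‖ₑ ^ (p / (p - n + 1)) ≤ _ :=
      lintegral_dualGrad_le hn hq hnp hwm hU hw0 hG.meas hRm hR0 hkey
        (E := fun m : ℕ => φ ⁻¹' ball 0 m) (fun m => hφm measurableSet_ball)
        (fun a b hab => preimage_mono (ball_subset_ball (by exact_mod_cast hab)))
        (fun x => (exists_nat_gt ‖φ x‖).imp fun m hm => by simpa using hm) (fun m => by
          rw [← withDensity_apply _ (hφm measurableSet_ball), ← hR,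
            Measure.map_apply hψm (hφm measurableSet_ball),
            Measure.restrict_apply (hψm (hφm measurableSet_ball))]
          refine ((measure_mono ?_).trans_lt
            (measure_ball_lt_top (x := (0 : En n)) (r := m))).ne
          intro y hy
          have h1 : φ (ψ y) ∈ ball (0 : En n) m := hy.1
          rwa [hφ.2.2.2.2.2 y hy.2] at h1) hgm i
    rw [h1, mul_assoc ‖c⁻¹‖ₑ, ENNReal.mul_rpow_of_nonneg ‖c⁻¹‖ₑ _ hpt0.le]
    exact mul_le_mul_right h3 _

lemma measurable_indicator_of_continuousOn (hU : IsOpen U) (h : ContinuousOn φ U) :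
    Measurable (U.indicator φ) := by
  classical
  rw [← piecewise_eq_indicator]
  exact h.measurable_piecewise continuousOn_const hU.measurableSet

/-- Composition duality for test-function bounds. -/
theorem CompTest.exists_dual (hn : 2 ≤ n) (hq : (n : ℝ) - 1 < q) (hqp : q ≤ p)
    (hU : IsOpen U) (hU' : IsOpen U') (hφ : IsHomeoOn U U' φ ψ)
    (hconn : IsPreconnected U') (hne : U.Nonempty) (hN : LuzinN U φ)
    (h : CompTest U U' φ p q w C) (hC : C ≠ ⊤) (hw : ContinuousOn w U) (hwm : Measurable w)
    (hw0 : ∀ x ∈ U, 0 < w x) :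
    ∃ K : ℝ≥0∞, K ≠ ⊤ ∧ ∀ (f : En n → ℝ) (gf : Fin n → En n → ℝ), ContinuousOn f U →
      (∀ j, LocallyIntegrableOn (gf j) U) → (∀ j, IsWeakPd U j f (gf j)) →
      ∫⁻ x in U, ((∑ j, ‖gf j x‖ₑ) * ENNReal.ofReal (w x) ^ (1 - (n : ℝ))) ^ (q / (q - n + 1)) ≠ ⊤ →
      ∃ g : Fin n → En n → ℝ, (∀ i, Measurable (g i)) ∧
        (∀ i, IsWeakPd U' i (fun y => f (ψ y)) (g i)) ∧
        ∀ i, ∫⁻ y in U', ‖g i y‖ₑ ^ (p / (p - n + 1)) ≤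
          (K * (∫⁻ x in U, ((∑ j, ‖gf j x‖ₑ) * ENNReal.ofReal (w x) ^ (1 - (n : ℝ))) ^
            (q / (q - n + 1))) ^ (1 / (q / (q - n + 1)))) ^ (p / (p - n + 1)) := by
  have hφe : EqOn (U.indicator φ) φ U := fun x hx => indicator_of_mem hx φ
  have hψe : EqOn (U'.indicator ψ) ψ U' := fun y hy => indicator_of_mem hy ψ
  obtain ⟨hφc, hψc, hφU, hψU, hinv, hinv'⟩ := hφ
  obtain ⟨K, hK, hmain⟩ := CompTest.exists_dual_of_measurable (C := C) (w := w)
    (φ := U.indicator φ) (ψ := U'.indicator ψ) hn hq hqp hU hU'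
    ⟨hφc.congr hφe, hψc.congr hψe, hφU.congr hφe.symm, hψU.congr hψe.symm,
      fun x hx => by rw [hφe hx, hψe (hφU hx), hinv x hx],
      fun y hy => by rw [hψe hy, hφe (hψU hy), hinv' y hy]⟩
    (measurable_indicator_of_continuousOn hU hφc) (measurable_indicator_of_continuousOn hU' hψc)
    hconn hne (fun E hE hE0 => by
      rw [(hφe.mono hE).image_eq]
      exact hN E hE hE0) (fun f hf => by
      obtain ⟨g, hg⟩ := h f hf
      exact ⟨g, fun i => ⟨(hg i).1, (hg i).2.1.congr_left hU fun x hx => by rw [hφe hx],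
        (hg i).2.2⟩⟩) hC hw hwm hw0
  refine ⟨K, hK, fun f gf hf hgl hgw hfin => ?_⟩
  obtain ⟨g, hgm, hgw', hgb⟩ := hmain f gf hf hgl hgw hfin
  exact ⟨g, hgm, fun i => (hgw' i).congr_left hU' fun y hy => by rw [hψe hy], hgb⟩
end Dual

section Puncture
variable {n : ℕ} {U Ω : Set (En n)}

lemma isPreconnected_ball_diff_singleton (hn : 2 ≤ n) (c : En n) {r : ℝ} (hr : 0 < r) :
    IsPreconnected (ball c r \ {c}) := by
  have hrank : 1 < Module.rank ℝ (En n) := by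
    rw [← Module.finrank_eq_rank, finrank_euclideanSpace_fin]
    exact_mod_cast hn
  have h1 : IsPreconnected ({0}ᶜ : Set (En n)) :=
    (isConnected_compl_singleton_of_one_lt_rank hrank 0).isPreconnected
  have h2 := h1.image _ (OpenPartialHomeomorph.continuous_univBall c r).continuousOn
  have hinj := (OpenPartialHomeomorph.univBall c r).injOn
  rw [OpenPartialHomeomorph.univBall_source] at hinj
  have himg := (OpenPartialHomeomorph.univBall c r).image_source_eq_target
  rw [OpenPartialHomeomorph.univBall_source, OpenPartialHomeomorph.univBall_target c hr] at himg
  have heq : OpenPartialHomeomorph.univBall c r '' {0}ᶜ = ball c r \ {c} := by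
    rw [compl_eq_univ_sdiff, image_sdiff (injOn_univ.1 hinj), himg, image_singleton,
      OpenPartialHomeomorph.univBall_apply_zero]
  rwa [heq] at h2

/-- A connected open set in dimension at least two stays connected when a point is removed. -/
lemma isPreconnected_diff_singleton (hn : 2 ≤ n) (hΩ : IsOpen Ω) (hc : IsPreconnected Ω)
    {c : En n} (hcΩ : c ∈ Ω) : IsPreconnected (Ω \ {c}) := by
  obtain ⟨r, hr, hball⟩ := Metric.isOpen_iff.1 hΩ c hcΩ
  have key : ∀ u v : Set (En n), IsOpen u → IsOpen v → Ω \ {c} ⊆ u ∪ v →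
      Ω \ {c} ∩ (u ∩ v) = ∅ → ball c r \ {c} ⊆ u → Ω \ {c} ⊆ u := by
    intro u v hu hv huv hdisj hbu
    have h1 := isPreconnected_iff_subset_of_disjoint.1 hc (u ∪ ball c r) (v \ {c})
      (hu.union isOpen_ball) (hv.sdiff isClosed_singleton) (fun x hx => by
        by_cases hxc : x = c
        · exact Or.inl (Or.inr (by rw [hxc]; exact mem_ball_self hr))
        · rcases huv ⟨hx, hxc⟩ with h | h
          · exact Or.inl (Or.inl h)
          · exact Or.inr ⟨h, hxc⟩) (by
        rw [eq_empty_iff_forall_notMem] at hdisj ⊢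
        rintro x ⟨hx, hxu, hxv, hxc⟩
        refine hdisj x ⟨⟨hx, hxc⟩, ?_, hxv⟩
        rcases hxu with h | h
        · exact h
        · exact hbu ⟨h, hxc⟩)
    rcases h1 with h1 | h1
    · intro x hx
      rcases h1 hx.1 with h | h
      · exact h
      · exact hbu ⟨h, hx.2⟩
    · exact absurd rfl (h1 hcΩ).2
  refine isPreconnected_iff_subset_of_disjoint.2 fun u v hu hv huv hdisj => ?_
  have hsub : ball c r \ {c} ⊆ Ω \ {c} := sdiff_subset_sdiff_left hball
  rcases isPreconnected_iff_subset_of_disjoint.1 (isPreconnected_ball_diff_singleton hn c hr) u v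
    hu hv (hsub.trans huv) (by
      rw [← subset_empty_iff, ← hdisj]
      exact inter_subset_inter_left _ hsub) with h | h
  · exact Or.inl (key u v hu hv huv hdisj h)
  · exact Or.inr (key v u hv hu (by rwa [union_comm]) (by rwa [inter_comm v u]) h)

lemma exists_abs_mul_test_le {f u : En n → ℝ} (hf : ContinuousOn f U)
    (hu : IsTest U u) : ∃ M, ∀ x, |f x * u x| ≤ M := by
  obtain ⟨M, hM⟩ := hu.2.1.isCompact.exists_bound_of_continuousOn
    ((hf.mono hu.2.2).mul hu.continuous.continuousOn)
  refine ⟨max M 0, fun x => ?_⟩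
  by_cases hx : x ∈ tsupport u
  · exact (hM x hx).trans (le_max_left _ _)
  · rw [image_eq_zero_of_notMem_tsupport hx]
    simp

lemma pd_comp_affine {u : En n → ℝ} (hu : Differentiable ℝ u) (a : ℝ) (c : En n) (i : Fin n)
    (x : En n) : pd i (fun x => u (a • (x - c))) x = a * pd i u (a • (x - c)) := by
  have h1 : HasFDerivAt (fun x : En n => a • (x - c)) (a • ContinuousLinearMap.id ℝ (En n)) x :=
    ((hasFDerivAt_id x).sub_const c).const_smul a
  have h2 := (hu (a • (x - c))).hasFDerivAt.comp x h1
  have h3 : HasFDerivAt (fun x => u (a • (x - c)))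
    ((fderiv ℝ u (a • (x - c))).comp (a • ContinuousLinearMap.id ℝ (En n))) x := h2
  simp [pd, h3.fderiv]

/-- Isolated points are removable for weak derivatives of continuous functions. -/
lemma IsWeakPd.of_insert (hn : 2 ≤ n) (hΩ : IsOpen Ω) {y₀ : En n}
    (hins : Ω ⊆ insert y₀ U) {f g : En n → ℝ} {i : Fin n} (hf : ContinuousOn f Ω)
    (hg : LocallyIntegrableOn g Ω) (h : IsWeakPd U i f g) : IsWeakPd Ω i f g := by
  intro η hη
  obtain ⟨χ, hχ, hχ01, W, hW, h0W, hχ1⟩ := exists_cutoff (K := {(0 : En n)}) (U := univ)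
    isCompact_singleton isOpen_univ (subset_univ _)
  have h0W' : (0 : En n) ∈ W := h0W rfl
  let a : ℕ → ℝ := fun k => (k : ℝ) + 1
  have ha : ∀ k, 0 < a k := fun k => by positivity
  let ζ : ℕ → En n → ℝ := fun k x => 1 - χ (a k • (x - y₀))
  have haff : ∀ k, ContDiff ℝ (⊤ : ℕ∞) fun x : En n => a k • (x - y₀) := fun k => by fun_prop
  have hζ : ∀ k, ContDiff ℝ (⊤ : ℕ∞) (ζ k) := fun k => contDiff_const.sub (hχ.1.comp (haff k))
  have hζ1 : ∀ k x, |ζ k x| ≤ 1 := fun k x => by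
    have := hχ01 (a k • (x - y₀))
    rw [abs_le]; constructor <;> simp only [ζ] <;> linarith
  have hpd : ∀ k x, pd i (ζ k) x = -(a k * pd i χ (a k • (x - y₀))) := fun k x => by
    have h1 : DifferentiableAt ℝ (fun x => χ (a k • (x - y₀))) x :=
      ((hχ.1.comp (haff k)).differentiable (by simp)) x
    have h2 := pd_sub (i := i) (differentiableAt_const (1 : ℝ)) h1
    rw [pd_comp_affine hχ.differentiable] at h2
    rw [h2]
    simp [pd]
  have hη' : ∀ k, IsTest U fun x => η x * ζ k x := fun k => by
    have h1 := hη.mul_right (hζ k)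
    refine ⟨h1.1, h1.2.1, fun x hx => ?_⟩
    rcases hins (h1.2.2 hx) with rfl | h2
    · exfalso
      refine notMem_tsupport_iff_eventuallyEq.2 ?_ hx
      have h3 : ∀ᶠ z in nhds x, a k • (z - x) ∈ W :=
        (haff k).continuous.continuousAt.eventually (by simpa using hW.mem_nhds h0W')
      filter_upwards [h3] with z hz
      simp [ζ, hχ1 _ hz]
    · exact h2
  have hlim : ∀ x, x ≠ y₀ → Tendsto (fun k => ζ k x) atTop (nhds 1) := by
    intro x hx
    obtain ⟨R, hR⟩ := hχ.2.1.isCompact.isBounded.subset_ball (0 : En n)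
    have hx' : 0 < ‖x - y₀‖ := norm_pos_iff.2 (sub_ne_zero.2 hx)
    obtain ⟨N, hN⟩ := exists_nat_gt (R / ‖x - y₀‖)
    refine tendsto_const_nhds.congr' ?_
    filter_upwards [eventually_ge_atTop N] with k hk
    have h1 : a k • (x - y₀) ∉ tsupport χ := fun hm => by
      have h2 := hR hm
      rw [mem_ball_zero_iff, norm_smul, Real.norm_of_nonneg (ha k).le] at h2
      rw [div_lt_iff₀ hx'] at hN
      have h3 : (N : ℝ) ≤ a k := by
        have : (N : ℝ) ≤ k := by exact_mod_cast hk
        simp only [a]; linarith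
      nlinarith
    simp [ζ, image_eq_zero_of_notMem_tsupport h1]
  have hae : ∀ᵐ x : En n, x ≠ y₀ := by
    have : NeZero n := ⟨by omega⟩
    have : Nontrivial (En n) := by
      have : Nonempty (Fin n) := ⟨0⟩
      infer_instance
    exact Measure.ae_ne volume y₀
  have hfl : LocallyIntegrableOn f Ω := hf.locallyIntegrableOn hΩ.measurableSet
  have i1 := integrable_mul_of_locallyIntegrableOn hfl (hη.pd i).continuous (hη.pd i).2.1
    (hη.pd i).2.2
  have i2 := integrable_mul_of_locallyIntegrableOn hg hη.continuous hη.2.1 hη.2.2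
  have dct : ∀ F : En n → ℝ, Integrable F →
      Tendsto (fun k => ∫ x, F x * ζ k x) atTop (nhds (∫ x, F x)) := by
    intro F hF
    refine tendsto_integral_of_dominated_convergence (fun x => ‖F x‖)
      (fun k => hF.1.mul (hζ k).continuous.aestronglyMeasurable) hF.norm
      (fun k => Eventually.of_forall fun x => ?_) ?_
    · rw [norm_mul]
      exact mul_le_of_le_one_right (norm_nonneg _) (hζ1 k x)
    · filter_upwards [hae] with x hx
      simpa using (hlim x hx).const_mul (F x)
  obtain ⟨M, hM⟩ := exists_abs_mul_test_le hf hη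
  have hpχ := hχ.pd i
  have hmid : Tendsto (fun k => ∫ x, f x * η x * pd i (ζ k) x) atTop (nhds 0) := by
    have hb : ∀ k, |∫ x, f x * η x * pd i (ζ k) x| ≤ (M * ∫ x, |pd i χ x|) * (1 / ((k : ℝ) + 1)) := by
      intro k
      have hintg : Integrable fun x : En n => M * a k * |pd i χ (a k • (x - y₀))| := by
        refine Integrable.const_mul ?_ _
        have h1 : Integrable fun x => |pd i χ x| :=
          (hpχ.continuous.integrable_of_hasCompactSupport hpχ.2.1).abs
        have h2 : Integrable fun x : En n => |pd i χ (a k • x)| := h1.comp_smul (ha k).ne'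
        exact h2.comp_sub_right y₀
      have h1 : |∫ x, f x * η x * pd i (ζ k) x| ≤ ∫ x : En n, M * a k * |pd i χ (a k • (x - y₀))| := by
        rw [← Real.norm_eq_abs]
        refine norm_integral_le_of_norm_le hintg (Eventually.of_forall fun x => ?_)
        rw [hpd, norm_mul (f x * η x), norm_neg, norm_mul (a k), Real.norm_of_nonneg (ha k).le,
          mul_assoc]
        exact mul_le_mul_of_nonneg_right (hM x) (by have := ha k; positivity)
      refine h1.trans ?_
      rw [integral_const_mul]
      have h2 : ∫ x : En n, |pd i χ (a k • (x - y₀))| = |(a k ^ n)⁻¹| * ∫ x, |pd i χ x| := by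
        rw [integral_sub_right_eq_self (fun x : En n => |pd i χ (a k • x)|) y₀,
          Measure.integral_comp_smul volume (fun x => |pd i χ x|)]
        simp
      rw [h2, abs_of_pos (inv_pos.2 (pow_pos (ha k) n))]
      have h3 : a k * (a k ^ n)⁻¹ ≤ 1 / ((k : ℝ) + 1) := by
        have h4 : 1 ≤ a k := by simp [a]
        have h5 : a k ^ 2 ≤ a k ^ n := pow_le_pow_right₀ h4 hn
        rw [mul_inv_le_iff₀ (pow_pos (ha k) n)]
        change a k ≤ 1 / a k * a k ^ n
        rw [div_mul_eq_mul_div, one_mul, le_div_iff₀ (ha k)]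
        nlinarith
      have hM0 : 0 ≤ M := (abs_nonneg _).trans (hM 0)
      have hI : 0 ≤ ∫ x, |pd i χ x| := integral_nonneg fun x => abs_nonneg _
      calc M * a k * ((a k ^ n)⁻¹ * ∫ x, |pd i χ x|)
          = (M * ∫ x, |pd i χ x|) * (a k * (a k ^ n)⁻¹) := by ring
        _ ≤ _ := mul_le_mul_of_nonneg_left h3 (mul_nonneg hM0 hI)
    refine squeeze_zero_norm hb ?_
    simpa using tendsto_one_div_add_atTop_nhds_zero_nat.const_mul (M * ∫ x, |pd i χ x|)
  have hk : ∀ k, (∫ x, f x * pd i η x * ζ k x) + ∫ x, f x * η x * pd i (ζ k) x =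
      -∫ x, g x * η x * ζ k x := by
    intro k
    have h1 := h _ (hη' k)
    rw [setIntegral_mul_test ((tsupport_pd i).trans (hη' k).2.2),
      setIntegral_mul_test (hη' k).2.2] at h1
    have j1 : Integrable fun x => f x * pd i η x * ζ k x :=
      i1.mul_bdd (c := 1) (hζ k).continuous.aestronglyMeasurable (Eventually.of_forall (hζ1 k))
    have j2 : Integrable fun x => f x * η x * pd i (ζ k) x := by
      have ht : IsTest Ω fun x => η x * pd i (ζ k) x := hη.mul_right (pd_contDiff (hζ k) i)
      have := integrable_mul_of_locallyIntegrableOn hfl ht.continuous ht.2.1 ht.2.2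
      simpa only [mul_assoc] using this
    rw [← integral_add j1 j2]
    simp only [mul_assoc] at h1 ⊢
    rw [← h1]
    refine integral_congr_ae (Eventually.of_forall fun x => ?_)
    simp only
    rw [pd_mul (hη.differentiable x) ((hζ k).differentiable (by simp) x)]
    ring
  rw [setIntegral_mul_test ((tsupport_pd i).trans hη.2.2), setIntegral_mul_test hη.2.2]
  have hL := (dct _ i1).add hmid
  have hR := (dct _ i2).neg
  simp_rw [hk, add_zero] at hL
  exact tendsto_nhds_unique hL hR
end Puncture

section Transfer
variable {n : ℕ} {U U' Ω Ω' : Set (En n)} {φ ψ : En n → En n} {p q : ℝ} {w : En n → ℝ}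

lemma enorm_coord_le (y : En n) (j : Fin n) : ‖y j‖ₑ ≤ ‖y‖ₑ :=
  enorm_le_iff_norm_le.2 (abs_coord_le y j)

lemma enorm_le_sum (y : En n) : ‖y‖ₑ ≤ ∑ j, ‖y j‖ₑ := by
  simp_rw [Real.enorm_eq_ofReal_abs]
  rw [← ENNReal.ofReal_sum_of_nonneg fun j _ => abs_nonneg _, ← ofReal_norm]
  exact ENNReal.ofReal_le_ofReal (norm_le_sum y)

lemma sum_enorm_le (y : En n) : ∑ j, ‖y j‖ₑ ≤ n * ‖y‖ₑ :=
  (Finset.sum_le_sum fun j _ => enorm_coord_le y j).trans (by simp)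

lemma IsWeakGradOn.coord {f : En n → ℝ} {g : En n → En n} (h : IsWeakGradOn Ω f g) (i : Fin n) :
    LocallyIntegrableOn (fun x => g x i) Ω ∧ IsWeakPd Ω i f (fun x => g x i) := by
  refine ⟨fun x hx => ?_, fun u hu => h.2.2 u hu.1 hu.2.1 hu.2.2 i⟩
  obtain ⟨s, hs, hI⟩ := h.2.1 x hx
  exact ⟨s, hs, hI.eval_piLp i⟩

lemma isWeakGradOn_toLp (hΩ : IsOpen Ω) {f : En n → ℝ} {g : Fin n → En n → ℝ}
    (hf : ContinuousOn f Ω) (hg : ∀ i, LocallyIntegrableOn (g i) Ω)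
    (hw : ∀ i, IsWeakPd Ω i f (g i)) :
    IsWeakGradOn Ω f fun x => WithLp.toLp 2 fun i => g i x := by
  refine ⟨hf.locallyIntegrableOn hΩ.measurableSet, ?_,
    fun u h1 h2 h3 i => hw i u ⟨h1, h2, h3⟩⟩
  rw [locallyIntegrableOn_iff hΩ.isLocallyClosed]
  intro K hK hKc
  exact Integrable.of_eval_piLp fun i =>
    (locallyIntegrableOn_iff hΩ.isLocallyClosed).1 (hg i) K hK hKc

lemma CompOpBound.compTest (hΩ' : IsOpen Ω') (hUΩ : U ⊆ Ω) (hU' : U' ⊆ Ω')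
    (hU : MeasurableSet U) (hp : 0 < p) (hq : 0 < q) (hw : ∀ x ∈ U, 0 ≤ w x) {K : ℝ≥0∞}
    (h : CompOpBound Ω Ω' φ p (fun _ => 1) q w K) : CompTest U U' φ p q w (K ^ q) := by
  intro f hf
  have hfΩ := hf.mono hU'
  have hgrad : IsWeakGradOn Ω' f fun x => WithLp.toLp 2 fun i => pd i f x :=
    isWeakGradOn_toLp hΩ' hf.continuous.continuousOn
      (fun i => (hf.pd i).continuous.continuousOn.locallyIntegrableOn hΩ'.measurableSet)
      fun i => isWeakPd_of_contDiff (hf.1.of_le (by exact_mod_cast le_top)) i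
  have hle : gradNormLp Ω' (fun _ => 1) p (fun x => WithLp.toLp 2 fun i => pd i f x) ≤
      (∫⁻ y, (∑ j, ‖pd j f y‖ₑ) ^ p) ^ (1 / p) := by
    refine ENNReal.rpow_le_rpow ((lintegral_mono fun x => ?_).trans
      (setLIntegral_le_lintegral _ _)) (by positivity)
    rw [mul_one, ofReal_norm]
    exact ENNReal.rpow_le_rpow (enorm_le_sum (n := n) (WithLp.toLp 2 fun i => pd i f x)) hp.le
  obtain ⟨g, hg, hb⟩ := h f _ hf.continuous.continuousOn hgrad (hle.trans_lt
    (ENNReal.rpow_lt_top_of_nonneg (by positivity) (lintegral_pd_lt_top hf hp).ne)).ne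
  refine ⟨fun i x => g x i, fun i => ⟨(hg.coord i).1.mono_set hUΩ, (hg.coord i).2.mono hUΩ, ?_⟩⟩
  have h1 : ∫⁻ x in U, ‖g x i * w x‖ₑ ^ q ≤ ∫⁻ x in Ω, ENNReal.ofReal (‖g x‖ * w x) ^ q := by
    refine le_trans ?_ (lintegral_mono_set hUΩ)
    refine setLIntegral_mono' hU fun x hx => ENNReal.rpow_le_rpow ?_ hq.le
    rw [enorm_mul, ENNReal.ofReal_mul (norm_nonneg _), ofReal_norm, Real.enorm_of_nonneg (hw x hx)]
    exact mul_le_mul_left (enorm_coord_le _ _) _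
  have h2 := hb.trans (mul_le_mul_right hle K)
  have h3 := ENNReal.rpow_le_rpow h2 hq.le
  rw [gradNormLp, ← ENNReal.rpow_mul, one_div_mul_cancel hq.ne', ENNReal.rpow_one,
    ENNReal.mul_rpow_of_nonneg _ _ hq.le, ← ENNReal.rpow_mul, one_div_mul_eq_div] at h3
  exact h1.trans h3

/-- Composition duality on domains whose weight degenerates at most at one removable point. -/
theorem BddCompOp.inverse_of_insert (hn : 2 ≤ n) (hq : (n : ℝ) - 1 < q) (hqp : q ≤ p)
    (hΩ' : IsOpen Ω') (hU : IsOpen U) (hU' : IsOpen U') (hUΩ : U ⊆ Ω)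
    (hUΩ' : U' ⊆ Ω') {y₀ : En n} (hins : Ω' ⊆ insert y₀ U') (hφΩ : IsHomeoOn Ω Ω' φ ψ)
    (hφ : IsHomeoOn U U' φ ψ) (hconn : IsPreconnected U') (hne : U.Nonempty) (hN : LuzinN U φ)
    (hw : ContinuousOn w U) (hwm : Measurable w) (hw0 : ∀ x ∈ U, 0 < w x) {v : En n → ℝ}
    (hv : ∀ x ∈ U, v x = w x ^ (1 - (n : ℝ)))
    (h : BddCompOp Ω Ω' φ p (fun _ => 1) q w) :
    BddCompOp Ω' Ω ψ (q / (q - n + 1)) v (p / (p - n + 1)) (fun _ => 1) := by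
  have hn' : (2 : ℝ) ≤ n := by exact_mod_cast hn
  have hq0 : 0 < q := by linarith
  have hp0 : 0 < p := by linarith
  have hqt0 : 0 < q / (q - n + 1) := div_pos hq0 (by linarith)
  have hpt1 : 1 ≤ p / (p - n + 1) := by
    rw [le_div_iff₀ (by linarith)]
    linarith
  obtain ⟨K₀, hK₀, hb⟩ := h
  obtain ⟨K, hK, hdual⟩ := CompTest.exists_dual hn hq hqp hU hU' hφ hconn hne hN
    (hb.compTest hΩ' hUΩ hUΩ' hU.measurableSet hp0 hq0 fun x hx => (hw0 x hx).le)
    (ENNReal.rpow_ne_top_of_nonneg hq0.le hK₀) hw hwm hw0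
  generalize p / (p - n + 1) = pt at *
  generalize q / (q - n + 1) = qt at *
  have hpt0 : 0 < pt := by linarith
  refine ⟨n * K * n, by finiteness, fun f gf hf hgf hfin => ?_⟩
  have hI : ∫⁻ x in U, ((∑ j, ‖gf x j‖ₑ) * ENNReal.ofReal (w x) ^ (1 - (n : ℝ))) ^ qt ≤
      (n * gradNormLp Ω v qt gf) ^ qt := by
    rw [ENNReal.mul_rpow_of_nonneg _ _ hqt0.le, gradNormLp, ← ENNReal.rpow_mul,
      one_div_mul_cancel hqt0.ne', ENNReal.rpow_one,
      ← lintegral_const_mul' _ _ (by finiteness)]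
    refine le_trans ?_ (lintegral_mono_set hUΩ)
    refine setLIntegral_mono' hU.measurableSet fun x hx => ?_
    rw [← ENNReal.mul_rpow_of_nonneg _ _ hqt0.le, ENNReal.ofReal_rpow_of_pos (hw0 x hx),
      ← hv x hx, ENNReal.ofReal_mul (norm_nonneg _), ofReal_norm, ← mul_assoc]
    exact ENNReal.rpow_le_rpow (mul_le_mul_left (sum_enorm_le _) _) hqt0.le
  have hItop : (n * gradNormLp Ω v qt gf) ^ qt ≠ ⊤ :=
    ENNReal.rpow_ne_top_of_nonneg hqt0.le (ENNReal.mul_ne_top (by finiteness) hfin)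
  obtain ⟨g, hgm, hgw, hgb⟩ := hdual f (fun j x => gf x j) (hf.mono hUΩ)
    (fun j => (hgf.coord j).1.mono_set hUΩ) (fun j => (hgf.coord j).2.mono hUΩ)
    (hI.trans_lt hItop.lt_top).ne
  have hI' := ENNReal.rpow_le_rpow hI (z := 1 / qt) (by positivity)
  rw [← ENNReal.rpow_mul, mul_one_div_cancel hqt0.ne', ENNReal.rpow_one] at hI'
  have hgb' : ∀ i, ∫⁻ y in Ω', ‖g i y‖ₑ ^ pt ≤ (K * (n * gradNormLp Ω v qt gf)) ^ pt := by
    intro i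
    have h1 : ∫⁻ y in Ω', ‖g i y‖ₑ ^ pt ≤ ∫⁻ y in U', ‖g i y‖ₑ ^ pt := by
      have : NeZero n := ⟨by omega⟩
      have : Nonempty (Fin n) := ⟨0⟩
      rw [← setLIntegral_congr (insert_ae_eq_self y₀ U')]
      exact lintegral_mono_set hins
    exact h1.trans ((hgb i).trans
      (ENNReal.rpow_le_rpow (mul_le_mul_right hI' K) hpt0.le))
  have hgloc : ∀ i, LocallyIntegrableOn (g i) Ω' := fun i =>
    locallyIntegrableOn_of_memLp hΩ' (q := ENNReal.ofReal pt) (by simpa using hpt1)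
      fun L hL _ => ⟨(hgm i).aestronglyMeasurable, by
        rw [eLpNorm_lt_top_iff_lintegral_rpow_enorm_lt_top (by simpa using hpt0) (by simp),
          ENNReal.toReal_ofReal hpt0.le]
        exact (lintegral_mono_set hL).trans_lt ((hgb' i).trans_lt
          (ENNReal.rpow_lt_top_of_nonneg hpt0.le (ENNReal.mul_ne_top hK
            (ENNReal.mul_ne_top (by finiteness) hfin))))⟩
  have hfψ : ContinuousOn (f ∘ ψ) Ω' := hf.comp hφΩ.2.1 hφΩ.2.2.2.1
  refine ⟨fun y => WithLp.toLp 2 fun i => g i y, isWeakGradOn_toLp hΩ' hfψ hgloc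
    fun i => (hgw i).of_insert hn hΩ' hins hfψ (hgloc i), ?_⟩
  have hsum : ∫⁻ y in Ω', ENNReal.ofReal (‖(WithLp.toLp 2 fun i => g i y : En n)‖ * 1) ^ pt ≤
      (n * (K * (n * gradNormLp Ω v qt gf))) ^ pt := by
    calc _ ≤ ∫⁻ y in Ω', (n : ℝ≥0∞) ^ (pt - 1) * ∑ i, ‖g i y‖ₑ ^ pt := by
          refine lintegral_mono fun y => ?_
          rw [mul_one, ofReal_norm]
          refine (ENNReal.rpow_le_rpow (enorm_le_sum _) hpt0.le).trans ?_
          have := ENNReal.rpow_sum_le_const_mul_sum_rpow Finset.univ (fun i => ‖g i y‖ₑ) hpt1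
          simpa using this
      _ = (n : ℝ≥0∞) ^ (pt - 1) * ∑ i, ∫⁻ y in Ω', ‖g i y‖ₑ ^ pt := by
          rw [lintegral_const_mul' _ _ (ENNReal.rpow_ne_top_of_nonneg (by linarith) (by simp)),
            lintegral_finsetSum _ fun i _ => (hgm i).enorm.pow_const _]
      _ ≤ (n : ℝ≥0∞) ^ (pt - 1) * (n * (K * (n * gradNormLp Ω v qt gf)) ^ pt) := by
          refine mul_le_mul_right ?_ _
          refine (Finset.sum_le_sum fun i _ => hgb' i).trans ?_
          simp
      _ = _ := by
          have h1 : (n : ℝ≥0∞) ≠ 0 := by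
            have : n ≠ 0 := by omega
            exact_mod_cast this
          rw [ENNReal.mul_rpow_of_nonneg (n : ℝ≥0∞) _ hpt0.le, ← mul_assoc]
          congr 1
          nth_rewrite 2 [← ENNReal.rpow_one (n : ℝ≥0∞)]
          rw [← ENNReal.rpow_add _ _ h1 (by simp)]
          ring_nf
  have h2 := ENNReal.rpow_le_rpow hsum (z := 1 / pt) (by positivity)
  rw [← ENNReal.rpow_mul _ pt, mul_one_div_cancel hpt0.ne', ENNReal.rpow_one] at h2
  refine h2.trans (le_of_eq ?_)
  ring

lemma IsHomeoOn.diff_singleton (h : IsHomeoOn Ω Ω' φ ψ) {x₀ : En n} (hx₀ : x₀ ∈ Ω) :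
    IsHomeoOn (Ω \ {x₀}) (Ω' \ {φ x₀}) φ ψ := by
  obtain ⟨h1, h2, h3, h4, h5, h6⟩ := h
  refine ⟨h1.mono sdiff_subset, h2.mono sdiff_subset, fun x hx => ⟨h3 hx.1, fun he => hx.2 ?_⟩,
    fun y hy => ⟨h4 hy.1, fun he => hy.2 ?_⟩, fun x hx => h5 x hx.1, fun y hy => h6 y hy.1⟩
  · have he' : φ x = φ x₀ := he
    rw [mem_singleton_iff, ← h5 x hx.1, he', h5 x₀ hx₀]
  · have he' : ψ y = x₀ := he
    rw [mem_singleton_iff, ← he', h6 y hy.1]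
end Transfer

/-- Composition duality for power weights: if `−n/q < α < n/(q̃(n−1))`,
`n−1 < q ≤ p < ∞`, and a homeomorphism `φ : Ω → Ω̃` has the Luzin N-property and generates
a bounded composition operator `φ* : L¹_p(Ω̃) → L¹_q(Ω,|x|^α)`, then `φ⁻¹` generates a
bounded composition operator `(φ⁻¹)* : L¹_{q̃}(Ω,|x|^{α(1−n)}) → L¹_{p̃}(Ω̃)`. -/
theorem composition_duality_power_weight
    (n : ℕ) (hn : 2 ≤ n) (Ω Ω' : Set (En n))
    (hΩ : IsDomainSet Ω) (hΩ' : IsDomainSet Ω')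
    (p q : ℝ) (hq : (n : ℝ) - 1 < q) (hqp : q ≤ p)
    (qt pt : ℝ) (hqt : qt = q / (q - n + 1)) (hpt : pt = p / (p - n + 1))
    (α : ℝ) (hα₁ : -(n : ℝ) / q < α) (hα₂ : α < (n : ℝ) / (qt * (n - 1)))
    (φ ψ : En n → En n) (hφ : IsHomeoOn Ω Ω' φ ψ)
    (hN : LuzinN Ω φ)
    (hbdd : BddCompOp Ω Ω' φ p (fun _ => 1) q (fun x => ‖x‖ ^ α)) :
    BddCompOp Ω' Ω ψ qt (fun x => ‖x‖ ^ (α * (1 - (n : ℝ)))) pt (fun _ => 1) := by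
  subst hqt hpt
  have hn' : (2 : ℝ) ≤ n := by exact_mod_cast hn
  have hwm : Measurable fun x : En n => ‖x‖ ^ α := measurable_norm.pow_const _
  have hw : ∀ U : Set (En n), (0 : En n) ∉ U → ContinuousOn (fun x : En n => ‖x‖ ^ α) U :=
    fun U hU => continuous_norm.continuousOn.rpow_const fun x hx =>
      Or.inl (norm_ne_zero_iff.2 fun h => hU (h ▸ hx))
  have hw0 : ∀ U : Set (En n), (0 : En n) ∉ U → ∀ x ∈ U, 0 < ‖x‖ ^ α := fun U hU x hx =>
    Real.rpow_pos_of_pos (norm_pos_iff.2 fun h => hU (h ▸ hx)) _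
  have hv : ∀ x : En n, ‖x‖ ^ (α * (1 - (n : ℝ))) = (‖x‖ ^ α) ^ (1 - (n : ℝ)) := fun x =>
    Real.rpow_mul (norm_nonneg x) _ _
  by_cases h0 : (0 : En n) ∈ Ω
  · have hne : (Ω \ {0}).Nonempty := by
      have : NeZero n := ⟨by omega⟩
      have : Nonempty (Fin n) := ⟨0⟩
      have h1 : (Ω ∩ {(0 : En n)}ᶜ).Nonempty :=
        (dense_compl_singleton (0 : En n)).inter_open_nonempty Ω hΩ.1 ⟨0, h0⟩
      exact h1
    exact BddCompOp.inverse_of_insert (y₀ := φ 0) hn hq hqp hΩ'.1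
      (hΩ.1.sdiff isClosed_singleton) (hΩ'.1.sdiff isClosed_singleton) sdiff_subset sdiff_subset
      (fun y hy => by
        by_cases h : y = φ 0
        · exact Or.inl h
        · exact Or.inr ⟨hy, h⟩) hφ (hφ.diff_singleton h0)
      (isPreconnected_diff_singleton hn hΩ'.1 hΩ'.2.isPreconnected (hφ.2.2.1 h0)) hne
      (fun E hE => hN E (hE.trans sdiff_subset)) (hw _ fun h => h.2 rfl) hwm
      (hw0 _ fun h => h.2 rfl) (fun x _ => hv x) hbdd
  · exact BddCompOp.inverse_of_insert (y₀ := 0) hn hq hqp hΩ'.1 hΩ.1 hΩ'.1 le_rfl le_rfl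
      (subset_insert _ _) hφ hφ hΩ'.2.isPreconnected hΩ.2.nonempty hN (hw _ h0) hwm
      (hw0 _ h0) (fun x _ => hv x) hbdd
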